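/- Suppose there is a constant c₀ > 0 such that β_n ≥ c₀·log n for all sufficiently large n. Then P-almost surely, for x = 2 and for x = −2 one has lim_{L→∞} limsup_{n→∞} #_n[B(x, (L/n)^{2/3})]/L = 2/(3π) and lim_{L→∞} liminf_{n→∞} #_n[B(x, (L/n)^{2/3})]/L = 2/(3π). -/

import Mathlib

open MeasureTheory Filter Topology
open scoped ENNReal

/-- The (unnormalized) density of the Gaussian beta-ensemble with potential `x^2/2`. -/
noncomputable def gaussianDensity (n : ℕ) (β : ℝ) (x : Fin n → ℝ) : ℝ :=
  (∏ p ∈ Finset.univ.filter (fun p : Fin n × Fin n => p.1 < p.2), |x p.1 - x p.2| ^ β) *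
    Real.exp (-((n : ℝ) * β / 2) * ∑ j, (x j) ^ 2 / 2)

/-- The number of points of the configuration `x` lying in the set `I`. -/
noncomputable def countIn (n : ℕ) (x : Fin n → ℝ) (I : Set ℝ) : ℕ :=
  {j : Fin n | x j ∈ I}.ncard

/-- Bernstein-Walsh inequality for polynomials with Gaussian weight, in the coordinate
`z = ω + ω⁻¹` exterior to `[-2, 2]`. -/
theorem bernstein_walsh {n : ℕ} {P : Polynomial ℂ} (hP : P.natDegree ≤ n) {M : ℝ}
    (hM : ∀ t ∈ Set.Icc (-2 : ℝ) 2, ‖P.eval (t : ℂ)‖ * Real.exp (-(n * t ^ 2 / 4)) ≤ M)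
    {ω : ℂ} (hω0 : ω ≠ 0) (hω1 : ‖ω‖ ≤ 1) :
    ‖P.eval (ω + ω⁻¹)‖ ≤ M * ‖ω‖⁻¹ ^ n * Real.exp (n * ((ω ^ 2).re + 1) / 2) := by
  set R : ℂ → ℂ := fun w => ∑ i ∈ Finset.range (n + 1), P.coeff i * (w ^ (n - i) * (w ^ 2 + 1) ^ i)
    with hR
  have hRP : ∀ w : ℂ, w ≠ 0 → R w = w ^ n * P.eval (w + w⁻¹) := by
    intro w hw
    rw [Polynomial.eval_eq_sum_range' (Nat.lt_succ_of_le hP), Finset.mul_sum]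
    refine Finset.sum_congr rfl fun i hi => ?_
    have hi' : i ≤ n := Nat.lt_succ_iff.mp (Finset.mem_range.mp hi)
    have h1 : w ^ n = w ^ (n - i) * w ^ i := by rw [← pow_add]; congr 1; omega
    have h2 : w ^ 2 + 1 = w * (w + w⁻¹) := by field_simp
    rw [h1, h2, mul_pow]; ring
  set Φ : ℂ → ℂ := fun w => R w * Complex.exp (-(n * (w ^ 2 + 1) / 2)) with hΦ
  have hd : Differentiable ℂ Φ := by
    rw [hΦ, hR]; fun_prop
  have hb : ∀ w ∈ frontier (Metric.ball (0 : ℂ) 1), ‖Φ w‖ ≤ M := by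
    intro w hw
    rw [frontier_ball (0 : ℂ) one_ne_zero] at hw
    have hw1 : ‖w‖ = 1 := by simpa using hw
    have hw0 : w ≠ 0 := by rintro rfl; simp at hw1
    have hinv : w⁻¹ = (starRingEnd ℂ) w := by
      rw [Complex.inv_def, Complex.normSq_eq_norm_sq, hw1]; simp
    have hsum : w + w⁻¹ = ((2 * w.re : ℝ) : ℂ) := by
      rw [hinv, Complex.add_conj]
    have hre : |w.re| ≤ 1 := hw1 ▸ Complex.abs_re_le_norm w
    have hre' := abs_le.mp hre
    have hsq : (w ^ 2).re = 2 * w.re ^ 2 - 1 := by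
      have h := Complex.sq_norm w
      rw [hw1, Complex.normSq_apply] at h
      rw [pow_two, Complex.mul_re]; nlinarith
    have := hM (2 * w.re) ⟨by linarith, by linarith⟩
    rw [hΦ]
    simp only
    rw [norm_mul, hRP w hw0, norm_mul, norm_pow, hw1, one_pow, one_mul, hsum, Complex.norm_exp]
    have he : (-((n : ℂ) * (w ^ 2 + 1) / 2)).re = -(n * (2 * w.re) ^ 2 / 4) := by
      have : (-((n : ℂ) * (w ^ 2 + 1) / 2)).re = -(n * ((w ^ 2).re + 1) / 2) := by
        rw [show (n : ℂ) * (w ^ 2 + 1) / 2 = ((n / 2 : ℝ) : ℂ) * (w ^ 2 + 1) by push_cast; ring]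
        rw [Complex.neg_re, Complex.re_ofReal_mul]; simp; ring
      rw [this, hsq]; ring
    rw [he]; exact this
  have hmain : ‖Φ ω‖ ≤ M :=
    Complex.norm_le_of_forall_mem_frontier_norm_le Metric.isBounded_ball hd.diffContOnCl hb
      (by rw [closure_ball (0 : ℂ) one_ne_zero]; simpa using hω1)
  rw [hΦ] at hmain
  simp only at hmain
  have he : (-((n : ℂ) * (ω ^ 2 + 1) / 2)).re = -(n * ((ω ^ 2).re + 1) / 2) := by
    rw [show (n : ℂ) * (ω ^ 2 + 1) / 2 = ((n / 2 : ℝ) : ℂ) * (ω ^ 2 + 1) by push_cast; ring]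
    rw [Complex.neg_re, Complex.re_ofReal_mul]; simp; ring
  rw [norm_mul, hRP ω hω0, norm_mul, norm_pow, Complex.norm_exp, he, Real.exp_neg] at hmain
  have hpos : 0 < ‖ω‖ := norm_pos_iff.mpr hω0
  rw [← div_eq_mul_inv, div_le_iff₀ (Real.exp_pos _)] at hmain
  rw [inv_pow]
  calc ‖P.eval (ω + ω⁻¹)‖ = (‖ω‖ ^ n * ‖P.eval (ω + ω⁻¹)‖) * (‖ω‖ ^ n)⁻¹ := by field_simp
    _ ≤ (M * Real.exp (n * ((ω ^ 2).re + 1) / 2)) * (‖ω‖ ^ n)⁻¹ := by gcongr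
    _ = _ := by ring

/-- Weighted form of the Bernstein-Walsh inequality. -/
theorem bernstein_walsh_weighted {n : ℕ} {P : Polynomial ℂ} (hP : P.natDegree ≤ n) {M : ℝ}
    (hM : ∀ t ∈ Set.Icc (-2 : ℝ) 2, ‖P.eval (t : ℂ)‖ * Real.exp (-(n * t ^ 2 / 4)) ≤ M)
    {ω : ℂ} (hω0 : ω ≠ 0) (hω1 : ‖ω‖ ≤ 1) :
    ‖P.eval (ω + ω⁻¹) * Complex.exp (-(n * (ω + ω⁻¹) ^ 2 / 4))‖ ≤
      M * ‖ω‖⁻¹ ^ n * Real.exp (n * ((ω ^ 2).re - ((ω⁻¹) ^ 2).re) / 4) := by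
  have h := bernstein_walsh hP hM hω0 hω1
  have he : (-((n : ℂ) * (ω + ω⁻¹) ^ 2 / 4)).re
      = -(n * ((ω ^ 2).re + 2 + ((ω⁻¹) ^ 2).re) / 4) := by
    have : (ω + ω⁻¹) ^ 2 = ω ^ 2 + 2 + (ω⁻¹) ^ 2 := by field_simp; ring
    rw [this, show (n : ℂ) * (ω ^ 2 + 2 + (ω⁻¹) ^ 2) / 4
      = ((n / 4 : ℝ) : ℂ) * (ω ^ 2 + 2 + (ω⁻¹) ^ 2) by push_cast; ring]
    rw [Complex.neg_re, Complex.re_ofReal_mul]; simp; ring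
  rw [norm_mul, Complex.norm_exp, he]
  calc _ ≤ (M * ‖ω‖⁻¹ ^ n * Real.exp (n * ((ω ^ 2).re + 1) / 2)) *
        Real.exp (-(n * ((ω ^ 2).re + 2 + ((ω⁻¹) ^ 2).re) / 4)) := by gcongr
    _ = _ := by
      rw [mul_assoc, ← Real.exp_add]; congr 2; ring

theorem complex_sqrt_sq (z : ℂ) : Complex.sqrt z ^ 2 = z := by
  rw [Complex.sqrt, show (2⁻¹ : ℂ) = ((2 : ℕ) : ℂ)⁻¹ by norm_num]
  exact Complex.cpow_nat_inv_pow z two_ne_zero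

theorem complex_sqrt_re_nonneg (z : ℂ) : 0 ≤ (Complex.sqrt z).re := by
  rw [Complex.sqrt, Complex.cpow_inv_two_re]; positivity

theorem complex_sqrt_re_pos {z : ℂ} (hz : z ∈ Complex.slitPlane) : 0 < (Complex.sqrt z).re := by
  rw [Complex.sqrt, Complex.cpow_inv_two_re]
  apply Real.sqrt_pos.mpr
  have : -z.re < ‖z‖ := by
    rcases hz with h | h
    · have := norm_nonneg z; linarith
    · exact lt_of_le_of_lt (neg_le_abs _) (Complex.abs_re_lt_norm.mpr h)
  linarith

/-- The second square root in the uniformization `z = 2 + σ²` of the edge. -/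
noncomputable def edgeRoot (σ : ℂ) : ℂ := Complex.sqrt (4 + σ ^ 2)

/-- The primitive of `-σ² √(4 + σ²)` vanishing at `0`. -/
noncomputable def edgeH (σ : ℂ) : ℂ :=
  2 * Complex.log ((σ + edgeRoot σ) / 2) - σ * edgeRoot σ * (σ ^ 2 + 2) / 4

theorem edgeRoot_sq (σ : ℂ) : edgeRoot σ ^ 2 = 4 + σ ^ 2 := complex_sqrt_sq _

theorem hasDerivAt_edgeRoot {σ : ℂ} (h : 4 + σ ^ 2 ∈ Complex.slitPlane) :
    HasDerivAt edgeRoot (σ / edgeRoot σ) σ := by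
  have hne : edgeRoot σ ≠ 0 := by
    intro h0
    have := edgeRoot_sq σ
    rw [h0] at this
    exact Complex.slitPlane_ne_zero h (by rw [← this]; simp)
  have hd : DifferentiableAt ℂ edgeRoot σ := by
    unfold edgeRoot
    exact DifferentiableAt.comp (f := fun τ : ℂ => 4 + τ ^ 2) σ (Complex.differentiableAt_sqrt h) (by fun_prop)
  have h1 := hd.hasDerivAt.pow 2
  have h2 : HasDerivAt (fun τ : ℂ => 4 + τ ^ 2) (2 * σ) σ := by
    simpa using ((hasDerivAt_id σ).pow 2).const_add 4
  have h3 : (fun τ : ℂ => 4 + τ ^ 2) = edgeRoot ^ 2 := by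
    ext τ; simp [edgeRoot_sq]
  rw [h3] at h2
  have h4 := h1.unique h2
  have h5 : deriv edgeRoot σ = σ / edgeRoot σ := by
    rw [eq_div_iff hne]
    have : (2 : ℂ) * (deriv edgeRoot σ * edgeRoot σ) = 2 * σ := by rw [← h4]; push_cast; ring
    exact mul_left_cancel₀ two_ne_zero this
  rw [← h5]; exact hd.hasDerivAt

theorem hasDerivAt_edgeH {σ : ℂ} (h : 4 + σ ^ 2 ∈ Complex.slitPlane)
    (h' : 0 < (σ + edgeRoot σ).re) : HasDerivAt edgeH (-(σ ^ 2 * edgeRoot σ)) σ := by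
  have hne : edgeRoot σ ≠ 0 := by
    intro h0
    have := edgeRoot_sq σ
    rw [h0] at this
    exact Complex.slitPlane_ne_zero h (by rw [← this]; simp)
  have hs := edgeRoot_sq σ
  have hr := hasDerivAt_edgeRoot h
  have hv : (σ + edgeRoot σ) ≠ 0 := by intro h0; rw [h0] at h'; simp at h'
  have hsl : (σ + edgeRoot σ) / 2 ∈ Complex.slitPlane := by
    left
    have : ((σ + edgeRoot σ) / 2).re = (σ + edgeRoot σ).re / 2 := by
      simp
    rw [this]; linarith
  have h1 := ((((hasDerivAt_id σ).add hr).div_const 2).clog hsl).const_mul 2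
  have h2 := ((((hasDerivAt_id σ).mul hr).mul (((hasDerivAt_id σ).pow 2).add_const 2))).div_const 4
  have h3 := h1.sub h2
  refine h3.congr_deriv ?_
  simp only [id, Pi.add_apply, Pi.mul_apply, Pi.pow_apply]
  set s := edgeRoot σ
  field_simp
  push_cast
  linear_combination (s + σ) * (σ ^ 2 - 2) * hs

theorem edgeRoot_re_pos {σ : ℂ} (h : 4 + σ ^ 2 ∈ Complex.slitPlane) : 0 < (edgeRoot σ).re :=
  complex_sqrt_re_pos h

theorem four_add_sq_mem_slitPlane {σ : ℂ} (h : ‖σ‖ ≤ 1) : 4 + σ ^ 2 ∈ Complex.slitPlane := by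
  left
  have : |(σ ^ 2).re| ≤ 1 := by
    refine (Complex.abs_re_le_norm _).trans ?_
    rw [norm_pow]; exact pow_le_one₀ (norm_nonneg _) h
  have := (abs_le.mp this).1
  have h4 : (4 + σ ^ 2).re = 4 + (σ ^ 2).re := by simp
  rw [h4]; linarith

theorem norm_edgeRoot_sub_two_le {σ : ℂ} (h : ‖σ‖ ≤ 1) : ‖edgeRoot σ - 2‖ ≤ ‖σ‖ ^ 2 / 2 := by
  have hp := edgeRoot_re_pos (four_add_sq_mem_slitPlane h)
  have h1 : (edgeRoot σ - 2) * (edgeRoot σ + 2) = σ ^ 2 := by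
    linear_combination edgeRoot_sq σ
  have h2 : 2 ≤ ‖edgeRoot σ + 2‖ := by
    refine le_trans ?_ (Complex.re_le_norm _)
    simp; linarith
  have h3 := congrArg norm h1
  rw [norm_mul, norm_pow] at h3
  nlinarith [norm_nonneg (edgeRoot σ - 2)]

theorem edgeRoot_add_re_pos {σ : ℂ} (h : ‖σ‖ ≤ 1) : 0 < (σ + edgeRoot σ).re := by
  have h1 := norm_edgeRoot_sub_two_le h
  have h2 := (abs_le.mp ((Complex.abs_re_le_norm (edgeRoot σ - 2)).trans h1)).1
  have h3 := (abs_le.mp ((Complex.abs_re_le_norm σ).trans h)).1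
  simp only [Complex.sub_re, Complex.re_ofNat, Complex.add_re] at *
  nlinarith [norm_nonneg σ]

theorem edgeRoot_zero : edgeRoot 0 = 2 := by
  have h := norm_edgeRoot_sub_two_le (σ := 0) (by simp)
  simpa [sub_eq_zero] using h

theorem edgeH_zero : edgeH 0 = 0 := by
  simp [edgeH, edgeRoot_zero]

theorem norm_edgeH_le {σ : ℂ} (h : ‖σ‖ ≤ 1) : ‖edgeH σ‖ ≤ 3 * ‖σ‖ ^ 3 := by
  have := Convex.norm_image_sub_le_of_norm_hasDerivWithin_le (𝕜 := ℂ) (f := edgeH)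
    (f' := fun τ => -(τ ^ 2 * edgeRoot τ)) (C := 3 * ‖σ‖ ^ 2) (s := Metric.closedBall (0 : ℂ) ‖σ‖)
    (x := 0) (y := σ) ?_ ?_ (convex_closedBall _ _) (by simp) (by simp)
  · rw [edgeH_zero, sub_zero, sub_zero] at this
    linarith [show 3 * ‖σ‖ ^ 2 * ‖σ‖ = 3 * ‖σ‖ ^ 3 by ring]
  · intro τ hτ
    have hτ' : ‖τ‖ ≤ ‖σ‖ := by simpa using hτ
    exact (hasDerivAt_edgeH (four_add_sq_mem_slitPlane (hτ'.trans h))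
      (edgeRoot_add_re_pos (hτ'.trans h))).hasDerivWithinAt
  · intro τ hτ
    have hτ' : ‖τ‖ ≤ ‖σ‖ := by simpa using hτ
    have h1 := norm_edgeRoot_sub_two_le (hτ'.trans h)
    have h2 : ‖edgeRoot τ‖ ≤ 3 := by
      have h3 : ‖edgeRoot τ‖ ≤ ‖edgeRoot τ - 2‖ + ‖(2 : ℂ)‖ := by
        simpa using norm_add_le (edgeRoot τ - 2) 2
      have h4 : ‖τ‖ ^ 2 ≤ 1 := pow_le_one₀ (norm_nonneg _) (hτ'.trans h)
      have h5 : ‖(2 : ℂ)‖ = 2 := by simp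
      linarith
    rw [norm_neg, norm_mul, norm_pow]
    calc ‖τ‖ ^ 2 * ‖edgeRoot τ‖ ≤ ‖σ‖ ^ 2 * 3 := by gcongr
      _ = _ := by ring

theorem norm_edgeH_add_le {σ : ℂ} (h : ‖σ‖ ≤ 1) : ‖edgeH σ + 2 / 3 * σ ^ 3‖ ≤ ‖σ‖ ^ 5 := by
  have := Convex.norm_image_sub_le_of_norm_hasDerivWithin_le (𝕜 := ℂ)
    (f := fun τ => edgeH τ + 2 / 3 * τ ^ 3)
    (f' := fun τ => -(τ ^ 2 * (edgeRoot τ - 2))) (C := ‖σ‖ ^ 4)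
    (s := Metric.closedBall (0 : ℂ) ‖σ‖)
    (x := 0) (y := σ) ?_ ?_ (convex_closedBall _ _) (by simp) (by simp)
  · simp only [edgeH_zero, sub_zero] at this
    norm_num at this
    linarith [show ‖σ‖ ^ 4 * ‖σ‖ = ‖σ‖ ^ 5 by ring]
  · intro τ hτ
    have hτ' : ‖τ‖ ≤ ‖σ‖ := by simpa using hτ
    have h1 := (hasDerivAt_edgeH (four_add_sq_mem_slitPlane (hτ'.trans h))
      (edgeRoot_add_re_pos (hτ'.trans h)))
    have h2 := ((hasDerivAt_id τ).pow 3).const_mul (2 / 3 : ℂ)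
    refine ((h1.add h2).congr_deriv ?_).hasDerivWithinAt
    simp; ring
  · intro τ hτ
    have hτ' : ‖τ‖ ≤ ‖σ‖ := by simpa using hτ
    have h1 := norm_edgeRoot_sub_two_le (hτ'.trans h)
    rw [norm_neg, norm_mul, norm_pow]
    calc ‖τ‖ ^ 2 * ‖edgeRoot τ - 2‖ ≤ ‖σ‖ ^ 2 * (‖σ‖ ^ 2) := by
          have : ‖τ‖ ^ 2 ≤ ‖σ‖ ^ 2 := by gcongr
          gcongr
          nlinarith [sq_nonneg ‖σ‖]
      _ = _ := by ring

theorem slit_of_nonneg (x : ℝ) : 4 + (x : ℂ) ^ 2 ∈ Complex.slitPlane := by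
  left
  have : (4 + (x : ℂ) ^ 2) = ((4 + x ^ 2 : ℝ) : ℂ) := by push_cast; ring
  rw [this, Complex.ofReal_re]; positivity

theorem edgeRoot_ofReal (x : ℝ) : edgeRoot x = ((√(4 + x ^ 2) : ℝ) : ℂ) := by
  have h1 : (4 + (x : ℂ) ^ 2) = ((4 + x ^ 2 : ℝ) : ℂ) := by push_cast; ring
  have h2 : edgeRoot x ^ 2 = ((√(4 + x ^ 2) : ℝ) : ℂ) ^ 2 := by
    rw [edgeRoot_sq, h1, ← Complex.ofReal_pow, Real.sq_sqrt (by positivity)]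
  rcases sq_eq_sq_iff_eq_or_eq_neg.mp h2 with h | h
  · exact h
  · have h3 := edgeRoot_re_pos (slit_of_nonneg x)
    rw [h, Complex.neg_re, Complex.ofReal_re] at h3
    have := Real.sqrt_nonneg (4 + x ^ 2)
    linarith

theorem edgeH_ofReal_re_le {x : ℝ} (hx : 0 ≤ x) : (edgeH x).re ≤ -(2 / 3) * x ^ 3 := by
  have hd : ∀ y : ℝ, 0 ≤ y → HasDerivAt (fun y : ℝ => (edgeH y).re + 2 / 3 * y ^ 3)
      (-(y ^ 2 * √(4 + y ^ 2)) + 2 * y ^ 2) y := by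
    intro y hy
    have h1 := hasDerivAt_edgeH (slit_of_nonneg y) (by
      rw [Complex.add_re, Complex.ofReal_re]
      have := edgeRoot_re_pos (slit_of_nonneg y); linarith)
    have h2 := h1.real_of_complex
    have h3 := h2.add (((hasDerivAt_id y).pow 3).const_mul (2 / 3 : ℝ))
    refine h3.congr_deriv ?_
    rw [edgeRoot_ofReal, ← Complex.ofReal_pow, ← Complex.ofReal_mul, ← Complex.ofReal_neg,
      Complex.ofReal_re]
    simp; ring
  have hanti : AntitoneOn (fun y : ℝ => (edgeH y).re + 2 / 3 * y ^ 3) (Set.Ici 0) := by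
    apply antitoneOn_of_deriv_nonpos (convex_Ici 0)
    · exact fun y hy => (hd y hy).continuousAt.continuousWithinAt
    · intro y hy
      rw [interior_Ici] at hy
      exact (hd y (le_of_lt hy)).differentiableAt.differentiableWithinAt
    · intro y hy
      rw [interior_Ici] at hy
      rw [(hd y (le_of_lt hy)).deriv]
      have : 2 ≤ √(4 + y ^ 2) := Real.le_sqrt_of_sq_le (by nlinarith [sq_nonneg y])
      nlinarith [sq_nonneg y]
  have := hanti (Set.mem_Ici.mpr le_rfl) (Set.mem_Ici.mpr hx) hx
  simp only [Complex.ofReal_zero, edgeH_zero] at this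
  norm_num at this
  linarith

/-- The Bernstein-Walsh inequality in the edge coordinate. -/
theorem bernstein_walsh_edge {n : ℕ} {P : Polynomial ℂ} (hP : P.natDegree ≤ n) {M : ℝ}
    (hM : ∀ t ∈ Set.Icc (-2 : ℝ) 2, ‖P.eval (t : ℂ)‖ * Real.exp (-(n * t ^ 2 / 4)) ≤ M)
    {σ : ℂ} (hσ : 0 ≤ σ.re) (h : 4 + σ ^ 2 ∈ Complex.slitPlane) :
    ‖P.eval (2 + σ ^ 2) * Complex.exp (-(n * (2 + σ ^ 2) ^ 2 / 4))‖ ≤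
      M * Real.exp (n * (edgeH σ).re) := by
  have hs := edgeRoot_sq σ
  have hp := edgeRoot_re_pos h
  have hH : edgeH σ = 2 * Complex.log ((σ + edgeRoot σ) / 2)
      - σ * edgeRoot σ * (σ ^ 2 + 2) / 4 := rfl
  set s := edgeRoot σ
  set v : ℂ := (σ + s) / 2 with hv
  set u : ℂ := (s - σ) / 2 with hu
  have hvu : v * u = 1 := by rw [hv, hu]; linear_combination hs / 4
  have hv0 : v ≠ 0 := left_ne_zero_of_mul_eq_one hvu
  have hu0 : u ≠ 0 := right_ne_zero_of_mul_eq_one hvu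
  have hinv : u⁻¹ = v := by field_simp; linear_combination -hvu
  have him : s.im * s.re = σ.im * σ.re := by
    have := congrArg Complex.im hs
    simp [sq] at this; linarith
  have hinner : 0 ≤ σ.re * s.re + σ.im * s.im := by
    have : 0 ≤ (σ.im * s.im) * s.re := by
      have : (σ.im * s.im) * s.re = σ.im ^ 2 * σ.re := by linear_combination σ.im * him
      rw [this]; positivity
    have h2 : 0 ≤ σ.im * s.im := nonneg_of_mul_nonneg_left this hp
    have := mul_nonneg hσ hp.le
    linarith
  have hle : ‖u‖ ≤ ‖v‖ := by
    have : ‖u‖ ^ 2 ≤ ‖v‖ ^ 2 := by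
      rw [← Complex.normSq_eq_norm_sq, ← Complex.normSq_eq_norm_sq, Complex.normSq_apply,
        Complex.normSq_apply, hu, hv]
      simp; nlinarith
    exact le_of_sq_le_sq this (norm_nonneg _) 
  have hn : ‖v‖ * ‖u‖ = 1 := by rw [← norm_mul, hvu, norm_one]
  have hu1 : ‖u‖ ≤ 1 := by nlinarith [norm_nonneg u]
  have key := bernstein_walsh_weighted hP hM (ω := u ^ 2) (pow_ne_zero 2 hu0)
    (by rw [norm_pow]; exact pow_le_one₀ (norm_nonneg _) hu1)
  have hω : u ^ 2 + (u ^ 2)⁻¹ = 2 + σ ^ 2 := by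
    rw [← inv_pow, hinv, hu, hv]; linear_combination hs / 2
  rw [hω] at key
  refine key.trans (le_of_eq ?_)
  have hM0 : ‖u ^ 2‖⁻¹ ^ n = Real.exp (n * (2 * Complex.log v).re) := by
    have : (2 * Complex.log v).re = 2 * Real.log ‖v‖ := by
      rw [← Complex.log_re]; simp
    rw [this, ← norm_inv, ← inv_pow, hinv, norm_pow, Real.exp_nat_mul, two_mul, Real.exp_add,
      Real.exp_log (norm_pos_iff.mpr hv0), sq]
  rw [mul_assoc, hM0, ← Real.exp_add]
  congr 2
  have h4 : (u ^ 2) ^ 2 - ((u ^ 2)⁻¹) ^ 2 = -(σ * s * (σ ^ 2 + 2)) := by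
    rw [← inv_pow, hinv, hu, hv]; linear_combination (-(σ*s)/2) * hs
  have h5 : ((u ^ 2) ^ 2).re - (((u ^ 2)⁻¹) ^ 2).re = -(σ * s * (σ ^ 2 + 2)).re := by
    rw [← Complex.sub_re, h4, Complex.neg_re]
  have h6 : (σ * s * (σ ^ 2 + 2) / 4).re = (σ * s * (σ ^ 2 + 2)).re / 4 := by
    rw [show (4 : ℂ) = ((4 : ℝ) : ℂ) by norm_num, Complex.div_ofReal_re]
  rw [h5, hH, Complex.sub_re, h6]
  ring

/-- The weighted Lagrange basis function at the node `x j`, extended to the complex plane. -/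
noncomputable def weightedLagrange (n : ℕ) (x : Fin n → ℝ) (j : Fin n) (z : ℂ) : ℂ :=
  (∏ k ∈ Finset.univ.erase j, (z - x k) / (x j - x k)) *
    Complex.exp (-(n * (z ^ 2 - (x j : ℂ) ^ 2) / 4))

/-- The weighted Lagrange basis functions are bounded by `C` on `[-2, 2]`. -/
def LagrangeBounded (n : ℕ) (x : Fin n → ℝ) (C : ℝ) : Prop :=
  ∀ j, ∀ t ∈ Set.Icc (-2 : ℝ) 2, ‖weightedLagrange n x j t‖ ≤ C

theorem weightedLagrange_self {n : ℕ} {x : Fin n → ℝ} (hx : Function.Injective x) (j : Fin n) :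
    weightedLagrange n x j (x j) = 1 := by
  have : ∏ k ∈ Finset.univ.erase j, ((x j : ℂ) - x k) / (x j - x k) = 1 := by
    refine Finset.prod_eq_one fun k hk => div_self ?_
    rw [sub_ne_zero]
    intro h
    exact (Finset.ne_of_mem_erase hk) (hx (Complex.ofReal_injective h)).symm
  simp [weightedLagrange, this]

/-- The Lagrange basis polynomial with complex coefficients. -/
noncomputable def lagrangePoly (n : ℕ) (x : Fin n → ℝ) (j : Fin n) : Polynomial ℂ :=
  ∏ k ∈ Finset.univ.erase j, (Polynomial.C (((x j : ℂ) - x k)⁻¹) *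
    (Polynomial.X - Polynomial.C (x k : ℂ)))

theorem natDegree_lagrangePoly_le (n : ℕ) (x : Fin n → ℝ) (j : Fin n) :
    (lagrangePoly n x j).natDegree ≤ n := by
  refine (Polynomial.natDegree_prod_le _ _).trans ?_
  calc _ ≤ ∑ k ∈ Finset.univ.erase j, 1 := by
        refine Finset.sum_le_sum fun k _ => ?_
        exact (Polynomial.natDegree_C_mul_le _ _).trans (Polynomial.natDegree_X_sub_C_le _)
    _ ≤ n := by simp

theorem weightedLagrange_eq (n : ℕ) (x : Fin n → ℝ) (j : Fin n) (z : ℂ) :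
    weightedLagrange n x j z = (lagrangePoly n x j).eval z * Complex.exp (-(n * z ^ 2 / 4)) *
      Real.exp (n * x j ^ 2 / 4) := by
  have h1 : (lagrangePoly n x j).eval z
      = ∏ k ∈ Finset.univ.erase j, (z - x k) / (x j - x k) := by
    rw [lagrangePoly, Polynomial.eval_prod]
    refine Finset.prod_congr rfl fun k _ => ?_
    simp; ring
  rw [h1, weightedLagrange, mul_assoc, Complex.ofReal_exp, ← Complex.exp_add]
  congr 2
  push_cast; ring

theorem norm_exp_neg_weight (n : ℕ) (t : ℝ) :
    ‖Complex.exp (-(n * (t : ℂ) ^ 2 / 4))‖ = Real.exp (-(n * t ^ 2 / 4)) := by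
  rw [show (-(n * (t : ℂ) ^ 2 / 4)) = ((-(n * t ^ 2 / 4) : ℝ) : ℂ) by push_cast; ring,
    ← Complex.ofReal_exp, Complex.norm_real, Real.norm_eq_abs, abs_of_pos (Real.exp_pos _)]

theorem weightedLagrange_bound_aux {n : ℕ} {x : Fin n → ℝ} {j : Fin n} {C : ℝ}
    (h : ∀ t ∈ Set.Icc (-2 : ℝ) 2, ‖weightedLagrange n x j t‖ ≤ C) :
    ∀ t ∈ Set.Icc (-2 : ℝ) 2, ‖(lagrangePoly n x j).eval (t : ℂ)‖ * Real.exp (-(n * t ^ 2 / 4))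
      ≤ C * Real.exp (-(n * x j ^ 2 / 4)) := by
  intro t ht
  have := h t ht
  rw [weightedLagrange_eq, norm_mul, norm_mul, norm_exp_neg_weight, Complex.norm_real,
    Real.norm_eq_abs, abs_of_pos (Real.exp_pos _)] at this
  rw [Real.exp_neg (n * x j ^ 2 / 4), ← div_eq_mul_inv, le_div_iff₀ (Real.exp_pos _)]
  exact this

theorem norm_weightedLagrange_le_edge {n : ℕ} {x : Fin n → ℝ} {j : Fin n} {C : ℝ}
    (h : ∀ t ∈ Set.Icc (-2 : ℝ) 2, ‖weightedLagrange n x j t‖ ≤ C) {σ : ℂ} (hσ : 0 ≤ σ.re)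
    (hs : 4 + σ ^ 2 ∈ Complex.slitPlane) :
    ‖weightedLagrange n x j (2 + σ ^ 2)‖ ≤ C * Real.exp (n * (edgeH σ).re) := by
  have key := bernstein_walsh_edge (natDegree_lagrangePoly_le n x j)
    (weightedLagrange_bound_aux h) hσ hs
  rw [weightedLagrange_eq, norm_mul, Complex.norm_real,
    Real.norm_eq_abs, abs_of_pos (Real.exp_pos _)]
  calc _ ≤ (C * Real.exp (-(n * x j ^ 2 / 4)) * Real.exp (n * (edgeH σ).re)) *
        Real.exp (n * x j ^ 2 / 4) := by gcongr
    _ = C * Real.exp (n * (edgeH σ).re) := by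
      rw [Real.exp_neg]; field_simp

theorem weightedLagrange_neg (n : ℕ) (x : Fin n → ℝ) (j : Fin n) (z : ℂ) :
    weightedLagrange n (fun k => -x k) j z = weightedLagrange n x j (-z) := by
  unfold weightedLagrange
  congr 1
  · refine Finset.prod_congr rfl fun k _ => ?_
    push_cast
    rw [← neg_div_neg_eq]; ring
  · congr 1; push_cast; ring

theorem LagrangeBounded.neg {n : ℕ} {x : Fin n → ℝ} {C : ℝ} (h : LagrangeBounded n x C) :
    LagrangeBounded n (fun k => -x k) C := by
  intro j t ht
  rw [weightedLagrange_neg, ← Complex.ofReal_neg]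
  exact h j (-t) ⟨by linarith [ht.2], by linarith [ht.1]⟩

/-- The constant in the bound for the largest particle. -/
noncomputable def outerConst (C : ℝ) : ℝ := 1 + 9 / 4 * (Real.log C) ^ 2

theorem one_le_outerConst (C : ℝ) : 1 ≤ outerConst C := by
  unfold outerConst; nlinarith [sq_nonneg (Real.log C)]

/-- Particles do not exceed the edge by more than a multiple of the edge scale. -/
theorem le_two_add_of_lagrangeBounded {n : ℕ} {x : Fin n → ℝ} (hx : Function.Injective x) {C h : ℝ}
    (hC : 1 ≤ C) (hh : 0 < h) (hnh : (n : ℝ) ^ 2 * h ^ 3 = 1) (hb : LagrangeBounded n x C)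
    (j : Fin n) : x j ≤ 2 + outerConst C * h := by
  by_contra hcon
  push Not at hcon
  have hM := one_le_outerConst C
  have hMh : 0 < outerConst C * h := by positivity
  set σ : ℝ := √(x j - 2) with hσ
  have hσ2 : σ ^ 2 = x j - 2 := Real.sq_sqrt (by linarith)
  have hσ0 : 0 ≤ σ := Real.sqrt_nonneg _
  have key := norm_weightedLagrange_le_edge (hb j) (σ := (σ : ℂ)) (by simpa using hσ0)
    (slit_of_nonneg σ)
  have hz : (2 : ℂ) + (σ : ℂ) ^ 2 = x j := by
    rw [← Complex.ofReal_pow, hσ2]; push_cast; ring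
  rw [hz, weightedLagrange_self hx, norm_one] at key
  have hle := edgeH_ofReal_re_le hσ0
  have h1 : 0 ≤ Real.log C + n * (edgeH σ).re := by
    have := Real.log_le_log one_pos key
    rwa [Real.log_one, Real.log_mul (by linarith) (Real.exp_pos _).ne', Real.log_exp] at this
  have hn : (0 : ℝ) ≤ n := Nat.cast_nonneg n
  have h2 : n * σ ^ 3 ≤ 3 / 2 * Real.log C := by nlinarith
  have h3 : (n * σ ^ 3) ^ 2 ≤ (3 / 2 * Real.log C) ^ 2 := by
    have : 0 ≤ n * σ ^ 3 := by positivity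
    gcongr
  have h4 : (n * σ ^ 3) ^ 2 = (n : ℝ) ^ 2 * (x j - 2) ^ 3 := by rw [← hσ2]; ring
  have h5 : (n : ℝ) ^ 2 * (outerConst C * h) ^ 3 ≤ (n : ℝ) ^ 2 * (x j - 2) ^ 3 := by
    have : outerConst C * h ≤ x j - 2 := by linarith
    gcongr
  have h6 : (n : ℝ) ^ 2 * (outerConst C * h) ^ 3 = outerConst C ^ 3 := by
    linear_combination outerConst C ^ 3 * hnh
  have h7 : outerConst C ≤ outerConst C ^ 3 := le_self_pow₀ hM (by norm_num)
  have h8 : outerConst C = 1 + 9 / 4 * (Real.log C) ^ 2 := rfl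
  nlinarith

/-- The constant in the bound for the number of particles near the edge. -/
noncomputable def countConst (C : ℝ) : ℝ := 115 + 2 * Real.log C

/-- The number of particles within distance `u ^ 2 h` of the edge is `O(u ^ 3)`. -/
theorem card_near_edge_le {n : ℕ} {x : Fin n → ℝ} (hx : Function.Injective x) {C h : ℝ}
    (hC : 1 ≤ C) (hh : 0 < h) (hnh : (n : ℝ) ^ 2 * h ^ 3 = 1) (hb : LagrangeBounded n x C)
    {u : ℝ} (hu : 1 ≤ u) :
    ((Finset.univ.filter fun k => |x k - 2| ≤ u ^ 2 * h).card : ℝ) ≤ countConst C * u ^ 3 := by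
  have hlog : 0 ≤ Real.log C := Real.log_nonneg hC
  have hu3 : 1 ≤ u ^ 3 := one_le_pow₀ hu
  unfold countConst
  set S := Finset.univ.filter fun k => |x k - 2| ≤ u ^ 2 * h with hS
  by_cases hbig : 1 < 7 * (u ^ 2 * h)
  · have h1 : (S.card : ℝ) ≤ n := by
      have := Finset.card_le_univ S
      simp at this; exact_mod_cast this
    have h2 : (n : ℝ) ≤ 19 * u ^ 3 := by
      have h3 : (1 : ℝ) ≤ (7 * (u ^ 2 * h)) ^ 3 := one_le_pow₀ hbig.le
      have h4 : (n : ℝ) ^ 2 ≤ (19 * u ^ 3) ^ 2 := by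
        have : (n : ℝ) ^ 2 * 1 ≤ (n : ℝ) ^ 2 * (7 * (u ^ 2 * h)) ^ 3 := by gcongr
        have h5 : (n : ℝ) ^ 2 * (7 * (u ^ 2 * h)) ^ 3 = 343 * u ^ 6 := by
          linear_combination 343 * u ^ 6 * hnh
        have : 0 ≤ u ^ 6 := by positivity
        nlinarith
      exact le_of_sq_le_sq h4 (by positivity)
    nlinarith
  push Not at hbig
  rcases S.eq_empty_or_nonempty with hE | ⟨j, hj⟩
  · rw [hE]; simp; positivity
  have hjS : |x j - 2| ≤ u ^ 2 * h := (Finset.mem_filter.mp hj).2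
  set d := u ^ 2 * h with hd
  have hd0 : 0 < d := by positivity
  set B := C * Real.exp (57 * u ^ 3) with hB
  set g : ℂ → ℂ := fun z => (∏ k ∈ (Finset.univ.erase j) \ (S.erase j), (z - x k) / (x j - x k)) *
    Complex.exp (-(n * (z ^ 2 - (x j : ℂ) ^ 2) / 4)) with hg
  have hsub : S.erase j ⊆ Finset.univ.erase j := Finset.erase_subset_erase _ (Finset.subset_univ _)
  have hfac : ∀ z, weightedLagrange n x j z =
      g z * ∏ k ∈ S.erase j, (z - x k) / (x j - x k) := by
    intro z
    rw [weightedLagrange, hg, ← Finset.prod_sdiff hsub]; ring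
  have hne : ∀ k, k ≠ j → (x j : ℂ) - x k ≠ 0 := by
    intro k hk
    rw [sub_ne_zero]
    intro h
    exact hk (hx (Complex.ofReal_injective h)).symm
  have hgj : g (x j) = 1 := by
    have h1 := hfac (x j)
    rw [weightedLagrange_self hx, Finset.prod_eq_one, mul_one] at h1
    · exact h1.symm
    · intro k hk; exact div_self (hne k (Finset.ne_of_mem_erase hk))
  have hgd : Differentiable ℂ g := by
    rw [hg]
    fun_prop
  clear_value g
  have hF : ∀ z : ℂ, ‖z - x j‖ ≤ 6 * d → ‖weightedLagrange n x j z‖ ≤ B := by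
    intro z hz
    set σ := Complex.sqrt (z - 2) with hσ
    have hσ2 : σ ^ 2 = z - 2 := complex_sqrt_sq _
    have hz2 : ‖z - 2‖ ≤ 7 * d := by
      have h1 : z - 2 = (z - x j) + ((x j - 2 : ℝ) : ℂ) := by push_cast; ring
      rw [h1]
      refine (norm_add_le _ _).trans ?_
      rw [Complex.norm_real, Real.norm_eq_abs]; linarith
    have hn2 : ‖σ‖ ^ 2 ≤ 7 * d := by rw [← norm_pow, hσ2]; exact hz2
    have hn1 : ‖σ‖ ≤ 1 := by
      by_contra hc
      push Not at hc
      nlinarith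
    have key := norm_weightedLagrange_le_edge (hb j) (σ := σ) (complex_sqrt_re_nonneg _)
      (four_add_sq_mem_slitPlane hn1)
    rw [hσ2, show 2 + (z - 2) = z by ring] at key
    refine key.trans ?_
    have h3 : (n * ‖σ‖ ^ 3) ≤ 19 * u ^ 3 := by
      have : (n * ‖σ‖ ^ 3) ^ 2 ≤ (19 * u ^ 3) ^ 2 := by
        calc (n * ‖σ‖ ^ 3) ^ 2 = (n : ℝ) ^ 2 * (‖σ‖ ^ 2) ^ 3 := by ring
          _ ≤ (n : ℝ) ^ 2 * (7 * d) ^ 3 := by gcongr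
          _ = 343 * u ^ 6 := by rw [hd]; linear_combination 343 * u ^ 6 * hnh
          _ ≤ _ := by nlinarith [show 0 ≤ u ^ 6 by positivity]
      exact le_of_sq_le_sq this (by positivity)
    have h4 : (edgeH σ).re ≤ 3 * ‖σ‖ ^ 3 :=
      (Complex.re_le_norm _).trans (norm_edgeH_le hn1)
    have h5 : n * (edgeH σ).re ≤ 57 * u ^ 3 := by
      have : n * (edgeH σ).re ≤ n * (3 * ‖σ‖ ^ 3) := by gcongr
      linarith
    rw [hB]; gcongr
  have hfr : ∀ z ∈ frontier (Metric.ball (x j : ℂ) (6 * d)), ‖g z‖ ≤ B / 2 ^ (S.erase j).card := by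
    intro z hz
    rw [frontier_ball _ (by positivity), mem_sphere_iff_norm] at hz
    rw [le_div_iff₀ (by positivity)]
    refine le_trans ?_ (hF z hz.le)
    rw [hfac, norm_mul, norm_prod]
    refine mul_le_mul_of_nonneg_left ?_ (norm_nonneg (g z))
    rw [← Finset.prod_const]
    refine Finset.prod_le_prod (fun _ _ => by norm_num) fun k hk => ?_
    have hkj := Finset.ne_of_mem_erase hk
    have hkS : |x k - 2| ≤ d := (Finset.mem_filter.mp (Finset.mem_of_mem_erase hk)).2
    have h1 : ‖(x j : ℂ) - x k‖ ≤ 2 * d := by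
      rw [← Complex.ofReal_sub, Complex.norm_real, Real.norm_eq_abs]
      rw [abs_le] at *
      constructor <;> linarith [hkS.1, hkS.2, hjS.1, hjS.2]
    have h2 : 4 * d ≤ ‖z - x k‖ := by
      have : ‖z - x j‖ ≤ ‖z - x k‖ + ‖(x j : ℂ) - x k‖ := by
        have := norm_sub_le (z - x k) ((x j : ℂ) - x k)
        simpa using this
      linarith
    rw [norm_div, le_div_iff₀ (norm_pos_iff.mpr (hne k hkj))]
    linarith
  have hmax := Complex.norm_le_of_forall_mem_frontier_norm_le Metric.isBounded_ball
    hgd.diffContOnCl hfr (z := (x j : ℂ))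
    (subset_closure (Metric.mem_ball_self (by positivity)))
  rw [hgj, norm_one, le_div_iff₀ (by positivity), one_mul] at hmax
  have hcard : (S.card : ℝ) = (S.erase j).card + 1 := by
    rw [Finset.card_erase_of_mem hj]
    have : 1 ≤ S.card := Finset.card_pos.mpr ⟨j, hj⟩
    push_cast [Nat.cast_sub this]; ring
  have hl := Real.log_le_log (by positivity) hmax
  rw [Real.log_pow, hB, Real.log_mul (by linarith) (Real.exp_pos _).ne', Real.log_exp] at hl
  have hl2 : (1 : ℝ) / 2 ≤ Real.log 2 := by have := Real.log_two_gt_d9; linarith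
  have : ((S.erase j).card : ℝ) * (1 / 2) ≤ (S.erase j).card * Real.log 2 := by gcongr
  rw [hcard]
  nlinarith

theorem sum_le_of_card_le {ι : Type*} [Fintype ι] {d f : ι → ℝ} {B : ℝ}
    (hB : ∀ u : ℝ, 1 ≤ u → ((Finset.univ.filter fun k => d k ≤ u ^ 2).card : ℝ) ≤ B * u ^ 3)
    (hf1 : ∀ k, f k ≤ 1) (hf2 : ∀ k, 1 < d k → f k ≤ (1 / d k) ^ 2) :
    ∑ k, f k ≤ 32 * B := by
  classical
  have hex : ∀ y : ℝ, ∃ i : ℕ, y ≤ 4 ^ i := fun y => by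
    obtain ⟨i, hi⟩ := pow_unbounded_of_one_lt y (by norm_num : (1 : ℝ) < 4)
    exact ⟨i, hi.le⟩
  set N : ι → ℕ := fun k => Nat.find (hex (d k)) with hN
  have hNs : ∀ k, d k ≤ 4 ^ N k := fun k => Nat.find_spec (hex (d k))
  have hfN : ∀ k, f k ≤ 16 * (1 / 16) ^ N k := by
    intro k
    rcases Nat.eq_zero_or_pos (N k) with h0 | h0
    · rw [h0]; have := hf1 k; norm_num; linarith
    · have h1 : ¬ d k ≤ 4 ^ (N k - 1) := Nat.find_min (hex (d k)) (Nat.sub_lt h0 one_pos)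
      push Not at h1
      have h2 : (1 : ℝ) ≤ 4 ^ (N k - 1) := one_le_pow₀ (by norm_num)
      refine (hf2 k (by linarith)).trans ?_
      have h3 : (4 : ℝ) ^ N k = 4 * 4 ^ (N k - 1) := by
        rw [← pow_succ']; congr 1; omega
      have h4 : (16 : ℝ) * (1 / 16) ^ N k = (1 / 4 ^ (N k - 1)) ^ 2 := by
        rw [div_pow, one_pow, show (16 : ℝ) ^ N k = (4 ^ N k) ^ 2 by rw [← pow_mul, mul_comm, pow_mul]; norm_num, h3]
        field_simp; norm_num
      rw [h4]
      have h5 : 0 < d k := by linarith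
      gcongr
  set m := Finset.univ.sup N
  have hNm : ∀ k, N k ≤ m := fun k => Finset.le_sup (Finset.mem_univ k)
  calc ∑ k, f k ≤ ∑ k, ∑ i ∈ Finset.range (m + 1), if d k ≤ 4 ^ i then (16 : ℝ) * (1 / 16) ^ i else 0 := by
        refine Finset.sum_le_sum fun k _ => (hfN k).trans ?_
        have := Finset.single_le_sum (f := fun i => if d k ≤ 4 ^ i then (16 : ℝ) * (1 / 16) ^ i else 0)
          (s := Finset.range (m + 1)) (fun i _ => by positivity)
          (Finset.mem_range.mpr (Nat.lt_succ_of_le (hNm k)))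
        simpa [hNs k] using this
    _ = ∑ i ∈ Finset.range (m + 1), ((Finset.univ.filter fun k => d k ≤ 4 ^ i).card : ℝ) *
          (16 * (1 / 16) ^ i) := by
        rw [Finset.sum_comm]
        refine Finset.sum_congr rfl fun i _ => ?_
        rw [← Finset.sum_filter, Finset.sum_const, nsmul_eq_mul]
    _ ≤ ∑ i ∈ Finset.range (m + 1), (16 * B) * (1 / 2) ^ i := by
        refine Finset.sum_le_sum fun i _ => ?_
        have h1 := hB (2 ^ i) (one_le_pow₀ (by norm_num))
        rw [show ((2 : ℝ) ^ i) ^ 2 = 4 ^ i by rw [← pow_mul, mul_comm, pow_mul]; norm_num,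
          show ((2 : ℝ) ^ i) ^ 3 = 8 ^ i by rw [← pow_mul, mul_comm, pow_mul]; norm_num] at h1
        calc _ ≤ B * 8 ^ i * (16 * (1 / 16) ^ i) := by gcongr
          _ = 16 * B * (8 ^ i * (1 / 16) ^ i) := by ring
          _ = _ := by rw [← mul_pow]; norm_num
    _ ≤ 32 * B := by
        have hB0 : 0 ≤ B := by
          have := hB 1 le_rfl
          have h2 : (0 : ℝ) ≤ ((Finset.univ.filter fun k => d k ≤ 1 ^ 2).card : ℝ) := by positivity
          simp only [one_pow, mul_one] at *
          linarith
        rw [← Finset.mul_sum]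
        have := sum_geometric_two_le (m + 1)
        nlinarith

theorem derivative_hermite_succ (m : ℕ) :
    Polynomial.derivative (Polynomial.hermite (m + 1)) = (m + 1 : ℤ) • Polynomial.hermite m := by
  induction m with
  | zero => simp [Polynomial.hermite_succ]
  | succ k ih =>
    rw [Polynomial.hermite_succ, Polynomial.derivative_sub, Polynomial.derivative_mul, ih,
      Polynomial.derivative_X, Polynomial.derivative_smul]
    have h := Polynomial.hermite_succ k
    simp only [zsmul_eq_mul]
    push_cast
    linear_combination (-(k : Polynomial ℤ) - 1) * h

theorem hermite_ode (m : ℕ) :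
    Polynomial.derivative (Polynomial.derivative (Polynomial.hermite m)) =
      Polynomial.X * Polynomial.derivative (Polynomial.hermite m) -
        (m : ℤ) • Polynomial.hermite m := by
  have h := derivative_hermite_succ m
  rw [Polynomial.hermite_succ, Polynomial.derivative_sub, Polynomial.derivative_mul,
    Polynomial.derivative_X] at h
  simp only [zsmul_eq_mul] at *
  push_cast at *
  linear_combination -h

theorem hermite_comp_neg (m : ℕ) :
    (Polynomial.hermite m).comp (-Polynomial.X) = (-1 : ℤ) ^ m • Polynomial.hermite m := by
  induction m with
  | zero => simp
  | succ k ih =>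
    have h := congrArg Polynomial.derivative ih
    rw [Polynomial.derivative_comp, Polynomial.derivative_smul] at h
    simp only [Polynomial.derivative_neg, Polynomial.derivative_X] at h
    rw [Polynomial.hermite_succ, Polynomial.sub_comp, Polynomial.mul_comp, ih, Polynomial.X_comp]
    simp only [zsmul_eq_mul] at *
    push_cast at *
    rw [pow_succ]
    linear_combination h

/-- Existence of rescaled Hermite polynomials, with the differential equation and the parity. -/
theorem exists_scaled_hermite (m : ℕ) {a : ℝ} (ha : 0 < a) :
    ∃ Q : Polynomial ℝ, Q ≠ 0 ∧ Q.natDegree ≤ m ∧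
      Polynomial.derivative (Polynomial.derivative Q) =
        Polynomial.C a * (Polynomial.X * Polynomial.derivative Q - (m : ℝ) • Q) ∧
      ∀ t, |Q.eval (-t)| = |Q.eval t| := by
  set c := √a with hc
  have hc0 : 0 < c := Real.sqrt_pos.mpr ha
  have hc2 : c ^ 2 = a := Real.sq_sqrt ha.le
  set H : Polynomial ℝ := (Polynomial.hermite m).map (Int.castRingHom ℝ) with hH
  have hHm : H.Monic := (Polynomial.hermite_monic m).map _
  have hode : Polynomial.derivative (Polynomial.derivative H) =
      Polynomial.X * Polynomial.derivative H - (m : ℝ) • H := by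
    rw [hH, Polynomial.derivative_map, Polynomial.derivative_map, hermite_ode]
    simp [Polynomial.smul_eq_C_mul]
  have hneg : H.comp (-Polynomial.X) = (-1 : ℝ) ^ m • H := by
    have := congrArg (Polynomial.map (Int.castRingHom ℝ)) (hermite_comp_neg m)
    rw [Polynomial.map_comp] at this
    simpa [Polynomial.smul_eq_C_mul] using this
  have hcX : (Polynomial.C c * Polynomial.X).natDegree = 1 :=
    Polynomial.natDegree_C_mul_X c hc0.ne'
  refine ⟨H.comp (Polynomial.C c * Polynomial.X), ?_, ?_, ?_, ?_⟩
  · intro h0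
    rw [Polynomial.comp_eq_zero_iff] at h0
    rcases h0 with h0 | ⟨_, h0⟩
    · exact hHm.ne_zero h0
    · have := congrArg Polynomial.natDegree h0
      rw [hcX] at this; simp at this
  · rw [Polynomial.natDegree_comp, hcX, mul_one, hH,
      (Polynomial.hermite_monic m).natDegree_map, Polynomial.natDegree_hermite]
  · have hX : Polynomial.derivative (Polynomial.C c * Polynomial.X) = Polynomial.C c := by simp
    have h2 := congrArg (fun p => p.comp (Polynomial.C c * Polynomial.X)) hode
    simp only [Polynomial.sub_comp, Polynomial.mul_comp, Polynomial.X_comp,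
      Polynomial.smul_comp] at h2
    rw [Polynomial.derivative_comp, Polynomial.derivative_mul, Polynomial.derivative_comp, hX, h2,
      ← hc2]
    simp only [Polynomial.smul_eq_C_mul, map_pow, Polynomial.derivative_C]
    ring
  · intro t
    have h2 := congrArg (fun p => |Polynomial.eval (c * t) p|) hneg
    simp only [Polynomial.eval_comp, Polynomial.eval_neg, Polynomial.eval_X, Polynomial.eval_smul,
      smul_eq_mul, abs_mul, abs_pow, abs_neg, abs_one, one_pow, one_mul] at h2
    simp only [Polynomial.eval_comp, Polynomial.eval_mul, Polynomial.eval_C, Polynomial.eval_X]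
    rw [← h2, mul_neg]

theorem sturm_aux {A A' q : ℝ → ℝ} (hA : ∀ t, HasDerivAt A (A' t) t)
    (hA' : ∀ t, HasDerivAt A' (-(q t * A t)) t) {a κ : ℝ} (hκ : 0 < κ)
    (hq : ∀ t ∈ Set.Icc a (a + Real.pi / κ), κ ^ 2 ≤ q t)
    (hpos : ∀ t ∈ Set.Icc a (a + Real.pi / κ), 0 < A t) : False := by
  have hpk : 0 < Real.pi / κ := div_pos Real.pi_pos hκ
  set W : ℝ → ℝ := fun t => A' t * Real.sin (κ * (t - a)) - κ * A t * Real.cos (κ * (t - a))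
  have hW : ∀ t, HasDerivAt W ((κ ^ 2 - q t) * A t * Real.sin (κ * (t - a))) t := by
    intro t
    have h0 : HasDerivAt (fun t => κ * (t - a)) κ t := by
      simpa using ((hasDerivAt_id t).sub_const a).const_mul κ
    have h1 := (hA' t).mul h0.sin
    have h2 := ((hA t).const_mul κ).mul h0.cos
    refine (h1.sub h2).congr_deriv ?_
    ring
  have hanti : AntitoneOn W (Set.Icc a (a + Real.pi / κ)) := by
    apply antitoneOn_of_deriv_nonpos (convex_Icc _ _)
    · exact fun t _ => (hW t).continuousAt.continuousWithinAt
    · exact fun t _ => (hW t).differentiableAt.differentiableWithinAt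
    · intro t ht
      rw [interior_Icc] at ht
      have ht' : t ∈ Set.Icc a (a + Real.pi / κ) := Set.Ioo_subset_Icc_self ht
      rw [(hW t).deriv]
      have h1 : 0 ≤ Real.sin (κ * (t - a)) := by
        apply Real.sin_nonneg_of_nonneg_of_le_pi
        · exact mul_nonneg hκ.le (by linarith [ht.1])
        · have : t - a ≤ Real.pi / κ := by linarith [ht.2]
          rw [le_div_iff₀ hκ] at this; linarith
      have h2 := hpos t ht'
      have h3 := hq t ht'
      have : 0 ≤ (q t - κ ^ 2) * A t * Real.sin (κ * (t - a)) :=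
        mul_nonneg (mul_nonneg (by linarith) h2.le) h1
      linarith
  have ha : a ∈ Set.Icc a (a + Real.pi / κ) := ⟨le_rfl, by linarith⟩
  have hb : a + Real.pi / κ ∈ Set.Icc a (a + Real.pi / κ) := ⟨by linarith, le_rfl⟩
  have h := hanti ha hb (by linarith)
  have hk : κ * (a + Real.pi / κ - a) = Real.pi := by field_simp; ring
  simp only [W, hk, sub_self, mul_zero, Real.sin_zero, Real.cos_zero, Real.sin_pi, Real.cos_pi] at h
  have h1 := mul_pos hκ (hpos a ha)
  have h2 := mul_pos hκ (hpos _ hb)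
  linarith

/-- Sturm comparison: a solution of `A'' = -q A` with `q ≥ κ²` vanishes on every interval of
length `π / κ`. -/
theorem sturm_exists_zero {A A' q : ℝ → ℝ} (hA : ∀ t, HasDerivAt A (A' t) t)
    (hA' : ∀ t, HasDerivAt A' (-(q t * A t)) t) {a κ : ℝ} (hκ : 0 < κ)
    (hq : ∀ t ∈ Set.Icc a (a + Real.pi / κ), κ ^ 2 ≤ q t) :
    ∃ z ∈ Set.Icc a (a + Real.pi / κ), A z = 0 := by
  by_contra! hcon
  have hpk : 0 < Real.pi / κ := div_pos Real.pi_pos hκ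
  have ha : a ∈ Set.Icc a (a + Real.pi / κ) := ⟨le_rfl, by linarith⟩
  have hc : ContinuousOn A (Set.Icc a (a + Real.pi / κ)) :=
    fun t _ => (hA t).continuousAt.continuousWithinAt
  rcases lt_or_gt_of_ne (hcon a ha) with h | h
  · refine sturm_aux (A := fun t => -A t) (A' := fun t => -A' t) (q := q) (fun t => (hA t).neg)
      (fun t => ((hA' t).neg).congr_deriv (by ring)) hκ hq fun t ht => ?_
    by_contra h2
    push Not at h2
    have h3 : (0 : ℝ) ∈ Set.Icc (A a) (A t) := ⟨h.le, by linarith⟩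
    obtain ⟨y, hy, hy0⟩ := intermediate_value_Icc ht.1
      (hc.mono (Set.Icc_subset_Icc_right ht.2)) h3
    exact hcon y ⟨hy.1, hy.2.trans ht.2⟩ hy0
  · refine sturm_aux hA hA' hκ hq fun t ht => ?_
    by_contra h2
    push Not at h2
    have h3 : (0 : ℝ) ∈ Set.Icc (A t) (A a) := ⟨h2, h.le⟩
    obtain ⟨y, hy, hy0⟩ := intermediate_value_Icc' ht.1
      (hc.mono (Set.Icc_subset_Icc_right ht.2)) h3
    exact hcon y ⟨hy.1, hy.2.trans ht.2⟩ hy0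

/-- Sonin's inequality. -/
theorem sonin {A A' q q' : ℝ → ℝ} (hA : ∀ t, HasDerivAt A (A' t) t)
    (hA' : ∀ t, HasDerivAt A' (-(q t * A t)) t) (hq : ∀ t, HasDerivAt q (q' t) t) {z : ℝ}
    (hpos : ∀ t ∈ Set.Icc 0 z, 0 < q t) (hq' : ∀ t ∈ Set.Icc 0 z, q' t ≤ 0) {t : ℝ}
    (ht : t ∈ Set.Icc 0 z) : A t ^ 2 ≤ A z ^ 2 + A' z ^ 2 / q z := by
  set S : ℝ → ℝ := fun t => A t ^ 2 + A' t ^ 2 / q t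
  have hS : ∀ t ∈ Set.Icc 0 z, HasDerivAt S (-(A' t ^ 2 * q' t) / q t ^ 2) t := by
    intro t ht
    have hne := (hpos t ht).ne'
    have h1 := ((hA t).pow 2).add (((hA' t).pow 2).div (hq t) hne)
    refine h1.congr_deriv ?_
    simp only [Pi.pow_apply]
    field_simp
    push_cast
    ring
  have hmono : MonotoneOn S (Set.Icc 0 z) := by
    apply monotoneOn_of_deriv_nonneg (convex_Icc _ _)
    · exact fun t ht => (hS t ht).continuousAt.continuousWithinAt
    · intro t ht
      rw [interior_Icc] at ht
      exact (hS t (Set.Ioo_subset_Icc_self ht)).differentiableAt.differentiableWithinAt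
    · intro t ht
      rw [interior_Icc] at ht
      have ht' := Set.Ioo_subset_Icc_self ht
      rw [(hS t ht').deriv]
      have := hq' t ht'
      have : 0 ≤ A' t ^ 2 * -q' t := mul_nonneg (sq_nonneg _) (by linarith)
      apply div_nonneg _ (sq_nonneg _)
      linarith
  have h0 : 0 ≤ z := ht.1.trans ht.2
  have h1 : A t ^ 2 + A' t ^ 2 / q t ≤ A z ^ 2 + A' z ^ 2 / q z := hmono ht ⟨h0, le_rfl⟩ ht.2
  have h2 : 0 ≤ A' t ^ 2 / q t := div_nonneg (sq_nonneg _) (hpos t ht).le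
  linarith

/-- Energy growth for solutions of `A'' = -q A`. -/
theorem energy_le {A A' q : ℝ → ℝ} (hA : ∀ t, HasDerivAt A (A' t) t)
    (hA' : ∀ t, HasDerivAt A' (-(q t * A t)) t) {h K z ρ : ℝ} (hh : 0 < h)
    (hq : ∀ t, |t - z| ≤ ρ → |q t| ≤ K / h ^ 2) {t : ℝ} (ht : |t - z| ≤ ρ) :
    (A t / h) ^ 2 + A' t ^ 2 ≤
      ((A z / h) ^ 2 + A' z ^ 2) * Real.exp ((1 + K) / h * |t - z|) := by
  set E : ℝ → ℝ := fun t => (A t / h) ^ 2 + A' t ^ 2 with hE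
  set D : ℝ → ℝ := fun t => 2 * A t * A' t * (1 / h ^ 2 - q t) with hD
  have hE' : ∀ t, HasDerivAt E (D t) t := by
    intro t
    have h1 := (((hA t).div_const h).pow 2).add ((hA' t).pow 2)
    refine h1.congr_deriv ?_
    simp only [hD]
    push_cast
    simp only [pow_one]
    field_simp
    ring
  set k := (1 + K) / h with hk
  have hDb : ∀ t, |t - z| ≤ ρ → |D t| ≤ k * E t := by
    intro t ht
    have h1 : |1 / h ^ 2 - q t| ≤ (1 + K) / h ^ 2 := by
      refine (abs_sub _ _).trans ?_
      rw [abs_of_pos (by positivity : 0 < 1 / h ^ 2), add_div]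
      have := hq t ht
      linarith
    have h2 : 2 * |A t / h| * |A' t| ≤ E t := by
      have := two_mul_le_add_sq |A t / h| |A' t|
      simpa [hE, sq_abs] using this
    have h3 : 0 ≤ k := by
      have h4 : 0 ≤ (1 + K) / h ^ 2 := (abs_nonneg _).trans h1
      have : k = (1 + K) / h ^ 2 * h := by rw [hk]; field_simp
      rw [this]; positivity
    calc |D t| = 2 * |A t| * |A' t| * |1 / h ^ 2 - q t| := by
          simp only [hD, abs_mul, abs_two]
      _ ≤ 2 * |A t| * |A' t| * ((1 + K) / h ^ 2) := by gcongr
      _ = k * (2 * |A t / h| * |A' t|) := by rw [hk, abs_div, abs_of_pos hh]; field_simp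
      _ ≤ _ := by gcongr
  rcases le_total z t with hzt | hzt
  · have habs : |t - z| = t - z := abs_of_nonneg (by linarith)
    have hF : ∀ s, HasDerivAt (fun s => E s * Real.exp (-(k * (s - z))))
        ((D s - k * E s) * Real.exp (-(k * (s - z)))) s := by
      intro s
      have h0 : HasDerivAt (fun s => -(k * (s - z))) (-k) s := by
        simpa using ((hasDerivAt_id s).sub_const z).const_mul k |>.fun_neg
      refine ((hE' s).mul h0.exp).congr_deriv ?_
      ring
    have hanti : AntitoneOn (fun s => E s * Real.exp (-(k * (s - z)))) (Set.Icc z t) := by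
      apply antitoneOn_of_deriv_nonpos (convex_Icc _ _)
      · exact fun s _ => (hF s).continuousAt.continuousWithinAt
      · exact fun s _ => (hF s).differentiableAt.differentiableWithinAt
      · intro s hs
        rw [interior_Icc] at hs
        rw [(hF s).deriv]
        have := (abs_le.mp (hDb s (by rw [abs_of_nonneg] <;> linarith [hs.1, hs.2]))).2
        exact mul_nonpos_of_nonpos_of_nonneg (by linarith) (Real.exp_pos _).le
    have := hanti ⟨le_rfl, hzt⟩ ⟨hzt, le_rfl⟩ hzt
    simp only [sub_self, mul_zero, neg_zero, Real.exp_zero, mul_one] at this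
    rw [Real.exp_neg, ← div_eq_mul_inv, div_le_iff₀ (Real.exp_pos _)] at this
    rw [habs]; exact this
  · have habs : |t - z| = z - t := by rw [abs_sub_comm]; exact abs_of_nonneg (by linarith)
    have hF : ∀ s, HasDerivAt (fun s => E s * Real.exp (-(k * (z - s))))
        ((D s + k * E s) * Real.exp (-(k * (z - s)))) s := by
      intro s
      have h0 : HasDerivAt (fun s => -(k * (z - s))) k s := by
        simpa using ((hasDerivAt_id s).const_sub z).const_mul k |>.fun_neg
      refine ((hE' s).mul h0.exp).congr_deriv ?_
      ring
    have hmono : MonotoneOn (fun s => E s * Real.exp (-(k * (z - s)))) (Set.Icc t z) := by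
      apply monotoneOn_of_deriv_nonneg (convex_Icc _ _)
      · exact fun s _ => (hF s).continuousAt.continuousWithinAt
      · exact fun s _ => (hF s).differentiableAt.differentiableWithinAt
      · intro s hs
        rw [interior_Icc] at hs
        rw [(hF s).deriv]
        have := (abs_le.mp (hDb s (by
          rw [abs_sub_comm, abs_of_nonneg] <;> linarith [hs.1, hs.2]))).1
        exact mul_nonneg (by linarith) (Real.exp_pos _).le
    have := hmono ⟨le_rfl, hzt⟩ ⟨hzt, le_rfl⟩ hzt
    simp only [sub_self, mul_zero, neg_zero, Real.exp_zero, mul_one] at this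
    rw [Real.exp_neg, ← div_eq_mul_inv, div_le_iff₀ (Real.exp_pos _)] at this
    rw [habs]; exact this

set_option maxHeartbeats 1000000 in
/-- A polynomial of degree less than `n`, normalized at a point at distance of order `h` inside the
edge, whose weighted values decay quadratically on the scale `h`. -/
theorem exists_anchor {Mo : ℝ} (hMo : 1 ≤ Mo) : ∃ K : ℝ, 1 ≤ K ∧ ∀ (n : ℕ) (h : ℝ), 0 < h →
    h * (10 + Mo) ≤ 1 → (n : ℝ) ^ 2 * h ^ 3 = 1 → ∃ z ∈ Set.Icc (2 - 10 * h) (2 - 5 * h),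
    ∃ p : Polynomial ℝ, p.natDegree < n ∧ p.eval z = 1 ∧ ∀ t, |t| ≤ 2 + Mo * h →
      |p.eval t| * Real.exp (-(n * (t ^ 2 - z ^ 2) / 4)) ≤ K ∧
      |p.eval t| * Real.exp (-(n * (t ^ 2 - z ^ 2) / 4)) * (t - z) ^ 2 ≤ K * h ^ 2 := by
  refine ⟨2 * Real.exp ((12 + Mo) ^ 2), ?_, ?_⟩
  · have := Real.add_one_le_exp ((12 + Mo) ^ 2)
    nlinarith
  intro n h hh hhM hnh
  set K := 2 * Real.exp ((12 + Mo) ^ 2) with hK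
  have hK2 : 2 ≤ K := by
    have := Real.add_one_le_exp ((12 + Mo) ^ 2)
    nlinarith
  have hMh : 0 < Mo * h := by positivity
  have hh10 : h ≤ 1 / 11 := by nlinarith
  have hn2 : (n : ℝ) ^ 2 * h = 1 / h ^ 2 := by
    rw [eq_div_iff (by positivity)]; linarith
  have hn0 : (0 : ℝ) ≤ n := Nat.cast_nonneg n
  have hnle : (n : ℝ) ≤ 1 / h ^ 2 := by
    rw [← hn2]
    have h1 : 1 ≤ (n : ℝ) * h := by
      have : (1 : ℝ) ^ 2 ≤ (n * h) ^ 2 := by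
        have h2 : (n * h) ^ 2 * h = 1 := by linarith
        nlinarith [sq_nonneg (n * h)]
      exact le_of_sq_le_sq this (by positivity)
    nlinarith
  have hnpos : 0 < (n : ℝ) := by
    rcases hn0.eq_or_lt with h0 | h0
    · rw [← h0] at hnh; norm_num at hnh
    · exact h0
  set m := n / 2 with hm
  have hm1 : 2 * (m : ℝ) ≤ n := by
    have : 2 * m ≤ n := by omega
    exact_mod_cast this
  have hm2 : (n : ℝ) ≤ 2 * m + 1 := by
    have : n ≤ 2 * m + 1 := by omega
    exact_mod_cast this
  obtain ⟨Q, hQ0, hQd, hode, hpar⟩ := exists_scaled_hermite m (a := n / 2) (by positivity)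
  set e : ℝ → ℝ := fun t => Real.exp (-(n * t ^ 2 / 8)) with he
  have he0 : ∀ t, 0 < e t := fun t => Real.exp_pos _
  have hed : ∀ t, HasDerivAt e (-(n * t / 4) * e t) t := by
    intro t
    have h0 : HasDerivAt (fun t : ℝ => -(n * t ^ 2 / 8)) (-(n * t / 4)) t := by
      refine ((((hasDerivAt_id t).pow 2).const_mul (n : ℝ)).div_const 8).fun_neg.congr_deriv ?_
      simp; ring
    exact h0.exp.congr_deriv (by simp only [he]; ring)
  set A : ℝ → ℝ := fun t => Q.eval t * e t with hA
  set A' : ℝ → ℝ := fun t => (Q.derivative.eval t - n * t / 4 * Q.eval t) * e t with hA'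
  set q : ℝ → ℝ := fun t => n * m / 2 + n / 4 - n ^ 2 * t ^ 2 / 16 with hq
  have hAd : ∀ t, HasDerivAt A (A' t) t := by
    intro t
    refine ((Q.hasDerivAt t).mul (hed t)).congr_deriv ?_
    simp only [hA']; ring
  have hAd' : ∀ t, HasDerivAt A' (-(q t * A t)) t := by
    intro t
    have h1 : HasDerivAt (fun t : ℝ => (n : ℝ) * t / 4) (n / 4) t := by
      simpa using ((hasDerivAt_id t).const_mul (n : ℝ)).div_const 4
    have h2 := ((Q.derivative.hasDerivAt t).fun_sub (h1.fun_mul (Q.hasDerivAt t))).fun_mul (hed t)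
    refine h2.congr_deriv ?_
    have h3 := congrArg (Polynomial.eval t) hode
    simp only [Polynomial.eval_mul, Polynomial.eval_C, Polynomial.eval_sub, Polynomial.eval_X,
      Polynomial.eval_smul, smul_eq_mul] at h3
    rw [h3]
    simp only [hq, hA]
    ring
  have hqd : ∀ t, HasDerivAt q (-(n ^ 2 * t / 8)) t := by
    intro t
    refine (((((hasDerivAt_id t).pow 2).const_mul ((n : ℝ) ^ 2)).div_const 16).const_sub
      ((n : ℝ) * m / 2 + n / 4)).congr_deriv ?_
    simp; ring
  have hql : ∀ t, n ^ 2 / 16 * (4 - t ^ 2) ≤ q t := by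
    intro t; simp only [hq]; nlinarith
  have hqu : ∀ t, q t ≤ n ^ 2 / 16 * (4 - t ^ 2) + n / 4 := by
    intro t; simp only [hq]; nlinarith
  have hqedge : ∀ t ∈ Set.Icc (2 - 10 * h) (2 - 5 * h), 15 / 16 / h ^ 2 ≤ q t := by
    intro t ht
    refine le_trans ?_ (hql t)
    have h1 : 15 * h ≤ 4 - t ^ 2 := by nlinarith [ht.1, ht.2]
    calc 15 / 16 / h ^ 2 = n ^ 2 / 16 * (15 * h) := by
          rw [div_div, mul_comm (16 : ℝ), ← div_div, ]
          linear_combination (-15 / 16) * hn2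
      _ ≤ _ := by gcongr
  have hκ : 0 < Real.pi / (5 * h) := by positivity
  have hlen : 2 - 10 * h + Real.pi / (Real.pi / (5 * h)) = 2 - 5 * h := by
    rw [div_div_cancel₀ Real.pi_ne_zero]; ring
  obtain ⟨z, hz, hAz⟩ := sturm_exists_zero hAd hAd' (a := 2 - 10 * h) hκ (by
    rw [hlen]
    intro t ht
    refine le_trans ?_ (hqedge t ht)
    rw [div_pow, mul_pow, ← div_div]
    have := Real.pi_lt_d2
    have := Real.pi_pos
    gcongr
    · nlinarith
    · norm_num)
  rw [hlen] at hz
  have hQz : Q.eval z = 0 := by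
    rcases mul_eq_zero.mp hAz with h0 | h0
    · exact h0
    · exact absurd h0 (he0 z).ne'
  have hz0 : 0 < z := by linarith [hz.1]
  set D := A' z with hD
  set ρ := (10 + Mo) * h with hρ
  have hson : ∀ t ∈ Set.Icc 0 z, A t ^ 2 ≤ K * h ^ 2 * D ^ 2 := by
    intro t ht
    have hpos : ∀ t ∈ Set.Icc 0 z, 0 < q t := by
      intro t ht
      refine lt_of_lt_of_le ?_ (hql t)
      have : t ≤ 2 - 5 * h := ht.2.trans hz.2
      have : 0 < 4 - t ^ 2 := by nlinarith [ht.1]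
      positivity
    have h1 := sonin hAd hAd' hqd hpos (fun t ht => by
      have := ht.1
      have : 0 ≤ (n : ℝ) ^ 2 * t / 8 := by positivity
      linarith) ht
    rw [hAz] at h1
    have h2 : D ^ 2 / q z ≤ D ^ 2 / (15 / 16 / h ^ 2) := by
      have := hqedge z hz
      gcongr
    have h3 : D ^ 2 / (15 / 16 / h ^ 2) = 16 / 15 * h ^ 2 * D ^ 2 := by field_simp
    have h4 : 16 / 15 * h ^ 2 * D ^ 2 ≤ K * h ^ 2 * D ^ 2 := by
      have : (16 : ℝ) / 15 ≤ K := by linarith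
      gcongr
    simp at h1
    linarith
  have hen : ∀ t, |t - z| ≤ ρ → (A t / h) ^ 2 + A' t ^ 2 ≤ K * D ^ 2 := by
    intro t ht
    have h1 := energy_le hAd hAd' (h := h) (K := 11 + Mo) (ρ := ρ) hh (z := z) (fun t ht => by
      have hzt := abs_le.mp ht
      have ha : |4 - t ^ 2| ≤ 12 * (10 + Mo) * h := by
        rw [show 4 - t ^ 2 = (2 - t) * (2 + t) by ring, abs_mul]
        have h1 : |2 - t| ≤ 2 * (10 + Mo) * h := by
          rw [abs_le]; constructor <;> linarith [hz.1, hz.2, hzt.1, hzt.2]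
        have h2 : |2 + t| ≤ 6 := by
          rw [abs_le]; constructor <;> linarith [hz.1, hz.2, hzt.1, hzt.2]
        calc |2 - t| * |2 + t| ≤ (2 * (10 + Mo) * h) * 6 := by gcongr
          _ = _ := by ring
      have h3 : |n ^ 2 / 16 * (4 - t ^ 2)| ≤ (10 + Mo) / h ^ 2 := by
        rw [abs_mul, abs_of_nonneg (by positivity : (0 : ℝ) ≤ n ^ 2 / 16)]
        calc _ ≤ (n : ℝ) ^ 2 / 16 * (12 * (10 + Mo) * h) := by gcongr
          _ = 12 / 16 * (10 + Mo) * (n ^ 2 * h) := by ring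
          _ = 12 / 16 * (10 + Mo) * (1 / h ^ 2) := by rw [hn2]
          _ ≤ 1 * (10 + Mo) * (1 / h ^ 2) := by gcongr; norm_num
          _ = _ := by ring
      have h4 : (11 + Mo) / h ^ 2 = (10 + Mo) / h ^ 2 + 1 / h ^ 2 := by rw [← add_div]; ring_nf
      have h5 := abs_le.mp h3
      have h6 := hql t
      have h7 := hqu t
      have h8 : 0 < 1 / h ^ 2 := by positivity
      rw [abs_le, h4]
      constructor <;> linarith [h5.1, h5.2]) ht
    rw [hAz] at h1
    simp only [zero_div, ne_eq, OfNat.ofNat_ne_zero, not_false_eq_true, zero_pow, zero_add] at h1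
    refine h1.trans ?_
    rw [mul_comm K]
    have h2 : (1 + (11 + Mo)) / h * |t - z| ≤ (12 + Mo) ^ 2 := by
      calc _ ≤ (1 + (11 + Mo)) / h * ρ := by gcongr
        _ = (12 + Mo) * (10 + Mo) := by rw [hρ]; field_simp; ring
        _ ≤ _ := by nlinarith
    have h3 : Real.exp ((1 + (11 + Mo)) / h * |t - z|) ≤ K := by
      have := Real.exp_le_exp.mpr h2
      have := Real.exp_pos ((12 + Mo) ^ 2)
      linarith
    gcongr
  have hρ0 : 0 < ρ := by positivity
  have hρh : h ≤ ρ := by rw [hρ]; nlinarith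
  have hD0 : D ≠ 0 := by
    intro h0
    apply hQ0
    apply Polynomial.eq_zero_of_infinite_isRoot
    refine Set.Infinite.mono (s := Set.Icc z (z + ρ)) ?_ (Set.Icc_infinite (by linarith))
    intro t ht
    have h1 := hen t (by rw [abs_le]; constructor <;> linarith [ht.1, ht.2])
    rw [h0] at h1
    have h2 : (A t / h) ^ 2 = 0 := by
      have := sq_nonneg (A t / h); have := sq_nonneg (A' t); linarith
    have h3 : A t = 0 := by
      have := pow_eq_zero_iff (two_ne_zero) |>.mp h2
      rcases div_eq_zero_iff.mp this with h | h
      · exact h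
      · exact absurd h hh.ne'
    rcases mul_eq_zero.mp h3 with h | h
    · exact h
    · exact absurd h (he0 t).ne'
  have hD2 : 0 < D ^ 2 := by positivity
  have hmain : ∀ t, |t| ≤ 2 + Mo * h → A t ^ 2 ≤ K * h ^ 2 * D ^ 2 := by
    intro t ht
    have hev : A t ^ 2 = A |t| ^ 2 := by
      rcases abs_choice t with h | h
      · rw [h]
      · rw [h]
        simp only [hA, he]
        rw [mul_pow, mul_pow, ← sq_abs (Q.eval (-t)), hpar, sq_abs]
        congr 4; ring
    rw [hev]
    rcases le_total |t| z with h1 | h1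
    · exact hson _ ⟨abs_nonneg t, h1⟩
    · have h2 := hen |t| (by
        rw [abs_of_nonneg (by linarith), hρ]; nlinarith [hz.1])
      have h3 : (A |t| / h) ^ 2 ≤ K * D ^ 2 := by have := sq_nonneg (A' |t|); linarith
      rw [div_pow, div_le_iff₀ (by positivity)] at h3
      linarith
  have hlip : ∀ t, |t - z| ≤ ρ → A t ^ 2 ≤ K * D ^ 2 * (t - z) ^ 2 := by
    intro t ht
    have h1 := Convex.norm_image_sub_le_of_norm_hasDerivWithin_le (f := A) (f' := A')
      (C := √(K * D ^ 2)) (s := Set.Icc (z - ρ) (z + ρ)) (x := z) (y := t)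
      (fun y _ => (hAd y).hasDerivWithinAt) (fun y hy => by
        apply Real.abs_le_sqrt
        have := hen y (by rw [abs_le]; constructor <;> linarith [hy.1, hy.2])
        have := sq_nonneg (A y / h)
        linarith) (convex_Icc _ _) ⟨by linarith, by linarith⟩
      ⟨by linarith [(abs_le.mp ht).1], by linarith [(abs_le.mp ht).2]⟩
    rw [hAz, sub_zero, Real.norm_eq_abs, Real.norm_eq_abs] at h1
    have h2 : |A t| ^ 2 ≤ (√(K * D ^ 2) * |t - z|) ^ 2 := by gcongr
    rwa [mul_pow, Real.sq_sqrt (by positivity), sq_abs, sq_abs] at h2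
  obtain ⟨R, hR⟩ := Polynomial.dvd_iff_isRoot.mpr hQz
  have hR0 : R ≠ 0 := by rintro rfl; exact hQ0 (by rw [hR, mul_zero])
  have hRdeg : R.natDegree + 1 ≤ m := by
    have : Q.natDegree = 1 + R.natDegree := by
      rw [hR, Polynomial.natDegree_mul (Polynomial.X_sub_C_ne_zero z) hR0,
        Polynomial.natDegree_X_sub_C]
    omega
  have hRe : ∀ t, Q.eval t = (t - z) * R.eval t := by
    intro t; rw [hR]; simp
  have hDR : D = R.eval z * e z := by
    rw [hD]; simp only [hA']
    rw [hQz, hR]; simp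
  have hRz : R.eval z ≠ 0 := by
    intro h0; rw [h0, zero_mul] at hDR; exact hD0 hDR
  have hp : ∀ t, |(Polynomial.C ((R.eval z ^ 2)⁻¹) * R ^ 2).eval t| *
      Real.exp (-(n * (t ^ 2 - z ^ 2) / 4)) = (R.eval t * e t) ^ 2 / D ^ 2 := by
    intro t
    have h1 : Real.exp (-(n * (t ^ 2 - z ^ 2) / 4)) = e t ^ 2 / e z ^ 2 := by
      simp only [he]
      rw [← Real.exp_nat_mul, ← Real.exp_nat_mul, ← Real.exp_sub]
      congr 1; push_cast; ring
    rw [h1, hDR]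
    simp only [Polynomial.eval_mul, Polynomial.eval_C, Polynomial.eval_pow]
    rw [abs_of_nonneg (by positivity)]
    have := (he0 z).ne'
    field_simp
  refine ⟨z, hz, Polynomial.C ((R.eval z ^ 2)⁻¹) * R ^ 2, ?_, ?_, ?_⟩
  · refine lt_of_le_of_lt (Polynomial.natDegree_C_mul_le _ _) ?_
    rw [Polynomial.natDegree_pow]
    omega
  · simp only [Polynomial.eval_mul, Polynomial.eval_C, Polynomial.eval_pow]
    field_simp
  · intro t ht
    rw [hp]
    have hb : (R.eval t * e t) ^ 2 / D ^ 2 * (t - z) ^ 2 ≤ K * h ^ 2 := by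
      have h1 := hmain t ht
      have h2 : A t ^ 2 = (R.eval t * e t) ^ 2 * (t - z) ^ 2 := by
        simp only [hA]; rw [hRe]; ring
      rw [h2] at h1
      rw [div_mul_eq_mul_div, div_le_iff₀ hD2]
      exact h1
    refine ⟨?_, hb⟩
    by_cases htz : t = z
    · rw [htz, ← hDR, div_self hD2.ne']; linarith
    have htz2 : 0 < (t - z) ^ 2 := by
      have : t - z ≠ 0 := sub_ne_zero.mpr htz
      positivity
    by_cases hc : |t - z| ≤ ρ
    · have h1 := hlip t hc
      have h2 : A t ^ 2 = (R.eval t * e t) ^ 2 * (t - z) ^ 2 := by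
        simp only [hA]; rw [hRe]; ring
      rw [h2] at h1
      rw [div_le_iff₀ hD2]
      exact le_of_mul_le_mul_right h1 htz2
    · push Not at hc
      have h1 : h ^ 2 ≤ (t - z) ^ 2 := by
        rw [← sq_abs (t - z)]
        have : h ≤ |t - z| := by linarith
        gcongr
      have h2 : (R.eval t * e t) ^ 2 / D ^ 2 * h ^ 2 ≤ K * h ^ 2 := by
        refine le_trans ?_ hb
        gcongr
      exact le_of_mul_le_mul_right h2 (by positivity)

theorem norm_weightedLagrange_ofReal (n : ℕ) (x : Fin n → ℝ) (j : Fin n) (t : ℝ) :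
    ‖weightedLagrange n x j t‖ = (∏ k ∈ Finset.univ.erase j, |t - x k| / |x j - x k|) *
      Real.exp (-(n * (t ^ 2 - x j ^ 2) / 4)) := by
  rw [weightedLagrange, norm_mul, norm_prod, Complex.norm_exp]
  congr 1
  · refine Finset.prod_congr rfl fun k _ => ?_
    rw [norm_div, ← Complex.ofReal_sub, ← Complex.ofReal_sub, Complex.norm_real, Complex.norm_real,
      Real.norm_eq_abs, Real.norm_eq_abs]
  · congr 1
    rw [show (-(n * ((t : ℂ) ^ 2 - (x j : ℂ) ^ 2) / 4)) =
      ((-(n * (t ^ 2 - x j ^ 2) / 4) : ℝ) : ℂ) by push_cast; ring, Complex.ofReal_re]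

theorem abs_eval_le_sum_weightedLagrange {n : ℕ} {x : Fin n → ℝ} (hx : Function.Injective x)
    {p : Polynomial ℝ} (hp : p.natDegree < n) (z : ℝ) :
    |p.eval z| ≤ ∑ j, (|p.eval (x j)| * Real.exp (-(n * (x j ^ 2 - z ^ 2) / 4))) *
      ‖weightedLagrange n x j z‖ := by
  have hdeg : p.degree < (Finset.univ : Finset (Fin n)).card := by
    rw [Finset.card_univ, Fintype.card_fin]
    exact (Polynomial.degree_le_natDegree).trans_lt (by exact_mod_cast hp)
  have h1 := Lagrange.eq_interpolate (v := x) (s := Finset.univ) hx.injOn hdeg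
  have h2 := congrArg (Polynomial.eval z) h1
  rw [Lagrange.interpolate_apply, Polynomial.eval_finsetSum] at h2
  rw [h2]
  refine (Finset.abs_sum_le_sum_abs _ _).trans (Finset.sum_le_sum fun j _ => le_of_eq ?_)
  rw [norm_weightedLagrange_ofReal, Polynomial.eval_mul, Polynomial.eval_C, abs_mul, Lagrange.basis,
    Polynomial.eval_prod, Finset.abs_prod]
  have h3 : ∏ k ∈ Finset.univ.erase j, |Polynomial.eval z (Lagrange.basisDivisor (x j) (x k))|
      = ∏ k ∈ Finset.univ.erase j, |z - x k| / |x j - x k| := by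
    refine Finset.prod_congr rfl fun k _ => ?_
    rw [Lagrange.basisDivisor]
    simp [abs_mul, abs_inv]; ring
  have h4 : Real.exp (-(n * (x j ^ 2 - z ^ 2) / 4)) * Real.exp (-(n * (z ^ 2 - x j ^ 2) / 4)) = 1 := by
    rw [← Real.exp_add, Real.exp_eq_one_iff]; ring
  rw [h3]
  linear_combination (-|Polynomial.eval (x j) p| *
    ∏ k ∈ Finset.univ.erase j, |z - x k| / |x j - x k|) * h4

theorem countConst_pos {C : ℝ} (hC : 1 ≤ C) : 1 ≤ countConst C := by
  have := Real.log_nonneg hC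
  unfold countConst; linarith

/-- Sums of `1 / (1 + d²)` type over the rescaled particles are bounded. -/
theorem sum_near_edge_le {n : ℕ} {x : Fin n → ℝ} (hx : Function.Injective x) {C h : ℝ}
    (hC : 1 ≤ C) (hh : 0 < h) (hnh : (n : ℝ) ^ 2 * h ^ 3 = 1) (hb : LagrangeBounded n x C)
    {z : ℝ} (hz : |z - 2| ≤ 10 * h) {f : Fin n → ℝ} (hf1 : ∀ k, f k ≤ 1)
    (hf2 : ∀ k, f k * (x k - z) ^ 2 ≤ h ^ 2) : ∑ k, f k ≤ 2048 * countConst C := by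
  have := sum_le_of_card_le (d := fun k => |x k - z| / h) (f := f) (B := 64 * countConst C) ?_ hf1 ?_
  · linarith
  · intro u hu
    have h1 := card_near_edge_le hx hC hh hnh hb (u := 4 * u) (by linarith)
    have h2 : ((Finset.univ.filter fun k => |x k - z| / h ≤ u ^ 2).card : ℝ) ≤
        (Finset.univ.filter fun k => |x k - 2| ≤ (4 * u) ^ 2 * h).card := by
      norm_cast
      apply Finset.card_le_card
      intro k hk
      simp only [Finset.mem_filter, Finset.mem_univ, true_and] at *
      rw [div_le_iff₀ hh] at hk
      have h3 : |x k - 2| ≤ |x k - z| + |z - 2| := by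
        have := abs_add_le (x k - z) (z - 2); simpa using this
      have h4 : h ≤ u ^ 2 * h := le_mul_of_one_le_left hh.le (one_le_pow₀ hu)
      linarith [show (4 * u) ^ 2 * h = 16 * (u ^ 2 * h) by ring]
    calc _ ≤ _ := h2
      _ ≤ _ := h1
      _ = _ := by ring
  · intro k hk
    have h0 : 0 < |x k - z| := by
      rw [lt_div_iff₀ hh] at hk; linarith
    have h1 := hf2 k
    rw [one_div_div, div_pow, sq_abs, le_div_iff₀]
    · exact h1
    · rw [← sq_abs]; positivity

/-- At a suitable point near the edge some weighted Lagrange function is bounded below. -/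
theorem exists_weightedLagrange_ge {C : ℝ} (hC : 1 ≤ C) : ∃ K : ℝ, 1 ≤ K ∧ ∃ h₀ : ℝ, 0 < h₀ ∧
    ∀ (n : ℕ) (h : ℝ), 0 < h → h ≤ h₀ → (n : ℝ) ^ 2 * h ^ 3 = 1 → ∀ x : Fin n → ℝ,
    Function.Injective x → LagrangeBounded n x C → ∃ z ∈ Set.Icc (2 - 10 * h) (2 - 5 * h),
    ∃ j, 1 ≤ K * ‖weightedLagrange n x j z‖ := by
  obtain ⟨K, hK1, hK⟩ := exists_anchor (one_le_outerConst C)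
  have hcc := countConst_pos hC
  refine ⟨K * (2048 * countConst C) + 1, by nlinarith, 1 / (10 + outerConst C), ?_, ?_⟩
  · have := one_le_outerConst C; positivity
  intro n h hh hh0 hnh x hx hb
  obtain ⟨z, hz, p, hpd, hpz, hp⟩ := hK n h hh (by
    have := one_le_outerConst C
    rwa [le_div_iff₀ (by positivity)] at hh0) hnh
  refine ⟨z, hz, ?_⟩
  by_contra! hcon
  have hsum := abs_eval_le_sum_weightedLagrange hx hpd z
  rw [hpz, abs_one] at hsum
  set v : Fin n → ℝ := fun j => |p.eval (x j)| * Real.exp (-(n * (x j ^ 2 - z ^ 2) / 4)) with hv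
  have hxb : ∀ k, |x k| ≤ 2 + outerConst C * h := by
    intro k
    have h1 := le_two_add_of_lagrangeBounded hx hC hh hnh hb k
    have h2 := le_two_add_of_lagrangeBounded (neg_injective.comp hx) hC hh hnh hb.neg k
    simp only [Function.comp_apply] at h2
    rw [abs_le]; constructor <;> linarith
  have hs := sum_near_edge_le hx hC hh hnh hb (z := z) (f := fun k => v k / K)
    (by rw [abs_le]; constructor <;> linarith [hz.1, hz.2])
    (fun k => by
      rw [div_le_one (by linarith)]; exact (hp (x k) (hxb k)).1)
    (fun k => by
      rw [div_mul_eq_mul_div, div_le_iff₀ (by linarith)]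
      have := (hp (x k) (hxb k)).2
      linarith)
  rw [← Finset.sum_div, div_le_iff₀ (by linarith)] at hs
  have hv0 : ∀ k, 0 ≤ v k := fun k => by positivity
  set K' := K * (2048 * countConst C) + 1 with hK'
  have hK'0 : 0 < K' := by positivity
  have h1 : ∑ j, v j * ‖weightedLagrange n x j z‖ ≤ ∑ j, v j * (1 / K') := by
    refine Finset.sum_le_sum fun j _ => ?_
    have h2 : ‖weightedLagrange n x j z‖ ≤ 1 / K' := by
      rw [le_div_iff₀ hK'0]; linarith [hcon j]
    exact mul_le_mul_of_nonneg_left h2 (hv0 j)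
  rw [← Finset.sum_mul] at h1
  have h3 : (1 : ℝ) ≤ (∑ j, v j) * (1 / K') := hsum.trans h1
  rw [mul_one_div, le_div_iff₀ hK'0] at h3
  linarith

/-- The Borel-Carathéodory inequality on the upper half-plane. -/
theorem norm_sub_le_of_re_nonneg {f : ℂ → ℂ} (hf : ∀ z : ℂ, 0 < z.im → DifferentiableAt ℂ f z)
    (hre : ∀ z : ℂ, 0 < z.im → 0 ≤ (f z).re) {z₀ z : ℂ} (hz₀ : 0 < z₀.im) (hz : 0 < z.im) {K : ℝ}
    (hK : 0 < K) (hfK : (f z₀).re ≤ K) :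
    ‖f z - f z₀‖ ≤ K * ‖z - (starRingEnd ℂ) z₀‖ ^ 2 / (z.im * z₀.im) := by
  set c := (starRingEnd ℂ) z₀ with hc
  have hcim : c.im = -z₀.im := by simp [hc]
  have hcre : c.re = z₀.re := by simp [hc]
  set φ : ℂ → ℂ := fun w => (z₀ - c * w) / (1 - w) with hφ
  have h1w : ∀ w ∈ Metric.ball (0 : ℂ) 1, 1 - w ≠ 0 := by
    intro w hw h0
    have : w = 1 := by linear_combination -h0
    rw [this] at hw; simp at hw
  have hφim : ∀ w ∈ Metric.ball (0 : ℂ) 1, 0 < (φ w).im := by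
    intro w hw
    have hw1 : ‖w‖ < 1 := by simpa using hw
    have hw2 : w.re * w.re + w.im * w.im < 1 := by
      rw [← Complex.normSq_apply, Complex.normSq_eq_norm_sq]
      exact pow_lt_one₀ (norm_nonneg _) hw1 two_ne_zero
    have hN : 0 < Complex.normSq (1 - w) := Complex.normSq_pos.mpr (h1w w hw)
    have : (φ w).im = z₀.im * (1 - (w.re * w.re + w.im * w.im)) / Complex.normSq (1 - w) := by
      simp only [hφ, Complex.div_im, Complex.sub_re, Complex.sub_im, Complex.mul_re,
        Complex.mul_im, hcim, hcre, Complex.one_re, Complex.one_im]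
      field_simp
      ring
    rw [this]
    exact div_pos (mul_pos hz₀ (by linarith)) hN
  have hzc : z - c ≠ 0 := by
    intro h0
    have := congrArg Complex.im h0
    rw [Complex.sub_im, hcim] at this
    simp at this; linarith
  set w := (z - z₀) / (z - c) with hw
  have hd1 : Complex.normSq (z - c) - Complex.normSq (z - z₀) = 4 * (z.im * z₀.im) := by
    rw [Complex.normSq_apply, Complex.normSq_apply]
    simp only [Complex.sub_re, Complex.sub_im, hcim, hcre]; ring
  rw [Complex.normSq_eq_norm_sq, Complex.normSq_eq_norm_sq] at hd1
  have hzz : 0 < z.im * z₀.im := mul_pos hz hz₀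
  have hnc : 0 < ‖z - c‖ := norm_pos_iff.mpr hzc
  have hwn : ‖w‖ * ‖z - c‖ = ‖z - z₀‖ := by rw [hw, norm_div]; field_simp
  have hw1 : ‖w‖ < 1 := by
    rw [hw, norm_div, div_lt_one hnc]
    exact lt_of_pow_lt_pow_left₀ 2 hnc.le (by linarith)
  have hwb : w ∈ Metric.ball (0 : ℂ) 1 := by simpa using hw1
  have hφw : φ w = z := by
    have h1 := h1w w hwb
    have hz0c : z₀ - c ≠ 0 := by
      intro h0
      have := congrArg Complex.im h0
      rw [Complex.sub_im, hcim] at this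
      simp at this; linarith
    simp only [hφ]
    rw [div_eq_iff h1, hw]
    field_simp
    ring
  have key := Complex.borelCaratheodory_zero (f := fun w => f z₀ - f (φ w)) (M := K) (R := 1) hK
    (fun w hw => by
      have h1 := h1w w hw
      have h2 := hf _ (hφim w hw)
      have h3 : DifferentiableAt ℂ φ w := by
        simp only [hφ]; fun_prop (disch := assumption)
      exact ((DifferentiableAt.comp w h2 h3).const_sub _).differentiableWithinAt)
    (fun w hw => by
      have := hre _ (hφim w hw)
      simp only [Set.mem_ofPred_eq, Complex.sub_re]
      linarith) one_pos hwb (by simp [hφ])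
  simp only [hφw] at key
  rw [norm_sub_rev]
  refine key.trans ?_
  have h1 : 0 < 1 - ‖w‖ := by linarith
  rw [div_le_div_iff₀ h1 hzz]
  have h2 : 4 * (z.im * z₀.im) = ‖z - c‖ ^ 2 * ((1 - ‖w‖) * (1 + ‖w‖)) := by
    rw [← hd1, ← hwn]; ring
  have hw0 := norm_nonneg w
  have h3 : 2 * K * ‖w‖ * (4 * (z.im * z₀.im)) ≤ 4 * (K * ‖z - c‖ ^ 2 * (1 - ‖w‖)) := by
    rw [h2]
    have h4 : 0 ≤ K * ‖z - c‖ ^ 2 * (1 - ‖w‖) := by positivity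
    have h5 : ‖w‖ * (1 + ‖w‖) ≤ 2 := by nlinarith
    calc 2 * K * ‖w‖ * (‖z - c‖ ^ 2 * ((1 - ‖w‖) * (1 + ‖w‖)))
        = 2 * (K * ‖z - c‖ ^ 2 * (1 - ‖w‖)) * (‖w‖ * (1 + ‖w‖)) := by ring
      _ ≤ 2 * (K * ‖z - c‖ ^ 2 * (1 - ‖w‖)) * 2 := by gcongr
      _ = _ := by ring
  linarith

theorem norm_weightedLagrange_add_I_ge (n : ℕ) (x : Fin n → ℝ) (j : Fin n) (t s : ℝ) :
    ‖weightedLagrange n x j t‖ ≤ ‖weightedLagrange n x j (t + s * Complex.I)‖ := by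
  unfold weightedLagrange
  rw [norm_mul, norm_mul, norm_prod, norm_prod, Complex.norm_exp, Complex.norm_exp]
  have h1 : ∏ k ∈ Finset.univ.erase j, ‖((t : ℂ) - x k) / (x j - x k)‖ ≤
      ∏ k ∈ Finset.univ.erase j, ‖((t : ℂ) + s * Complex.I - x k) / (x j - x k)‖ := by
    refine Finset.prod_le_prod (fun _ _ => norm_nonneg _) fun k _ => ?_
    rw [norm_div, norm_div]
    gcongr
    rw [← Complex.ofReal_sub, Complex.norm_real, Real.norm_eq_abs]
    have := Complex.abs_re_le_norm ((t : ℂ) + s * Complex.I - x k)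
    simpa using this
  have h2 : (-(n * ((t : ℂ) ^ 2 - (x j : ℂ) ^ 2) / 4)).re ≤
      (-(n * (((t : ℂ) + s * Complex.I) ^ 2 - (x j : ℂ) ^ 2) / 4)).re := by
    have h3 : -(n * (((t : ℂ) + s * Complex.I) ^ 2 - (x j : ℂ) ^ 2) / 4) =
        -(n * ((t : ℂ) ^ 2 - (x j : ℂ) ^ 2) / 4) + ((n * s ^ 2 / 4 : ℝ) : ℂ)
          + ((-(n * t * s / 2) : ℝ) : ℂ) * Complex.I := by
      push_cast
      linear_combination (-(n : ℂ) * s ^ 2 / 4) * Complex.I_sq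
    rw [h3, Complex.add_re, Complex.add_re, Complex.ofReal_re, Complex.re_ofReal_mul, Complex.I_re]
    have : 0 ≤ (n : ℝ) * s ^ 2 / 4 := by positivity
    linarith
  gcongr

/-- The logarithm of the gap in the Bernstein-Walsh inequality for the weighted Lagrange
functions, as a holomorphic function on the upper half-plane. -/
noncomputable def lagrangeGap (n : ℕ) (x : Fin n → ℝ) (j : Fin n) (C : ℝ) (z : ℂ) : ℂ :=
  Real.log C + n * edgeH (Complex.sqrt (z - 2)) + n * (z ^ 2 - (x j : ℂ) ^ 2) / 4 -
    ∑ k ∈ Finset.univ.erase j, (Complex.log (z - x k) - Real.log |x j - x k|)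

theorem mem_slitPlane_of_im_pos {z : ℂ} (hz : 0 < z.im) (a : ℝ) : z - a ∈ Complex.slitPlane := by
  right
  simp only [Complex.sub_im, Complex.ofReal_im, sub_zero]
  exact hz.ne'

theorem edge_slit_of_im_pos {z : ℂ} (hz : 0 < z.im) :
    4 + Complex.sqrt (z - 2) ^ 2 ∈ Complex.slitPlane := by
  rw [complex_sqrt_sq, show 4 + (z - 2) = z - ((-2 : ℝ) : ℂ) by push_cast; ring]
  exact mem_slitPlane_of_im_pos hz _

theorem differentiableAt_lagrangeGap (n : ℕ) (x : Fin n → ℝ) (j : Fin n) (C : ℝ) {z : ℂ}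
    (hz : 0 < z.im) : DifferentiableAt ℂ (lagrangeGap n x j C) z := by
  have h2 : z - 2 ∈ Complex.slitPlane := by
    have := mem_slitPlane_of_im_pos hz 2
    push_cast at this; exact this
  have hs := edge_slit_of_im_pos hz
  have hH : DifferentiableAt ℂ edgeH (Complex.sqrt (z - 2)) := by
    refine (hasDerivAt_edgeH hs ?_).differentiableAt
    have h3 := complex_sqrt_re_nonneg (z - 2)
    have h4 := edgeRoot_re_pos hs
    rw [Complex.add_re]; linarith
  have hq : DifferentiableAt ℂ (fun z : ℂ => Complex.sqrt (z - 2)) z :=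
    DifferentiableAt.comp (f := fun z : ℂ => z - 2) z (Complex.differentiableAt_sqrt h2)
      (by fun_prop)
  have hHq : DifferentiableAt ℂ (fun z : ℂ => edgeH (Complex.sqrt (z - 2))) z :=
    DifferentiableAt.comp (f := fun z : ℂ => Complex.sqrt (z - 2)) z hH hq
  have hlog : DifferentiableAt ℂ (fun z : ℂ => ∑ k ∈ Finset.univ.erase j,
      (Complex.log (z - x k) - Real.log |x j - x k|)) z := by
    refine DifferentiableAt.fun_sum fun k _ => ?_
    have := mem_slitPlane_of_im_pos hz (x k)
    fun_prop (disch := assumption)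
  unfold lagrangeGap
  fun_prop

theorem re_lagrangeGap {n : ℕ} {x : Fin n → ℝ} (hx : Function.Injective x) (j : Fin n) (C : ℝ)
    {z : ℂ} (hz : 0 < z.im) : (lagrangeGap n x j C z).re =
      Real.log C + n * (edgeH (Complex.sqrt (z - 2))).re - Real.log ‖weightedLagrange n x j z‖ ∧
      0 < ‖weightedLagrange n x j z‖ := by
  have hne : ∀ k ∈ Finset.univ.erase j, ‖(z - x k) / (x j - x k)‖ ≠ 0 := by
    intro k hk
    rw [norm_ne_zero_iff]
    refine div_ne_zero (Complex.slitPlane_ne_zero (mem_slitPlane_of_im_pos hz _)) ?_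
    rw [sub_ne_zero]
    intro h
    exact (Finset.ne_of_mem_erase hk) (hx (Complex.ofReal_injective h)).symm
  have hlog : Real.log ‖weightedLagrange n x j z‖ =
      ∑ k ∈ Finset.univ.erase j, (Real.log ‖z - x k‖ - Real.log |x j - x k|) -
        (n * (z ^ 2 - (x j : ℂ) ^ 2) / 4).re := by
    rw [weightedLagrange, norm_mul, norm_prod, Real.log_mul (Finset.prod_ne_zero_iff.mpr hne)
      (norm_ne_zero_iff.mpr (Complex.exp_ne_zero _)), Real.log_prod (fun k hk => hne k hk),
      Complex.norm_exp, Real.log_exp, Complex.neg_re, ← sub_eq_add_neg]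
    congr 1
    refine Finset.sum_congr rfl fun k hk => ?_
    have h1 := hne k hk
    rw [norm_div] at h1 ⊢
    rw [Real.log_div (fun h => h1 (by rw [h, zero_div])) (fun h => h1 (by rw [h, div_zero])),
      ← Complex.ofReal_sub, Complex.norm_real, Real.norm_eq_abs]
  constructor
  · rw [hlog, lagrangeGap, Complex.sub_re, Complex.add_re, Complex.add_re, Complex.re_sum,
      Complex.ofReal_re]
    have h1 : ((n : ℂ) * edgeH (Complex.sqrt (z - 2))).re
        = n * (edgeH (Complex.sqrt (z - 2))).re := by
      rw [← Complex.ofReal_natCast, Complex.re_ofReal_mul]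
    rw [h1]
    have h2 : ∑ k ∈ Finset.univ.erase j, (Complex.log (z - x k) - (Real.log |x j - x k| : ℝ)).re =
        ∑ k ∈ Finset.univ.erase j, (Real.log ‖z - x k‖ - Real.log |x j - x k|) := by
      refine Finset.sum_congr rfl fun k _ => ?_
      rw [Complex.sub_re, Complex.log_re, Complex.ofReal_re]
    rw [h2]; ring
  · rw [weightedLagrange, norm_mul, norm_prod]
    exact mul_pos (Finset.prod_pos fun k hk => (norm_nonneg _).lt_of_ne' (hne k hk))
      (norm_pos_iff.mpr (Complex.exp_ne_zero _))

theorem im_lagrangeGap (n : ℕ) (x : Fin n → ℝ) (j : Fin n) (C : ℝ) (z : ℂ) :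
    (lagrangeGap n x j C z).im = n * (edgeH (Complex.sqrt (z - 2))).im + n * (z.re * z.im) / 2 -
      ∑ k ∈ Finset.univ.erase j, Complex.arg (z - x k) := by
  rw [lagrangeGap, Complex.sub_im, Complex.add_im, Complex.add_im, Complex.im_sum,
      Complex.ofReal_im]
  have h1 : ((n : ℂ) * edgeH (Complex.sqrt (z - 2))).im
      = n * (edgeH (Complex.sqrt (z - 2))).im := by
    rw [← Complex.ofReal_natCast, Complex.im_ofReal_mul]
  have h3 : ((n : ℂ) * (z ^ 2 - (x j : ℂ) ^ 2) / 4).im = n * (z.re * z.im) / 2 := by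
    rw [show (n : ℂ) * (z ^ 2 - (x j : ℂ) ^ 2) / 4 = ((n / 4 : ℝ) : ℂ) * (z ^ 2 - ((x j ^ 2 : ℝ) : ℂ))
      by push_cast; ring, Complex.im_ofReal_mul, Complex.sub_im, Complex.ofReal_im, sq, Complex.mul_im]
    ring
  have h2 : ∑ k ∈ Finset.univ.erase j, (Complex.log (z - x k) - (Real.log |x j - x k| : ℝ)).im =
      ∑ k ∈ Finset.univ.erase j, Complex.arg (z - x k) := by
    refine Finset.sum_congr rfl fun k _ => ?_
    rw [Complex.sub_im, Complex.log_im, Complex.ofReal_im, sub_zero]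
  rw [h1, h2, h3]; ring

theorem exists_lagrangeGap_close {C : ℝ} (hC : 1 ≤ C) : ∃ K : ℝ, 0 < K ∧ ∃ h₀ : ℝ, 0 < h₀ ∧
    ∀ (n : ℕ) (h : ℝ), 0 < h → h ≤ h₀ → (n : ℝ) ^ 2 * h ^ 3 = 1 → ∀ x : Fin n → ℝ,
    Function.Injective x → LagrangeBounded n x C → ∃ j : Fin n, ∀ (r η : ℝ) (z z' : ℂ),
    16 * h ≤ r → 0 < η → z.im = η * r → z'.im = η * r → ‖z - 2‖ ≤ 2 * r → ‖z' - 2‖ ≤ 2 * r →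
    ‖lagrangeGap n x j C z - lagrangeGap n x j C z'‖ ≤ K * (r / (η * h)) := by
  obtain ⟨K, hK1, h₀, hh₀, H⟩ := exists_weightedLagrange_ge hC
  set K₁ := Real.log C + 111 + Real.log K with hK₁
  have hlC := Real.log_nonneg hC
  have hlK := Real.log_nonneg hK1
  have hK₁pos : 0 < K₁ := by rw [hK₁]; linarith
  refine ⟨18 * K₁, by positivity, min h₀ (1 / 11), by positivity, ?_⟩
  intro n h hh hhle hnh x hx hb
  obtain ⟨z₁, hz₁, j, hj⟩ := H n h hh (hhle.trans (min_le_left _ _)) hnh x hx hb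
  have hh11 : 11 * h ≤ 1 := by
    have := hhle.trans (min_le_right _ _); linarith
  refine ⟨j, ?_⟩
  intro r η z z' hr hη hz hz' hzr hzr'
  have hr0 : 0 < r := by linarith
  set z₀ : ℂ := z₁ + h * Complex.I with hz₀
  have hz₀im : z₀.im = h := by simp [hz₀]
  have hz₀re : z₀.re = z₁ := by simp [hz₀]
  have hz₀pos : 0 < z₀.im := by rw [hz₀im]; exact hh
  have hz₁n : ‖((z₁ : ℂ) - 2)‖ ≤ 10 * h := by
    rw [show (z₁ : ℂ) - 2 = ((z₁ - 2 : ℝ) : ℂ) by push_cast; rfl, Complex.norm_real,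
      Real.norm_eq_abs, abs_le]
    constructor <;> linarith [hz₁.1, hz₁.2]
  have hhI : ‖(h : ℂ) * Complex.I‖ = h := by
    rw [norm_mul, Complex.norm_I, mul_one, Complex.norm_real, Real.norm_eq_abs, abs_of_pos hh]
  have hz₀n : ‖z₀ - 2‖ ≤ 11 * h := by
    have : z₀ - 2 = ((z₁ : ℂ) - 2) + h * Complex.I := by rw [hz₀]; ring
    rw [this]
    exact (norm_add_le _ _).trans (by linarith)
  have hre : ∀ w : ℂ, 0 < w.im → 0 ≤ (lagrangeGap n x j C w).re := by
    intro w hw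
    obtain ⟨h1, h2⟩ := re_lagrangeGap hx j C hw
    rw [h1]
    have h3 := norm_weightedLagrange_le_edge (hb j) (complex_sqrt_re_nonneg (w - 2))
      (edge_slit_of_im_pos hw)
    rw [complex_sqrt_sq, add_sub_cancel] at h3
    have h4 := Real.log_le_log h2 h3
    rw [Real.log_mul (by positivity) (by positivity), Real.log_exp] at h4
    linarith
  have hf0 : (lagrangeGap n x j C z₀).re ≤ K₁ := by
    obtain ⟨h1, h2⟩ := re_lagrangeGap hx j C hz₀pos
    rw [h1]
    have h3 : 1 ≤ K * ‖weightedLagrange n x j z₀‖ := by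
      refine hj.trans ?_
      gcongr
      exact norm_weightedLagrange_add_I_ge n x j z₁ h
    have h4 := Real.log_nonneg h3
    rw [Real.log_mul (by positivity) h2.ne'] at h4
    set s := ‖Complex.sqrt (z₀ - 2)‖ with hs
    have hs0 : 0 ≤ s := norm_nonneg _
    have hs2 : s ^ 2 = ‖z₀ - 2‖ := by
      rw [hs, ← norm_pow, complex_sqrt_sq]
    have hs1 : s ≤ 1 := by
      by_contra! h5
      nlinarith
    have h5 := (Complex.re_le_norm _).trans (norm_edgeH_le hs1)
    have h6 : (n : ℝ) * s ^ 3 ≤ 37 := by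
      refine le_of_sq_le_sq ?_ (by norm_num)
      calc ((n : ℝ) * s ^ 3) ^ 2 = (n : ℝ) ^ 2 * (s ^ 2) ^ 3 := by ring
        _ ≤ (n : ℝ) ^ 2 * (11 * h) ^ 3 := by rw [hs2]; gcongr
        _ = 1331 * ((n : ℝ) ^ 2 * h ^ 3) := by ring
        _ ≤ 37 ^ 2 := by rw [hnh]; norm_num
    have h7 : (n : ℝ) * (edgeH (Complex.sqrt (z₀ - 2))).re ≤ 111 := by
      calc (n : ℝ) * (edgeH (Complex.sqrt (z₀ - 2))).re ≤ n * (3 * s ^ 3) := by gcongr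
        _ = 3 * (n * s ^ 3) := by ring
        _ ≤ 111 := by linarith
    rw [hK₁]; linarith
  have key : ∀ w : ℂ, w.im = η * r → ‖w - 2‖ ≤ 2 * r →
      ‖lagrangeGap n x j C w - lagrangeGap n x j C z₀‖ ≤ 9 * K₁ * (r / (η * h)) := by
    intro w hw hwr
    have hwpos : 0 < w.im := by rw [hw]; positivity
    refine (norm_sub_le_of_re_nonneg (fun v hv => differentiableAt_lagrangeGap n x j C hv) hre
      hz₀pos hwpos hK₁pos hf0).trans ?_
    have h1 : ‖w - (starRingEnd ℂ) z₀‖ ≤ 3 * r := by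
      have : w - (starRingEnd ℂ) z₀ = (w - 2) - (((z₁ : ℂ) - 2) - h * Complex.I) := by
        rw [hz₀]; simp; ring
      rw [this]
      refine (norm_sub_le _ _).trans ?_
      have := norm_sub_le ((z₁ : ℂ) - 2) (h * Complex.I)
      linarith
    calc K₁ * ‖w - (starRingEnd ℂ) z₀‖ ^ 2 / (w.im * z₀.im)
        ≤ K₁ * (3 * r) ^ 2 / (w.im * z₀.im) := by gcongr
      _ = 9 * K₁ * (r / (η * h)) := by rw [hw, hz₀im]; field_simp; ring
  have e1 := key z hz hzr
  have e2 := key z' hz' hzr'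
  have : lagrangeGap n x j C z - lagrangeGap n x j C z' = (lagrangeGap n x j C z -
    lagrangeGap n x j C z₀) - (lagrangeGap n x j C z' - lagrangeGap n x j C z₀) := by ring
  rw [this]
  refine (norm_sub_le _ _).trans ?_
  linarith

/-- The angle under which the interval `[2 - r, 2 + r]`, lifted by `η r` into the upper
half-plane, is seen from the real point `a`. -/
noncomputable def edgeAngle (r η a : ℝ) : ℝ :=
  Complex.arg (((2 - r - a : ℝ) : ℂ) + (η * r : ℝ) * Complex.I) -
    Complex.arg (((2 + r - a : ℝ) : ℂ) + (η * r : ℝ) * Complex.I)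

theorem exists_edgeAngle_sum_close {C : ℝ} (hC : 1 ≤ C) : ∃ K : ℝ, 0 < K ∧ ∃ h₀ : ℝ, 0 < h₀ ∧
    ∀ (n : ℕ) (h : ℝ), 0 < h → h ≤ h₀ → (n : ℝ) ^ 2 * h ^ 3 = 1 → ∀ x : Fin n → ℝ,
    Function.Injective x → LagrangeBounded n x C → ∃ j : Fin n, ∀ r η : ℝ,
    16 * h ≤ r → 0 < η → η ≤ 1 →
    |∑ k ∈ Finset.univ.erase j, edgeAngle r η (x k) -
      n * ((edgeH (Complex.sqrt ((-r : ℝ) + (η * r : ℝ) * Complex.I))).im -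
        (edgeH (Complex.sqrt ((r : ℝ) + (η * r : ℝ) * Complex.I))).im) + n * η * r ^ 2|
      ≤ K * (r / (η * h)) := by
  obtain ⟨K, hK, h₀, hh₀, H⟩ := exists_lagrangeGap_close hC
  refine ⟨K, hK, h₀, hh₀, ?_⟩
  intro n h hh hhle hnh x hx hb
  obtain ⟨j, hj⟩ := H n h hh hhle hnh x hx hb
  refine ⟨j, ?_⟩
  intro r η hr hη hη1
  have hr0 : 0 < r := by linarith
  have hn : ∀ s : ℝ, |s| ≤ r → ‖((s : ℝ) : ℂ) + (η * r : ℝ) * Complex.I‖ ≤ 2 * r := by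
    intro s hs
    refine (norm_add_le _ _).trans ?_
    rw [norm_mul, Complex.norm_I, mul_one, Complex.norm_real, Complex.norm_real,
      Real.norm_eq_abs, Real.norm_eq_abs, abs_of_pos (by positivity : 0 < η * r)]
    nlinarith
  set z : ℂ := ((2 - r : ℝ) : ℂ) + (η * r : ℝ) * Complex.I with hz
  set z' : ℂ := ((2 + r : ℝ) : ℂ) + (η * r : ℝ) * Complex.I with hz'
  have hz2 : z - 2 = (-r : ℝ) + (η * r : ℝ) * Complex.I := by rw [hz]; push_cast; ring
  have hz2' : z' - 2 = (r : ℝ) + (η * r : ℝ) * Complex.I := by rw [hz']; push_cast; ring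
  have hzim : z.im = η * r := by simp [hz]
  have hzim' : z'.im = η * r := by simp [hz']
  have hzre : z.re = 2 - r := by simp [hz]
  have hzre' : z'.re = 2 + r := by simp [hz']
  have key := hj r η z z' hr hη hzim hzim' (by rw [hz2]; exact hn _ (by rw [abs_neg, abs_of_pos hr0]))
    (by rw [hz2']; exact hn _ (by rw [abs_of_pos hr0]))
  refine le_trans ?_ key
  rw [← norm_neg]
  refine le_trans (le_of_eq ?_) (Complex.abs_im_le_norm _)
  rw [Complex.neg_im, Complex.sub_im, im_lagrangeGap, im_lagrangeGap, hzim, hzim', hzre, hzre', hz2,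
    hz2']
  have hsum : ∑ k ∈ Finset.univ.erase j, edgeAngle r η (x k) =
      ∑ k ∈ Finset.univ.erase j, Complex.arg (z - x k) -
      ∑ k ∈ Finset.univ.erase j, Complex.arg (z' - x k) := by
    rw [← Finset.sum_sub_distrib]
    refine Finset.sum_congr rfl fun k _ => ?_
    rw [edgeAngle, hz, hz']
    congr 2 <;> (push_cast; ring)
  rw [hsum]
  congr 1
  ring

theorem eq_of_sq_eq_sq_of_re_pos {a b : ℂ} (ha : 0 < a.re) (hb : 0 < b.re) (h : a ^ 2 = b ^ 2) :
    a = b := by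
  rcases sq_eq_sq_iff_eq_or_eq_neg.mp h with h | h
  · exact h
  · rw [h, Complex.neg_re] at ha; linarith

theorem complex_sqrt_ofReal_mul {r : ℝ} (hr : 0 < r) {w : ℂ} (hw : w ∈ Complex.slitPlane) :
    Complex.sqrt (r * w) = √r * Complex.sqrt w := by
  have hrw : (r : ℂ) * w ∈ Complex.slitPlane := by
    rcases hw with h | h
    · left; rw [Complex.re_ofReal_mul]; positivity
    · right; rw [Complex.im_ofReal_mul]; positivity
  refine eq_of_sq_eq_sq_of_re_pos (complex_sqrt_re_pos hrw) ?_ ?_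
  · rw [Complex.re_ofReal_mul]
    have := complex_sqrt_re_pos hw
    positivity
  · rw [mul_pow, complex_sqrt_sq, complex_sqrt_sq, ← Complex.ofReal_pow, Real.sq_sqrt hr.le]

/-- The limiting angle sum per unit of `r ^ (3 / 2)`. -/
noncomputable def edgeFlux (η : ℝ) : ℝ :=
  (Complex.sqrt (1 + η * Complex.I) ^ 3).im - (Complex.sqrt (-1 + η * Complex.I) ^ 3).im

theorem complex_sqrt_neg_one_add {η : ℝ} (hη : 0 < η) :
    Complex.sqrt (-1 + η * Complex.I) = Complex.I * Complex.sqrt (1 + (-η : ℝ) * Complex.I) := by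
  refine eq_of_sq_eq_sq_of_re_pos (complex_sqrt_re_pos (Or.inr ?_)) ?_ ?_
  · simp [hη.ne']
  · rw [Complex.I_mul_re, Complex.sqrt, Complex.cpow_inv_two_im_eq_neg_sqrt, neg_neg, Real.sqrt_pos]
    · have := Complex.abs_re_lt_norm (z := 1 + (-η : ℝ) * Complex.I) |>.mpr (by simp [hη.ne'])
      have := (le_abs_self _).trans_lt this
      linarith
    · simp [hη]
  · rw [mul_pow, complex_sqrt_sq, complex_sqrt_sq, Complex.I_sq]; push_cast; ring

theorem exists_edgeFlux_close {ε : ℝ} (hε : 0 < ε) : ∃ η₀ : ℝ, 0 < η₀ ∧ ∀ η : ℝ, 0 < η → η ≤ η₀ →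
    |edgeFlux η - 1| ≤ ε := by
  have hc : ContinuousAt (fun η : ℝ => (Complex.sqrt (1 + η * Complex.I) ^ 3).im -
      ((Complex.I * Complex.sqrt (1 + (-η : ℝ) * Complex.I)) ^ 3).im) 0 := by
    have h1 : ContinuousAt Complex.sqrt (1 : ℂ) :=
      (Complex.differentiableAt_sqrt (by simp)).continuousAt
    have h2 : ContinuousAt (fun η : ℝ => Complex.sqrt (1 + η * Complex.I)) 0 :=
      ContinuousAt.comp (g := Complex.sqrt) (by simpa using h1) (by fun_prop)
    have h3 : ContinuousAt (fun η : ℝ => Complex.sqrt (1 + (-η : ℝ) * Complex.I)) 0 :=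
      ContinuousAt.comp (g := Complex.sqrt) (by simpa using h1) (by fun_prop)
    exact (Complex.continuous_im.continuousAt.comp (h2.pow 3)).sub
      (Complex.continuous_im.continuousAt.comp ((continuousAt_const.mul h3).pow 3))
  obtain ⟨δ, hδ, H⟩ := Metric.continuousAt_iff.mp hc ε hε
  refine ⟨δ / 2, by positivity, fun η hη hηδ => ?_⟩
  have h := H (x := η) (by rw [Real.dist_eq, sub_zero, abs_of_pos hη]; linarith)
  have hs1 : Complex.sqrt 1 = 1 := by simp [Complex.sqrt]
  have hI : (Complex.I ^ 3).im = -1 := by simp [pow_succ]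
  rw [Real.dist_eq] at h
  simp only [Complex.ofReal_zero, neg_zero, zero_mul, add_zero, hs1, mul_one, one_pow,
    Complex.one_im, hI] at h
  rw [edgeFlux, complex_sqrt_neg_one_add hη]
  have : (0 : ℝ) - -1 = 1 := by norm_num
  rw [this] at h
  exact h.le

theorem edgeH_im_sub_close {r η : ℝ} (hr : 0 < r) (hr1 : r ≤ 1 / 2) (hη : 0 < η) (hη1 : η ≤ 1) :
    |(edgeH (Complex.sqrt ((-r : ℝ) + (η * r : ℝ) * Complex.I))).im -
        (edgeH (Complex.sqrt ((r : ℝ) + (η * r : ℝ) * Complex.I))).im -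
      2 / 3 * √r ^ 3 * edgeFlux η| ≤ 12 * r * √r ^ 3 := by
  have key : ∀ w : ℂ, w ∈ Complex.slitPlane → ‖w‖ ≤ 2 →
      |(edgeH (Complex.sqrt (r * w))).im + 2 / 3 * √r ^ 3 * (Complex.sqrt w ^ 3).im|
        ≤ 6 * r * √r ^ 3 := by
    intro w hw hw2
    have hs : ‖Complex.sqrt (r * w)‖ ^ 2 ≤ 2 * r := by
      rw [← norm_pow, complex_sqrt_sq, norm_mul, Complex.norm_real, Real.norm_eq_abs, abs_of_pos hr]
      nlinarith
    have hs1 : ‖Complex.sqrt (r * w)‖ ≤ 1 := by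
      by_contra! h5; nlinarith
    have h1 := norm_edgeH_add_le hs1
    have h2 : 2 / 3 * √r ^ 3 * (Complex.sqrt w ^ 3).im =
        (2 / 3 * Complex.sqrt (r * w) ^ 3).im := by
      rw [complex_sqrt_ofReal_mul hr hw, mul_pow, show (2 / 3 : ℂ) * ((√r : ℂ) ^ 3 *
        Complex.sqrt w ^ 3) = ((2 / 3 * √r ^ 3 : ℝ) : ℂ) * Complex.sqrt w ^ 3 by push_cast; ring,
        Complex.im_ofReal_mul]
    rw [h2, ← Complex.add_im]
    refine (Complex.abs_im_le_norm _).trans (h1.trans ?_)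
    have h3 : ‖Complex.sqrt (r * w)‖ ≤ 3 / 2 * √r := by
      refine le_of_sq_le_sq ?_ (by positivity)
      rw [mul_pow, Real.sq_sqrt hr.le]; linarith
    calc ‖Complex.sqrt (r * w)‖ ^ 5 = ‖Complex.sqrt (r * w)‖ ^ 2 * ‖Complex.sqrt (r * w)‖ ^ 2 *
          ‖Complex.sqrt (r * w)‖ := by ring
      _ ≤ (2 * r) * (2 * r) * (3 / 2 * √r) := by gcongr
      _ = 6 * r * (r * √r) := by ring
      _ = 6 * r * √r ^ 3 := by
        congr 1
        nth_rewrite 1 [← Real.sq_sqrt hr.le]; ring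
  have hn : ∀ s : ℂ, ‖s‖ ≤ 1 → ‖s + η * Complex.I‖ ≤ 2 := by
    intro s hs
    refine (norm_add_le _ _).trans ?_
    rw [norm_mul, Complex.norm_I, mul_one, Complex.norm_real, Real.norm_eq_abs, abs_of_pos hη]
    linarith
  have e1 := key (-1 + η * Complex.I) (Or.inr (by simp [hη.ne'])) (hn _ (by simp))
  have e2 := key (1 + η * Complex.I) (Or.inr (by simp [hη.ne'])) (hn _ (by simp))
  rw [show (r : ℂ) * (-1 + η * Complex.I) = (-r : ℝ) + (η * r : ℝ) * Complex.I by push_cast; ring]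
    at e1
  rw [show (r : ℂ) * (1 + η * Complex.I) = (r : ℝ) + (η * r : ℝ) * Complex.I by push_cast; ring]
    at e2
  rw [abs_le] at e1 e2 ⊢
  rw [edgeFlux]
  constructor <;> linarith [e1.1, e1.2, e2.1, e2.2]

theorem arg_add_mul_I (a : ℝ) {y : ℝ} (hy : 0 < y) :
    Complex.arg ((a : ℂ) + y * Complex.I) = Real.pi / 2 - Real.arctan (a / y) := by
  have him : ((a : ℂ) + y * Complex.I).im = y := by simp
  have hre : ((a : ℂ) + y * Complex.I).re = a := by simp
  have h0 : 0 < Complex.arg ((a : ℂ) + y * Complex.I) := by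
    refine lt_of_le_of_ne (Complex.arg_nonneg_iff.mpr (by rw [him]; exact hy.le)) fun h => ?_
    have := (Complex.arg_eq_zero_iff.mp h.symm).2
    rw [him] at this; exact hy.ne' this
  have h1 : Complex.arg ((a : ℂ) + y * Complex.I) < Real.pi :=
    Complex.arg_lt_pi_iff.mpr (Or.inr (by rw [him]; exact hy.ne'))
  have h2 : Real.arctan (a / y) = Real.pi / 2 - Complex.arg ((a : ℂ) + y * Complex.I) := by
    refine Real.arctan_eq_of_tan_eq ?_ ⟨by linarith, by linarith⟩
    rw [Real.tan_pi_div_two_sub, Complex.tan_arg, him, hre, inv_div]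
  linarith

theorem edgeAngle_eq {r η : ℝ} (hr : 0 < r) (hη : 0 < η) (a : ℝ) :
    edgeAngle r η a = Real.arctan ((2 + r - a) / (η * r)) - Real.arctan ((2 - r - a) / (η * r)) := by
  rw [edgeAngle, arg_add_mul_I _ (by positivity), arg_add_mul_I _ (by positivity)]
  ring

theorem edgeAngle_mem {r η : ℝ} (hr : 0 < r) (hη : 0 < η) (a : ℝ) :
    edgeAngle r η a ∈ Set.Icc 0 Real.pi := by
  rw [edgeAngle_eq hr hη]
  constructor
  · rw [sub_nonneg]
    refine Real.arctan_strictMono.monotone ?_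
    gcongr
    linarith
  · have h1 := Real.arctan_lt_pi_div_two ((2 + r - a) / (η * r))
    have h2 := Real.neg_pi_div_two_lt_arctan ((2 - r - a) / (η * r))
    linarith

theorem arctan_sub_arctan_le {u v : ℝ} (huv : u ≤ v) : Real.arctan v - Real.arctan u ≤ v - u := by
  have hd : Differentiable ℝ fun x => x - Real.arctan x :=
    differentiable_id.sub Real.differentiable_arctan
  have : Monotone fun x => x - Real.arctan x := by
    refine monotone_of_deriv_nonneg hd fun x => ?_
    rw [deriv_fun_sub differentiableAt_fun_id (Real.differentiable_arctan x), Real.deriv_arctan]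
    simp only [deriv_id'']
    rw [sub_nonneg, div_le_one (by positivity)]
    nlinarith [sq_nonneg x]
  have := this huv
  simp only at this; linarith

theorem pi_div_two_sub_inv_le_arctan {u : ℝ} (hu : 0 < u) : Real.pi / 2 - u⁻¹ ≤ Real.arctan u := by
  have h1 := Real.arctan_inv_of_pos hu
  have h2 := arctan_sub_arctan_le (inv_pos.mpr hu).le
  rw [Real.arctan_zero] at h2
  linarith

theorem le_edgeAngle {r η a : ℝ} (hr : 0 < r) (hη : 0 < η) (ha : |a - 2| < r) :
    Real.pi - 2 * η * r / (r - |a - 2|) ≤ edgeAngle r η a := by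
  have hpos : 0 < r - |a - 2| := by linarith
  have key : ∀ d : ℝ, r - |a - 2| ≤ d →
      Real.pi / 2 - η * r / (r - |a - 2|) ≤ Real.arctan (d / (η * r)) := by
    intro d hd
    have hd0 : 0 < d := hpos.trans_le hd
    have := pi_div_two_sub_inv_le_arctan (u := d / (η * r)) (by positivity)
    rw [inv_div] at this
    refine le_trans ?_ this
    gcongr
  rw [edgeAngle_eq hr hη]
  have h1 := key (2 + r - a) (by linarith [le_abs_self (a - 2)])
  have h2 := key (-(2 - r - a)) (by linarith [neg_abs_le (a - 2)])
  rw [neg_div, Real.arctan_neg] at h2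
  have : 2 * η * r / (r - |a - 2|) = η * r / (r - |a - 2|) + η * r / (r - |a - 2|) := by ring
  linarith

theorem arctan_sub_arctan_le_of_pos {u v : ℝ} (hu : 0 < u) (huv : u ≤ v) :
    Real.arctan v - Real.arctan u ≤ u⁻¹ - v⁻¹ := by
  have h1 := Real.arctan_inv_of_pos hu
  have h2 := Real.arctan_inv_of_pos (hu.trans_le huv)
  have h3 := arctan_sub_arctan_le (inv_anti₀ hu huv)
  linarith

theorem edgeAngle_le {r η a : ℝ} (hr : 0 < r) (hη : 0 < η) (ha : r < |a - 2|) :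
    edgeAngle r η a ≤ 2 * η * r ^ 2 / (|a - 2| ^ 2 - r ^ 2) := by
  have hηr : 0 < η * r := by positivity
  have h1 : 0 < |a - 2| - r := by linarith
  have h2 : 0 < |a - 2| + r := by linarith
  have key := arctan_sub_arctan_le_of_pos (u := (|a - 2| - r) / (η * r))
    (v := (|a - 2| + r) / (η * r)) (by positivity) (by gcongr; linarith)
  have e : ((|a - 2| - r) / (η * r))⁻¹ - ((|a - 2| + r) / (η * r))⁻¹ =
      2 * η * r ^ 2 / (|a - 2| ^ 2 - r ^ 2) := by
    rw [inv_div, inv_div, show |a - 2| ^ 2 - r ^ 2 = (|a - 2| - r) * (|a - 2| + r) by ring]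
    field_simp; ring
  rw [e] at key
  refine le_trans (le_of_eq ?_) key
  rw [edgeAngle_eq hr hη]
  rcases abs_cases (a - 2) with ⟨h, _⟩ | ⟨h, _⟩ <;> rw [h]
  · rw [show (2 + r - a) / (η * r) = -((a - 2 - r) / (η * r)) by ring,
      show (2 - r - a) / (η * r) = -((a - 2 + r) / (η * r)) by ring, Real.arctan_neg,
      Real.arctan_neg]
    ring
  · congr 3 <;> ring

theorem exists_edgeAngle_total_close {C : ℝ} (hC : 1 ≤ C) {ε : ℝ} (hε : 0 < ε) :
    ∃ η₀ : ℝ, 0 < η₀ ∧ ∀ η : ℝ, 0 < η → η ≤ η₀ → ∃ s₀ : ℝ, 0 < s₀ ∧ ∀ s : ℝ, s₀ ≤ s →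
    ∃ h₀ : ℝ, 0 < h₀ ∧ ∀ (n : ℕ) (h : ℝ), 0 < h → h ≤ h₀ → (n : ℝ) ^ 2 * h ^ 3 = 1 →
    ∀ x : Fin n → ℝ, Function.Injective x → LagrangeBounded n x C →
    |∑ k, edgeAngle (s ^ 2 * h) η (x k) - 2 / 3 * s ^ 3| ≤ ε * s ^ 3 := by
  obtain ⟨K, hK, h₁, hh₁, H⟩ := exists_edgeAngle_sum_close hC
  obtain ⟨η₁, hη₁, Hη⟩ := exists_edgeFlux_close (show 0 < ε / 2 by positivity)
  refine ⟨min η₁ 1, by positivity, fun η hη hηle => ?_⟩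
  have hηle1 : η ≤ 1 := hηle.trans (min_le_right _ _)
  set s₀ := max 4 ((4 + K / η) * (3 / ε)) with hs₀
  have hs₀4 : 4 ≤ s₀ := le_max_left _ _
  refine ⟨s₀, by linarith, fun s hs => ?_⟩
  have hs4 : 4 ≤ s := by linarith
  have hs0 : 0 < s := by linarith
  set h₂ := min (1 / (2 * s ^ 2)) (ε / (72 * s ^ 2)) with hh₂
  refine ⟨min h₁ (min h₂ ((ε / (6 * s)) ^ 2)), by positivity, fun n h hh hhle hnh x hx hb => ?_⟩
  have hhle1 : h ≤ h₁ := hhle.trans (min_le_left _ _)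
  have hhle2 : h ≤ h₂ := hhle.trans ((min_le_right _ _).trans (min_le_left _ _))
  have hhle3 : h ≤ (ε / (6 * s)) ^ 2 := hhle.trans ((min_le_right _ _).trans (min_le_right _ _))
  have hr1 : s ^ 2 * h ≤ 1 / 2 := by
    have := hhle2.trans (min_le_left _ _)
    rw [le_div_iff₀ (by positivity)] at this; linarith
  have hr2 : 12 * (s ^ 2 * h) ≤ ε / 6 := by
    have := hhle2.trans (min_le_right _ _)
    rw [le_div_iff₀ (by positivity)] at this; linarith
  have hr3 : √h * s ≤ ε / 6 := by
    have := Real.sqrt_le_sqrt hhle3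
    rw [Real.sqrt_sq (by positivity), le_div_iff₀ (by positivity)] at this; linarith
  obtain ⟨j, hj⟩ := H n h hh hhle1 hnh x hx hb
  have e1 := hj (s ^ 2 * h) η (by gcongr; nlinarith) hη hηle1
  have e2 := edgeH_im_sub_close (r := s ^ 2 * h) (by positivity) hr1 hη hηle1
  have e3 := Hη η hη (hηle.trans (min_le_left _ _))
  have e4 := edgeAngle_mem (r := s ^ 2 * h) (by positivity) hη (x j)
  have hsum := Finset.sum_erase_add Finset.univ (fun k => edgeAngle (s ^ 2 * h) η (x k))
    (Finset.mem_univ j)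
  have hnq : (n : ℝ) * √h ^ 3 = 1 := by
    rw [← pow_left_inj₀ (by positivity) (by norm_num) two_ne_zero, mul_pow, ← pow_mul, mul_comm 3 2,
      pow_mul, Real.sq_sqrt hh.le, hnh, one_pow]
  have hroot : √(s ^ 2 * h) = s * √h := by
    rw [Real.sqrt_mul (by positivity), Real.sqrt_sq hs0.le]
  rw [hroot] at e2
  set D := (edgeH (Complex.sqrt ((-(s ^ 2 * h) : ℝ) + (η * (s ^ 2 * h) : ℝ) * Complex.I))).im -
        (edgeH (Complex.sqrt ((s ^ 2 * h : ℝ) + (η * (s ^ 2 * h) : ℝ) * Complex.I))).im with hD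
  have e2' : |n * D - 2 / 3 * s ^ 3 * edgeFlux η| ≤ 12 * (s ^ 2 * h) * s ^ 3 := by
    have : n * D - 2 / 3 * s ^ 3 * edgeFlux η = n * (D - 2 / 3 * (s * √h) ^ 3 * edgeFlux η) := by
      linear_combination (2 / 3 * s ^ 3 * edgeFlux η) * hnq
    rw [this, abs_mul, abs_of_nonneg (by positivity : (0 : ℝ) ≤ n)]
    calc n * |D - 2 / 3 * (s * √h) ^ 3 * edgeFlux η| ≤ n * (12 * (s ^ 2 * h) * (s * √h) ^ 3) := by
          gcongr
      _ = _ := by linear_combination (12 * (s ^ 2 * h) * s ^ 3) * hnq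
  have e5 : (n : ℝ) * η * (s ^ 2 * h) ^ 2 = η * s ^ 3 * (√h * s) := by
    have h2 : h ^ 2 = √h ^ 3 * √h := by nth_rewrite 1 [← Real.sq_sqrt hh.le]; ring
    rw [mul_pow, h2]
    linear_combination (η * s ^ 4 * √h) * hnq
  have e6 : (n : ℝ) * η * (s ^ 2 * h) ^ 2 ≤ ε / 6 * s ^ 3 := by
    rw [e5]
    calc η * s ^ 3 * (√h * s) ≤ 1 * s ^ 3 * (ε / 6) := by gcongr
      _ = _ := by ring
  have e6' : 0 ≤ (n : ℝ) * η * (s ^ 2 * h) ^ 2 := by positivity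
  have e7 : K * (s ^ 2 * h / (η * h)) + 4 ≤ ε / 3 * s ^ 3 := by
    have h1 : (4 + K / η) * (3 / ε) ≤ s := (le_max_right _ _).trans hs
    have h2 : 4 + K / η ≤ ε / 3 * s := by
      rw [mul_div_assoc', div_le_iff₀ hε] at h1; linarith
    have h3 : K * (s ^ 2 * h / (η * h)) = K / η * s ^ 2 := by field_simp
    rw [h3]
    have h4 : 0 < K / η := by positivity
    nlinarith
  have e8 : |2 / 3 * s ^ 3 * edgeFlux η - 2 / 3 * s ^ 3| ≤ ε / 3 * s ^ 3 := by
    rw [show 2 / 3 * s ^ 3 * edgeFlux η - 2 / 3 * s ^ 3 = 2 / 3 * s ^ 3 * (edgeFlux η - 1) by ring,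
      abs_mul, abs_of_pos (by positivity : 0 < 2 / 3 * s ^ 3)]
    calc 2 / 3 * s ^ 3 * |edgeFlux η - 1| ≤ 2 / 3 * s ^ 3 * (ε / 2) := by gcongr
      _ = _ := by ring
  have e9 : 12 * (s ^ 2 * h) * s ^ 3 ≤ ε / 6 * s ^ 3 := by gcongr
  have hpi := Real.pi_le_four
  rw [← hsum]
  rw [abs_le] at e1 e2' e8 ⊢
  constructor <;> linarith [e1.1, e1.2, e2'.1, e2'.2, e8.1, e8.2, e4.1, e4.2]

/-- The number of points within distance less than `r` of the edge `2`. -/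
noncomputable def edgeCount (n : ℕ) (x : Fin n → ℝ) (r : ℝ) : ℕ :=
  (Finset.univ.filter fun k => |x k - 2| < r).card

theorem edgeCount_upper {n : ℕ} {x : Fin n → ℝ} {r R η : ℝ} (hr : 0 < r) (hrR : r < R)
    (hη : 0 < η) : edgeCount n x r * (Real.pi - 2 * η * R / (R - r)) ≤
      ∑ k, edgeAngle R η (x k) := by
  have hR : 0 < R := hr.trans hrR
  have h1 : ∑ k ∈ Finset.univ.filter (fun k => |x k - 2| < r), edgeAngle R η (x k) ≤
      ∑ k, edgeAngle R η (x k) :=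
    Finset.sum_le_sum_of_subset_of_nonneg (Finset.filter_subset _ _)
      fun k _ _ => (edgeAngle_mem hR hη (x k)).1
  refine le_trans ?_ h1
  rw [edgeCount, ← nsmul_eq_mul]
  refine Finset.card_nsmul_le_sum _ _ _ fun k hk => ?_
  have hk' : |x k - 2| < r := (Finset.mem_filter.mp hk).2
  refine le_trans ?_ (le_edgeAngle hR hη (hk'.trans hrR))
  have h2 : 0 < R - r := by linarith
  gcongr

theorem edgeCount_lower {n : ℕ} {x : Fin n → ℝ} (hx : Function.Injective x) {C h : ℝ}
    (hC : 1 ≤ C) (hh : 0 < h) (hnh : (n : ℝ) ^ 2 * h ^ 3 = 1) (hb : LagrangeBounded n x C)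
    {s κ η : ℝ} (hs : 1 ≤ s) (hκ : 0 < κ) (hκ1 : κ ≤ 1 / 2) (hη : 0 < η) :
    ∑ k, edgeAngle ((s * (1 - κ)) ^ 2 * h) η (x k) ≤
      Real.pi * edgeCount n x (s ^ 2 * h) + 64 * η / κ * (countConst C * s ^ 3) := by
  set r := s ^ 2 * h with hr
  have hr0 : 0 < r := by positivity
  have hκ' : 0 < 1 - κ := by linarith
  set r' := (s * (1 - κ)) ^ 2 * h with hr'
  have hr'r : r' = (1 - κ) ^ 2 * r := by rw [hr', hr]; ring
  have hr'0 : 0 < r' := by positivity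
  have hr'le : r' ≤ (1 - κ) * r := by
    rw [hr'r]; gcongr; nlinarith
  set f : Fin n → ℝ := fun k => if |x k - 2| < r then 0 else (r / |x k - 2|) ^ 2 with hf
  have hf1 : ∑ k, f k ≤ 32 * (countConst C * s ^ 3) := by
    refine sum_le_of_card_le (d := fun k => |x k - 2| / r) ?_ ?_ ?_
    · intro u hu
      have := card_near_edge_le hx hC hh hnh hb (u := u * s) (by nlinarith)
      calc _ = ((Finset.univ.filter fun k => |x k - 2| ≤ (u * s) ^ 2 * h).card : ℝ) := by
            congr 3
            ext k
            rw [div_le_iff₀ hr0, hr, mul_pow, mul_assoc]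
        _ ≤ _ := by
          refine this.trans (le_of_eq ?_); ring
    · intro k
      simp only [hf]
      split_ifs with h1
      · norm_num
      · push Not at h1
        have : r / |x k - 2| ≤ 1 := div_le_one_of_le₀ h1 (abs_nonneg _)
        exact pow_le_one₀ (by positivity) this
    · intro k hk
      simp only [hf]
      split_ifs with h1
      · positivity
      · rw [one_div_div]
  have key : ∀ k, edgeAngle r' η (x k) ≤
      (if |x k - 2| < r then Real.pi else 0) + 2 * η / κ * f k := by
    intro k
    simp only [hf]
    split_ifs with h1
    · rw [mul_zero, add_zero]; exact (edgeAngle_mem hr'0 hη (x k)).2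
    · push Not at h1
      have hd : 0 < |x k - 2| := hr0.trans_le h1
      have h2 : r' ≤ (1 - κ) * |x k - 2| := hr'le.trans (by gcongr)
      have h3 : κ * |x k - 2| ^ 2 ≤ |x k - 2| ^ 2 - r' ^ 2 := by
        have : r' ^ 2 ≤ ((1 - κ) * |x k - 2|) ^ 2 := by gcongr
        have : ((1 - κ) * |x k - 2|) ^ 2 ≤ (1 - κ) * |x k - 2| ^ 2 := by
          rw [mul_pow]; gcongr; nlinarith
        linarith
      have h4 : r' < |x k - 2| := by nlinarith
      rw [zero_add]
      refine (edgeAngle_le hr'0 hη h4).trans ?_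
      have h5 : r' ≤ r := by nlinarith
      calc 2 * η * r' ^ 2 / (|x k - 2| ^ 2 - r' ^ 2) ≤ 2 * η * r ^ 2 / (κ * |x k - 2| ^ 2) := by
            gcongr
        _ = _ := by field_simp
  calc ∑ k, edgeAngle r' η (x k) ≤
        ∑ k, ((if |x k - 2| < r then Real.pi else 0) + 2 * η / κ * f k) :=
        Finset.sum_le_sum fun k _ => key k
    _ = Real.pi * edgeCount n x r + 2 * η / κ * ∑ k, f k := by
        rw [Finset.sum_add_distrib, ← Finset.mul_sum, ← Finset.sum_filter, Finset.sum_const,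
          nsmul_eq_mul, edgeCount, mul_comm]
    _ ≤ Real.pi * edgeCount n x r + 2 * η / κ * (32 * (countConst C * s ^ 3)) := by gcongr
    _ = _ := by ring

theorem sandwich_upper {κ : ℝ} (hκ0 : 0 ≤ κ) (hκ1 : κ ≤ 1 / 2) :
    (2 / 3 + κ) * (1 + κ) ^ 3 ≤ 2 / 3 + 13 * κ := by
  have h2 : κ ^ 2 ≤ κ / 2 := by nlinarith
  have h1 : (1 + κ) ^ 3 ≤ 1 + 5 * κ := by nlinarith
  calc (2 / 3 + κ) * (1 + κ) ^ 3 ≤ (2 / 3 + κ) * (1 + 5 * κ) := by gcongr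
    _ ≤ _ := by nlinarith

theorem sandwich_lower {κ : ℝ} (hκ0 : 0 ≤ κ) (hκ1 : κ ≤ 1 / 2) :
    2 / 3 - 13 * κ ≤ (2 / 3 - κ) * (1 - κ) ^ 3 := by
  have h1 : 1 - 3 * κ ≤ (1 - κ) ^ 3 := by nlinarith [sq_nonneg κ]
  calc 2 / 3 - 13 * κ ≤ (2 / 3 - κ) * (1 - 3 * κ) := by nlinarith
    _ ≤ _ := by gcongr; linarith

theorem exists_edgeCount_close {C : ℝ} (hC : 1 ≤ C) {ε : ℝ} (hε : 0 < ε) :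
    ∃ s₀ : ℝ, 0 < s₀ ∧ ∀ s : ℝ, s₀ ≤ s → ∃ h₀ : ℝ, 0 < h₀ ∧ ∀ (n : ℕ) (h : ℝ), 0 < h → h ≤ h₀ →
    (n : ℝ) ^ 2 * h ^ 3 = 1 → ∀ x : Fin n → ℝ, Function.Injective x → LagrangeBounded n x C →
    |Real.pi * edgeCount n x (s ^ 2 * h) - 2 / 3 * s ^ 3| ≤ ε * s ^ 3 := by
  set κ := min (ε / 26) (1 / 2) with hκ
  have hκ0 : 0 < κ := by positivity
  have hκε : κ ≤ ε / 26 := min_le_left _ _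
  have hκ1 : κ ≤ 1 / 2 := min_le_right _ _
  have hcc := countConst_pos hC
  obtain ⟨η₀, hη₀, H⟩ := exists_edgeAngle_total_close hC hκ0
  set η := min η₀ (κ * ε / (128 * countConst C)) with hη
  have hη0 : 0 < η := by positivity
  have hηle : 64 * η / κ * countConst C ≤ ε / 2 := by
    have : η ≤ κ * ε / (128 * countConst C) := min_le_right _ _
    rw [le_div_iff₀ (by positivity)] at this
    rw [div_mul_eq_mul_div, div_le_iff₀ hκ0]; linarith
  obtain ⟨s₁, hs₁, H'⟩ := H η hη0 (min_le_left _ _)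
  refine ⟨max 1 (2 * s₁), by positivity, fun s hs => ?_⟩
  have hs1 : 1 ≤ s := (le_max_left _ _).trans hs
  have hss : 2 * s₁ ≤ s := (le_max_right _ _).trans hs
  have hs0 : 0 < s := by linarith
  obtain ⟨h₁, hh₁, Hl⟩ := H' (s * (1 - κ)) (by nlinarith)
  obtain ⟨h₂, hh₂, Hu⟩ := H' (s * (1 + κ)) (by nlinarith)
  refine ⟨min h₁ h₂, by positivity, fun n h hh hhle hnh x hx hb => ?_⟩
  have hl := Hl n h hh (hhle.trans (min_le_left _ _)) hnh x hx hb
  have hu := Hu n h hh (hhle.trans (min_le_right _ _)) hnh x hx hb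
  have e1 := edgeCount_lower hx hC hh hnh hb hs1 hκ0 hκ1 hη0
  have hr0 : 0 < s ^ 2 * h := by positivity
  have hRr : (s * (1 + κ)) ^ 2 * h - s ^ 2 * h = (2 * κ + κ ^ 2) * (s ^ 2 * h) := by ring
  have e2 := edgeCount_upper (x := x) (r := s ^ 2 * h) (R := (s * (1 + κ)) ^ 2 * h) hr0
    (by rw [← sub_pos, hRr]; positivity) hη0
  have e3 : (edgeCount n x (s ^ 2 * h) : ℝ) ≤ countConst C * s ^ 3 := by
    refine le_trans ?_ (card_near_edge_le hx hC hh hnh hb hs1)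
    rw [edgeCount]
    norm_cast
    exact Finset.card_le_card (Finset.monotone_filter_right _ fun k _ hk => le_of_lt hk)
  set N : ℝ := (edgeCount n x (s ^ 2 * h) : ℝ) with hN
  have hN0 : 0 ≤ N := by positivity
  have e4 : 2 * η * ((s * (1 + κ)) ^ 2 * h) / ((s * (1 + κ)) ^ 2 * h - s ^ 2 * h) ≤ 64 * η / κ := by
    rw [hRr, div_le_div_iff₀ (by positivity) hκ0]
    have : (1 + κ) ^ 2 * κ ≤ 32 * (2 * κ + κ ^ 2) := by nlinarith
    calc 2 * η * ((s * (1 + κ)) ^ 2 * h) * κ = 2 * (η * (s ^ 2 * h)) * ((1 + κ) ^ 2 * κ) := by ring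
      _ ≤ 2 * (η * (s ^ 2 * h)) * (32 * (2 * κ + κ ^ 2)) := by gcongr
      _ = _ := by ring
  have e5 : 64 * η / κ * (countConst C * s ^ 3) ≤ ε / 2 * s ^ 3 := by
    rw [← mul_assoc]; gcongr
  have e6 : N * Real.pi ≤ (2 / 3 + κ) * (s * (1 + κ)) ^ 3 + ε / 2 * s ^ 3 := by
    have : N * (64 * η / κ) ≤ ε / 2 * s ^ 3 := by
      refine le_trans ?_ e5
      rw [mul_comm]; gcongr
    have : N * (2 * η * ((s * (1 + κ)) ^ 2 * h) / ((s * (1 + κ)) ^ 2 * h - s ^ 2 * h)) ≤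
      N * (64 * η / κ) := by gcongr
    have := (abs_le.mp hu).2
    rw [mul_sub] at e2
    linarith
  have hs3 : 0 < s ^ 3 := by positivity
  have e7 : (2 / 3 + κ) * (s * (1 + κ)) ^ 3 ≤ (2 / 3 + 13 * κ) * s ^ 3 := by
    have := sandwich_upper hκ0.le hκ1
    calc (2 / 3 + κ) * (s * (1 + κ)) ^ 3 = ((2 / 3 + κ) * (1 + κ) ^ 3) * s ^ 3 := by ring
      _ ≤ _ := by gcongr
  have e8 : (2 / 3 - 13 * κ) * s ^ 3 ≤ (2 / 3 - κ) * (s * (1 - κ)) ^ 3 := by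
    have := sandwich_lower hκ0.le hκ1
    calc (2 / 3 - 13 * κ) * s ^ 3 ≤ ((2 / 3 - κ) * (1 - κ) ^ 3) * s ^ 3 := by gcongr
      _ = _ := by ring
  have e9 : 13 * κ * s ^ 3 ≤ ε / 2 * s ^ 3 := by gcongr; linarith
  have e10 := (abs_le.mp hl).1
  rw [abs_le]
  constructor <;> linarith

theorem exists_joukowsky (z : ℂ) : ∃ ω : ℂ, ω ≠ 0 ∧ ‖ω‖ ≤ 1 ∧ ω + ω⁻¹ = z := by
  set s := Complex.sqrt (z ^ 2 - 4) with hs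
  have hs2 : s ^ 2 = z ^ 2 - 4 := complex_sqrt_sq _
  have hprod : ((z - s) / 2) * ((z + s) / 2) = 1 := by linear_combination -hs2 / 4
  have h1 : (z - s) / 2 ≠ 0 := left_ne_zero_of_mul_eq_one hprod
  have h2 : (z + s) / 2 ≠ 0 := right_ne_zero_of_mul_eq_one hprod
  rcases le_total ‖(z - s) / 2‖ 1 with h | h
  · refine ⟨(z - s) / 2, h1, h, ?_⟩
    rw [← eq_inv_of_mul_eq_one_right hprod]; ring
  · refine ⟨(z + s) / 2, h2, ?_, ?_⟩
    · have := congrArg norm hprod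
      rw [norm_mul, norm_one] at this
      nlinarith [norm_nonneg ((z + s) / 2)]
    · rw [← eq_inv_of_mul_eq_one_left hprod]; ring

theorem joukowsky_norm_add {ω : ℂ} (hω : ω ≠ 0) :
    ‖ω + ω⁻¹ - 2‖ + ‖ω + ω⁻¹ + 2‖ = 2 * (‖ω‖ + ‖ω‖⁻¹) := by
  have e1 : ω + ω⁻¹ - 2 = (1 - ω) ^ 2 / ω := by field_simp; ring
  have e2 : ω + ω⁻¹ + 2 = (1 + ω) ^ 2 / ω := by field_simp; ring
  have hn : 0 < ‖ω‖ := norm_pos_iff.mpr hω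
  rw [e1, e2, norm_div, norm_div, norm_pow, norm_pow, ← add_div, div_eq_iff hn.ne']
  have := parallelogram_law_with_norm ℝ (1 : ℂ) ω
  rw [norm_one] at this
  have e3 : 2 * (‖ω‖ + ‖ω‖⁻¹) * ‖ω‖ = 2 * (1 * 1 + ‖ω‖ * ‖ω‖) := by field_simp; ring
  rw [e3]; linarith

theorem norm_weightedLagrange_near_le {n : ℕ} (hn : 1 ≤ n) {x : Fin n → ℝ} {j : Fin n} {M : ℝ}
    (hM : ∀ t ∈ Set.Icc (-2 : ℝ) 2, ‖weightedLagrange n x j t‖ ≤ M) {t₀ : ℝ}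
    (ht₀ : t₀ ∈ Set.Icc (-2 : ℝ) 2) {z : ℂ} (hz : ‖z - t₀‖ ≤ 1 / (n : ℝ) ^ 2) :
    ‖weightedLagrange n x j z‖ ≤ M * Real.exp 6 := by
  obtain ⟨ω, hω0, hω1, rfl⟩ := exists_joukowsky z
  have hn0 : (0 : ℝ) < n := by exact_mod_cast hn
  have hn1 : (1 : ℝ) ≤ n := by exact_mod_cast hn
  have hM0 : 0 ≤ M := (norm_nonneg _).trans (hM t₀ ht₀)
  have hsum := joukowsky_norm_add hω0
  have hρ : 0 < ‖ω‖ := norm_pos_iff.mpr hω0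
  set v := ‖ω‖⁻¹ with hv
  have hv1 : 1 ≤ v := (one_le_inv₀ hρ).mpr hω1
  have hρv : ‖ω‖ * v = 1 := mul_inv_cancel₀ hρ.ne'
  set δ := 1 / (n : ℝ) ^ 2 with hδ
  have hδ0 : 0 < δ := by positivity
  have hδ1 : δ ≤ 1 := div_le_one_of_le₀ (one_le_pow₀ hn1) (by positivity)
  have h1 : ‖ω + ω⁻¹ - 2‖ ≤ (2 - t₀) + δ := by
    have e : ω + ω⁻¹ - 2 = (ω + ω⁻¹ - t₀) + ((t₀ - 2 : ℝ) : ℂ) := by push_cast; ring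
    rw [e]
    refine (norm_add_le _ _).trans ?_
    rw [Complex.norm_real, Real.norm_eq_abs, abs_of_nonpos (by linarith [ht₀.2])]
    linarith
  have h2 : ‖ω + ω⁻¹ + 2‖ ≤ (2 + t₀) + δ := by
    have e : ω + ω⁻¹ + 2 = (ω + ω⁻¹ - t₀) + ((t₀ + 2 : ℝ) : ℂ) := by push_cast; ring
    rw [e]
    refine (norm_add_le _ _).trans ?_
    rw [Complex.norm_real, Real.norm_eq_abs, abs_of_nonneg (by linarith [ht₀.1])]
    linarith
  have h3 : ‖ω‖ + v ≤ 2 + δ := by linarith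
  have h4 : (v - 1) ^ 2 ≤ δ * v := by nlinarith
  have h5 : v ≤ 3 := by nlinarith
  have h6 : v - 1 ≤ 2 / n := by
    refine le_of_sq_le_sq ?_ (by positivity)
    calc (v - 1) ^ 2 ≤ δ * v := h4
      _ ≤ δ * 4 := by gcongr; linarith
      _ = (2 / n) ^ 2 := by rw [hδ]; ring
  have h7 : v - ‖ω‖ ≤ 2 * (2 / n) := by
    have : 1 - ‖ω‖ ≤ v - 1 := by nlinarith
    linarith
  have hv2 : (n : ℝ) * ((ω ^ 2).re - ((ω⁻¹) ^ 2).re) / 4 ≤ 4 := by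
    have e1 : (ω⁻¹) ^ 2 = ((v ^ 4 : ℝ) : ℂ) * (starRingEnd ℂ) (ω ^ 2) := by
      rw [Complex.inv_def, Complex.normSq_eq_norm_sq, hv, map_pow]
      push_cast
      ring
    have e2 : ((ω⁻¹) ^ 2).re = v ^ 4 * (ω ^ 2).re := by
      rw [e1, Complex.re_ofReal_mul, Complex.conj_re]
    have e3 : |(ω ^ 2).re| ≤ ‖ω‖ ^ 2 := by
      rw [← norm_pow]; exact Complex.abs_re_le_norm _
    have hv4 : 1 ≤ v ^ 4 := one_le_pow₀ hv1
    have e4 : (ω ^ 2).re - ((ω⁻¹) ^ 2).re ≤ 4 * (4 / n) := by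
      rw [e2]
      calc (ω ^ 2).re - v ^ 4 * (ω ^ 2).re = -(ω ^ 2).re * (v ^ 4 - 1) := by ring
        _ ≤ ‖ω‖ ^ 2 * (v ^ 4 - 1) := by
          have : -(ω ^ 2).re ≤ ‖ω‖ ^ 2 := (neg_le_abs _).trans e3
          have h : 0 ≤ v ^ 4 - 1 := by linarith
          gcongr
        _ = (v - ‖ω‖) * (v + ‖ω‖) := by
          linear_combination ((‖ω‖ * v + 1) * v ^ 2) * hρv
        _ ≤ (2 * (2 / n)) * 4 := by
          have : 0 ≤ v + ‖ω‖ := by positivity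
          gcongr
          linarith
        _ = _ := by ring
    have : (n : ℝ) * (4 * (4 / n)) = 16 := by field_simp; norm_num
    have : (n : ℝ) * ((ω ^ 2).re - ((ω⁻¹) ^ 2).re) ≤ n * (4 * (4 / n)) := by gcongr
    linarith
  have hvn : v ^ n ≤ Real.exp 2 := by
    have : v ≤ Real.exp (2 / n) := by
      have := Real.add_one_le_exp (2 / (n : ℝ)); linarith
    calc v ^ n ≤ Real.exp (2 / n) ^ n := by gcongr
      _ = Real.exp 2 := by rw [← Real.exp_nat_mul]; congr 1; field_simp
  have key := bernstein_walsh_weighted (natDegree_lagrangePoly_le n x j)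
    (weightedLagrange_bound_aux hM) hω0 hω1
  rw [weightedLagrange_eq, norm_mul, Complex.norm_real,
    Real.norm_eq_abs, abs_of_pos (Real.exp_pos _)]
  calc _ ≤ (M * Real.exp (-(n * x j ^ 2 / 4)) * v ^ n *
        Real.exp (n * ((ω ^ 2).re - ((ω⁻¹) ^ 2).re) / 4)) * Real.exp (n * x j ^ 2 / 4) := by gcongr
    _ ≤ (M * Real.exp (-(n * x j ^ 2 / 4)) * Real.exp 2 *
        Real.exp 4) * Real.exp (n * x j ^ 2 / 4) := by gcongr
    _ = M * Real.exp 6 := by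
      rw [Real.exp_neg, show (6 : ℝ) = 2 + 4 by norm_num, Real.exp_add]; field_simp

theorem half_le_norm_weightedLagrange {n : ℕ} (hn : 1 ≤ n) {x : Fin n → ℝ} {j : Fin n} {M : ℝ}
    (hM0 : 0 < M)
    (hM : ∀ t ∈ Set.Icc (-2 : ℝ) 2, ‖weightedLagrange n x j t‖ ≤ M) {t₀ : ℝ}
    (ht₀ : t₀ ∈ Set.Icc (-2 : ℝ) 2) (hMt₀ : ‖weightedLagrange n x j t₀‖ = M) {t : ℝ}
    (ht : |t - t₀| ≤ 1 / (6 * Real.exp 6 * (n : ℝ) ^ 2)) :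
    M / 2 ≤ ‖weightedLagrange n x j t‖ := by
  have hn0 : (0 : ℝ) < n := by exact_mod_cast hn
  have he : 1 ≤ Real.exp 6 := Real.one_le_exp (by norm_num)
  have hlt : 1 / (6 * Real.exp 6 * (n : ℝ) ^ 2) < 1 / (n : ℝ) ^ 2 := by
    apply one_div_lt_one_div_of_lt (by positivity)
    have : 0 < (n : ℝ) ^ 2 := by positivity
    nlinarith
  have hd : Differentiable ℂ (weightedLagrange n x j) := by
    unfold weightedLagrange; fun_prop
  have htt : dist (t : ℂ) t₀ = |t - t₀| := by
    rw [dist_eq_norm, ← Complex.ofReal_sub, Complex.norm_real, Real.norm_eq_abs]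
  have key := Complex.dist_le_div_mul_dist_of_mapsTo_ball (f := weightedLagrange n x j)
    (c := (t₀ : ℂ)) (R₁ := 1 / (n : ℝ) ^ 2) (R₂ := 3 * M * Real.exp 6) (z := (t : ℂ))
    hd.differentiableOn (fun z hz => by
      have hz' := norm_weightedLagrange_near_le hn hM ht₀ (z := z)
        (by rw [← dist_eq_norm]; exact (Metric.mem_ball.mp hz).le)
      have := norm_sub_le (weightedLagrange n x j z) (weightedLagrange n x j t₀)
      rw [Metric.mem_closedBall, dist_eq_norm]
      nlinarith) (by rw [Metric.mem_ball, htt]; linarith)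
  rw [htt, dist_eq_norm] at key
  have h1 : 3 * M * Real.exp 6 / (1 / (n : ℝ) ^ 2) * |t - t₀| ≤ M / 2 := by
    calc _ ≤ 3 * M * Real.exp 6 / (1 / (n : ℝ) ^ 2) * (1 / (6 * Real.exp 6 * (n : ℝ) ^ 2)) := by
          gcongr
      _ = M / 2 := by field_simp; norm_num
  have h2 := norm_sub_norm_le (weightedLagrange n x j t₀) (weightedLagrange n x j t)
  rw [norm_sub_rev] at h2
  linarith

theorem norm_weightedLagrange_le_of_lintegral {n : ℕ} (hn : 2 ≤ n) {β c₀ : ℝ} (hβ : 1 ≤ β)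
    (hc₀ : 0 < c₀) (hβn : c₀ * Real.log n ≤ β) {x : Fin n → ℝ} {j : Fin n}
    (hI : ∫⁻ t : ℝ, ENNReal.ofReal (‖weightedLagrange n x j t‖ ^ β) ≤
      ENNReal.ofReal ((n : ℝ) ^ 3 * (1 + x j ^ 2))) {t : ℝ} (ht : t ∈ Set.Icc (-2 : ℝ) 2) :
    ‖weightedLagrange n x j t‖ ≤ 6 * Real.exp 6 * Real.exp (5 / c₀) * (1 + x j ^ 2) := by
  have hn0 : (0 : ℝ) < n := by exact_mod_cast (by omega : 0 < n)
  have hn1 : (1 : ℝ) ≤ n := by exact_mod_cast (by omega : 1 ≤ n)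
  have he6 : 1 ≤ Real.exp 6 := Real.one_le_exp (by norm_num)
  have he5 : 1 ≤ Real.exp (5 / c₀) := Real.one_le_exp (by positivity)
  have hcont : Continuous fun t : ℝ => ‖weightedLagrange n x j t‖ := by
    unfold weightedLagrange; fun_prop
  obtain ⟨t₀, ht₀, hmax⟩ := (isCompact_Icc (a := (-2 : ℝ)) (b := 2)).exists_isMaxOn
    ⟨0, by norm_num, by norm_num⟩ hcont.continuousOn
  have hM : ∀ t ∈ Set.Icc (-2 : ℝ) 2, ‖weightedLagrange n x j t‖ ≤ ‖weightedLagrange n x j t₀‖ :=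
    fun t ht => hmax ht
  refine (hM t ht).trans ?_
  obtain ⟨M, hMdef⟩ : ∃ M, ‖weightedLagrange n x j t₀‖ = M := ⟨_, rfl⟩
  rw [hMdef] at hM ⊢
  have hx1 : 1 ≤ 1 + x j ^ 2 := by nlinarith [sq_nonneg (x j)]
  rcases le_or_gt M 2 with hM2 | hM2
  · calc M ≤ 2 * 1 * 1 * 1 := by linarith
      _ ≤ _ := by gcongr; linarith
  have hM0 : 0 < M := by linarith
  set d := 1 / (6 * Real.exp 6 * (n : ℝ) ^ 2) with hd
  have hd0 : 0 < d := by positivity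
  have h1 : ENNReal.ofReal ((M / 2) ^ β * (2 * d)) ≤ ENNReal.ofReal ((n : ℝ) ^ 3 * (1 + x j ^ 2)) := by
    refine le_trans ?_ hI
    calc ENNReal.ofReal ((M / 2) ^ β * (2 * d))
        = ENNReal.ofReal ((M / 2) ^ β) * volume (Set.Icc (t₀ - d) (t₀ + d)) := by
          rw [Real.volume_Icc, ← ENNReal.ofReal_mul (by positivity)]
          congr 2; ring
      _ = ∫⁻ _ in Set.Icc (t₀ - d) (t₀ + d), ENNReal.ofReal ((M / 2) ^ β) := by
          rw [setLIntegral_const]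
      _ ≤ ∫⁻ t in Set.Icc (t₀ - d) (t₀ + d), ENNReal.ofReal (‖weightedLagrange n x j t‖ ^ β) := by
          refine setLIntegral_mono' measurableSet_Icc fun t ht => ?_
          apply ENNReal.ofReal_le_ofReal
          refine Real.rpow_le_rpow (by positivity) ?_ (by linarith)
          refine half_le_norm_weightedLagrange (by omega) hM0 hM ht₀ hMdef ?_
          rw [abs_le]; constructor <;> linarith [ht.1, ht.2]
      _ ≤ _ := setLIntegral_le_lintegral _ _
  rw [ENNReal.ofReal_le_ofReal_iff (by positivity)] at h1
  have h2 : (M / 2) ^ β ≤ 3 * Real.exp 6 * (n : ℝ) ^ 5 * (1 + x j ^ 2) := by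
    have e : (M / 2) ^ β = ((M / 2) ^ β * (2 * d)) * (3 * Real.exp 6 * (n : ℝ) ^ 2) := by
      rw [hd]; field_simp; ring
    rw [e]
    calc _ ≤ ((n : ℝ) ^ 3 * (1 + x j ^ 2)) * (3 * Real.exp 6 * (n : ℝ) ^ 2) := by gcongr
      _ = _ := by ring
  have h3 := Real.log_le_log (by positivity) h2
  rw [Real.log_rpow (by positivity), Real.log_mul (by positivity) (by positivity),
    Real.log_mul (by positivity) (by positivity), Real.log_pow] at h3
  have h4 : Real.log (M / 2) ≤ Real.log (3 * Real.exp 6) + 5 / c₀ + Real.log (1 + x j ^ 2) := by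
    have l1 : 0 ≤ Real.log (3 * Real.exp 6) := Real.log_nonneg (by linarith)
    have l2 : 0 ≤ Real.log (1 + x j ^ 2) := Real.log_nonneg hx1
    have l3 : 5 * Real.log n ≤ β * (5 / c₀) := by
      rw [mul_div_assoc', le_div_iff₀ hc₀]; linarith
    have l4 : Real.log (3 * Real.exp 6) ≤ β * Real.log (3 * Real.exp 6) :=
      le_mul_of_one_le_left l1 hβ
    have l5 : Real.log (1 + x j ^ 2) ≤ β * Real.log (1 + x j ^ 2) := le_mul_of_one_le_left l2 hβ
    refine le_of_mul_le_mul_left ?_ (by linarith : 0 < β)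
    push_cast at h3
    linarith
  have h5 : M / 2 ≤ 3 * Real.exp 6 * Real.exp (5 / c₀) * (1 + x j ^ 2) := by
    rw [← Real.log_le_log_iff (by positivity) (by positivity), Real.log_mul (by positivity)
      (by positivity), Real.log_mul (by positivity) (by positivity), Real.log_exp]
    exact h4
  linarith

theorem lt_three_of_norm_weightedLagrange_le {n : ℕ} {x : Fin n → ℝ} (hx : Function.Injective x)
    {D : ℝ} (hD : 0 < D) (hn : 45 * D < (n : ℝ) ^ 2) {j : Fin n}
    (hb : ∀ t ∈ Set.Icc (-2 : ℝ) 2, ‖weightedLagrange n x j t‖ ≤ D * (1 + x j ^ 2)) : x j < 3 := by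
  by_contra! h3
  set σ := √(x j - 2) with hσ
  have hσ2 : σ ^ 2 = x j - 2 := Real.sq_sqrt (by linarith)
  have hσ1 : 1 ≤ σ := Real.one_le_sqrt.mpr (by linarith)
  have key := norm_weightedLagrange_le_edge hb (σ := (σ : ℂ)) (by simp; linarith)
    (slit_of_nonneg σ)
  have e : (2 : ℂ) + (σ : ℂ) ^ 2 = (x j : ℂ) := by
    rw [← Complex.ofReal_pow, hσ2]; push_cast; ring
  rw [e, weightedLagrange_self hx, norm_one] at key
  have h1 : (n : ℝ) * (edgeH σ).re ≤ -(n * (2 / 3 * σ ^ 3)) := by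
    have := edgeH_ofReal_re_le (x := σ) (by linarith)
    have : (n : ℝ) * (edgeH σ).re ≤ n * (-(2 / 3) * σ ^ 3) := by gcongr
    linarith
  have h2 : 1 + x j ^ 2 ≤ 10 * σ ^ 4 := by
    have : x j = 2 + σ ^ 2 := by linarith
    rw [this]
    have h4 : 1 ≤ σ ^ 2 := one_le_pow₀ hσ1
    nlinarith
  set y := (n : ℝ) * (2 / 3 * σ ^ 3) with hy
  have hy0 : 0 ≤ y := by positivity
  have h3 : 1 ≤ D * (10 * σ ^ 4) * Real.exp (-y) := by
    refine key.trans ?_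
    gcongr
  rw [Real.exp_neg, ← div_eq_mul_inv, le_div_iff₀ (Real.exp_pos _), one_mul] at h3
  have h4 : y ^ 2 / 2 ≤ Real.exp y := by
    have := Real.quadratic_le_exp_of_nonneg hy0
    linarith
  have h5 : (2 / 9 : ℝ) * (n : ℝ) ^ 2 * σ ^ 4 ≤ y ^ 2 / 2 := by
    rw [hy]
    calc (2 / 9 : ℝ) * (n : ℝ) ^ 2 * σ ^ 4 ≤ (2 / 9 : ℝ) * (n : ℝ) ^ 2 * σ ^ 6 := by
          gcongr
          norm_num
      _ = _ := by ring
  have h6 : 0 < σ ^ 4 := by positivity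
  have h7 := h5.trans (h4.trans h3)
  nlinarith

theorem lagrangeBounded_of_norm_le {n : ℕ} {x : Fin n → ℝ} (hx : Function.Injective x)
    {D : ℝ} (hD : 0 < D) (hn : 45 * D < (n : ℝ) ^ 2)
    (hb : ∀ j, ∀ t ∈ Set.Icc (-2 : ℝ) 2, ‖weightedLagrange n x j t‖ ≤ D * (1 + x j ^ 2)) :
    LagrangeBounded n x (10 * D) := by
  intro j t ht
  have h1 := lt_three_of_norm_weightedLagrange_le hx hD hn (hb j)
  have h2 := lt_three_of_norm_weightedLagrange_le (x := fun k => -x k) (j := j)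
    (fun a b hab => hx (neg_injective hab)) hD hn (by
      intro t ht
      rw [weightedLagrange_neg, ← Complex.ofReal_neg, neg_sq]
      exact hb j (-t) ⟨by linarith [ht.2], by linarith [ht.1]⟩)
  have h3 : 1 + x j ^ 2 ≤ 10 := by nlinarith
  calc _ ≤ D * (1 + x j ^ 2) := hb j t ht
    _ ≤ D * 10 := by gcongr
    _ = _ := by ring

theorem lagrangeBounded_of_lintegral_le {n : ℕ} (hn : 2 ≤ n) {β c₀ : ℝ} (hβ : 1 ≤ β)
    (hc₀ : 0 < c₀) (hβn : c₀ * Real.log n ≤ β) {x : Fin n → ℝ} (hx : Function.Injective x)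
    (hnD : 45 * (6 * Real.exp 6 * Real.exp (5 / c₀)) < (n : ℝ) ^ 2)
    (hI : ∀ j, ∫⁻ t : ℝ, ENNReal.ofReal (‖weightedLagrange n x j t‖ ^ β) ≤
      ENNReal.ofReal ((n : ℝ) ^ 3 * (1 + x j ^ 2))) :
    LagrangeBounded n x (10 * (6 * Real.exp 6 * Real.exp (5 / c₀))) :=
  lagrangeBounded_of_norm_le hx (by positivity) hnD fun j _ ht =>
    norm_weightedLagrange_le_of_lintegral hn hβ hc₀ hβn (hI j) ht

theorem prod_pairs_eq {n : ℕ} (f : Fin n → Fin n → ℝ) (hf : ∀ i k, f i k = f k i) (j : Fin n) :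
    ∏ p ∈ Finset.univ.filter (fun p : Fin n × Fin n => p.1 < p.2), f p.1 p.2 =
      (∏ k ∈ Finset.univ.erase j, f j k) *
        ∏ p ∈ (Finset.univ.filter (fun p : Fin n × Fin n => p.1 < p.2)).filter
          (fun p => ¬ (p.1 = j ∨ p.2 = j)), f p.1 p.2 := by
  rw [← Finset.prod_filter_mul_prod_filter_not _ (fun p : Fin n × Fin n => p.1 = j ∨ p.2 = j)]
  congr 1
  refine Finset.prod_bij' (fun p _ => if p.1 = j then p.2 else p.1)
    (fun k _ => if j < k then (j, k) else (k, j)) ?_ ?_ ?_ ?_ ?_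
  · rintro ⟨a, b⟩ h
    simp only [Finset.mem_filter, Finset.mem_univ, true_and, Finset.mem_erase, and_true] at h ⊢
    split_ifs <;> grind
  · intro k h
    simp only [Finset.mem_filter, Finset.mem_univ, true_and, Finset.mem_erase, and_true] at h ⊢
    split_ifs <;> grind
  · rintro ⟨a, b⟩ h
    simp only [Finset.mem_filter, Finset.mem_univ, true_and] at h ⊢
    split_ifs <;> grind
  · intro k h
    simp only [Finset.mem_erase, Finset.mem_univ, and_true] at h
    split_ifs <;> grind
  · rintro ⟨a, b⟩ h
    simp only [Finset.mem_filter, Finset.mem_univ, true_and] at h ⊢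
    split_ifs <;> grind

theorem gaussianDensity_nonneg (n : ℕ) (β : ℝ) (x : Fin n → ℝ) : 0 ≤ gaussianDensity n β x := by
  unfold gaussianDensity
  positivity

theorem gaussianDensity_eq_zero {n : ℕ} {β : ℝ} (hβ : 0 < β) {x : Fin n → ℝ}
    (hx : ¬ Function.Injective x) : gaussianDensity n β x = 0 := by
  simp only [Function.Injective] at hx
  push Not at hx
  obtain ⟨a, b, hab, hne⟩ := hx
  unfold gaussianDensity
  rw [mul_eq_zero]
  left
  rcases lt_or_gt_of_ne hne with h | h
  · exact Finset.prod_eq_zero (i := (a, b)) (by simpa using h)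
      (by simp [hab, Real.zero_rpow hβ.ne'])
  · exact Finset.prod_eq_zero (i := (b, a)) (by simpa using h)
      (by simp [hab, Real.zero_rpow hβ.ne'])

theorem measurable_gaussianDensity (n : ℕ) (β : ℝ) : Measurable (gaussianDensity n β) := by
  unfold gaussianDensity
  fun_prop

theorem gaussianDensity_mul_weightedLagrange_le {n : ℕ} {β : ℝ} (hβ : 0 < β) (x : Fin n → ℝ)
    (j : Fin n) (t : ℝ) :
    gaussianDensity n β x * ‖weightedLagrange n x j t‖ ^ β ≤
      gaussianDensity n β (Function.update x j t) := by
  by_cases hx : Function.Injective x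
  swap
  · rw [gaussianDensity_eq_zero hβ hx, zero_mul]
    exact gaussianDensity_nonneg ..
  apply le_of_eq
  rw [norm_weightedLagrange_ofReal]
  unfold gaussianDensity
  rw [prod_pairs_eq (fun a b => |x a - x b| ^ β) (fun a b => by rw [abs_sub_comm]) j,
    prod_pairs_eq (fun a b => |Function.update x j t a - Function.update x j t b| ^ β)
      (fun a b => by rw [abs_sub_comm]) j]
  have h1 : ∏ p ∈ (Finset.univ.filter (fun p : Fin n × Fin n => p.1 < p.2)).filter
        (fun p => ¬ (p.1 = j ∨ p.2 = j)),
        |Function.update x j t p.1 - Function.update x j t p.2| ^ β =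
      ∏ p ∈ (Finset.univ.filter (fun p : Fin n × Fin n => p.1 < p.2)).filter
        (fun p => ¬ (p.1 = j ∨ p.2 = j)), |x p.1 - x p.2| ^ β := by
    refine Finset.prod_congr rfl fun p hp => ?_
    have := (Finset.mem_filter.1 hp).2
    push Not at this
    rw [Function.update_of_ne this.1, Function.update_of_ne this.2]
  have h2 : ∏ k ∈ Finset.univ.erase j,
        |Function.update x j t j - Function.update x j t k| ^ β =
      (∏ k ∈ Finset.univ.erase j, |x j - x k| ^ β) *
        (∏ k ∈ Finset.univ.erase j, |t - x k| / |x j - x k|) ^ β := by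
    rw [← Real.finsetProd_rpow _ _ (fun i _ => by positivity), ← Finset.prod_mul_distrib]
    refine Finset.prod_congr rfl fun k hk => ?_
    have hk := Finset.ne_of_mem_erase hk
    have hne : 0 < |x j - x k| := abs_pos.2 (sub_ne_zero.2 (fun h => hk (hx h).symm))
    rw [Function.update_self, Function.update_of_ne hk, ← Real.mul_rpow hne.le (by positivity),
      mul_div_cancel₀ _ hne.ne']
  have h3 : ∑ k, (Function.update x j t k) ^ 2 / 2 = ∑ k, x k ^ 2 / 2 + (t ^ 2 - x j ^ 2) / 2 := by
    rw [← Finset.add_sum_erase _ _ (Finset.mem_univ j),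
      ← Finset.add_sum_erase Finset.univ (fun k => x k ^ 2 / 2) (Finset.mem_univ j),
      Function.update_self, Finset.sum_congr rfl (fun k hk => by
        rw [Function.update_of_ne (Finset.ne_of_mem_erase hk)])]
    ring
  rw [h1, h2, h3, Real.mul_rpow (by positivity) (Real.exp_pos _).le, ← Real.exp_mul, mul_add,
    Real.exp_add, show -((n : ℝ) * β / 2) * ((t ^ 2 - x j ^ 2) / 2) =
      -(n * (t ^ 2 - x j ^ 2) / 4) * β by ring]
  ring

theorem lintegral_cauchy_mul_update {n : ℕ} (j : Fin n) {G : (Fin n → ℝ) → ℝ≥0∞}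
    (hG : Measurable G) :
    ∫⁻ x, ENNReal.ofReal ((1 + x j ^ 2)⁻¹) * ∫⁻ t : ℝ, G (Function.update x j t) =
      ENNReal.ofReal Real.pi * ∫⁻ x, G x := by
  rw [← lintegral_const_mul _ hG]
  have hH : Measurable (lmarginal (fun _ : Fin n => (volume : Measure ℝ)) {j} G) := hG.lmarginal _
  have e : ∀ (F : (Fin n → ℝ) → ℝ≥0∞) x, ∫⁻ t : ℝ, F (Function.update x j t) =
      lmarginal (fun _ : Fin n => (volume : Measure ℝ)) {j} F x := fun F x => by
    rw [lmarginal_singleton]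
  simp_rw [e]
  rw [volume_pi]
  refine lintegral_eq_of_lmarginal_eq {j} ?_ (hG.const_mul _) ?_
  · exact Measurable.mul (by fun_prop) hH
  · funext x
    rw [← e, ← e]
    have hm : Measurable fun t : ℝ => G (Function.update x j t) := hG.comp (measurable_update x)
    rw [lintegral_const_mul _ hm, e]
    simp_rw [lmarginal_update_of_mem _ (Finset.mem_singleton_self j), Function.update_self]
    rw [lintegral_mul_const _ (by fun_prop),
      ← ofReal_integral_eq_lintegral_ofReal integrable_inv_one_add_sq
        (ae_of_all _ fun t => by positivity), integral_univ_inv_one_add_sq]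

theorem measurable_lintegral_weightedLagrange {n : ℕ} (β : ℝ) (j : Fin n) :
    Measurable fun x : Fin n → ℝ =>
      ∫⁻ t : ℝ, ENNReal.ofReal (‖weightedLagrange n x j t‖ ^ β) := by
  refine Measurable.lintegral_prod_right'
    (f := fun p : (Fin n → ℝ) × ℝ => ENNReal.ofReal (‖weightedLagrange n p.1 j p.2‖ ^ β)) ?_
  simp_rw [norm_weightedLagrange_ofReal]
  have h (k : Fin n) : Measurable fun p : (Fin n → ℝ) × ℝ => p.1 k :=
    (measurable_pi_apply k).comp measurable_fst
  fun_prop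

theorem lintegral_cauchy_mul_weightedLagrange_le {n : ℕ} {β Z : ℝ} (hβ : 0 < β) (hZ : 0 < Z)
    {μ : Measure (Fin n → ℝ)} [IsProbabilityMeasure μ]
    (hμ : μ = volume.withDensity (fun x => ENNReal.ofReal (gaussianDensity n β x / Z)))
    (j : Fin n) :
    ∫⁻ x, ENNReal.ofReal ((1 + x j ^ 2)⁻¹) *
      (∫⁻ t : ℝ, ENNReal.ofReal (‖weightedLagrange n x j t‖ ^ β)) ∂μ ≤ ENNReal.ofReal Real.pi := by
  have hG : Measurable fun x : Fin n → ℝ => ENNReal.ofReal (gaussianDensity n β x / Z) :=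
    ((measurable_gaussianDensity n β).div_const Z).ennreal_ofReal
  have hone : ∫⁻ x : Fin n → ℝ, ENNReal.ofReal (gaussianDensity n β x / Z) = 1 := by
    have h := measure_univ (μ := μ)
    rwa [hμ, withDensity_apply _ MeasurableSet.univ, Measure.restrict_univ] at h
  have hW : Measurable fun x : Fin n → ℝ => ENNReal.ofReal ((1 + x j ^ 2)⁻¹) *
      ∫⁻ t : ℝ, ENNReal.ofReal (‖weightedLagrange n x j t‖ ^ β) :=
    Measurable.mul (by fun_prop) (measurable_lintegral_weightedLagrange β j)
  calc _ = ∫⁻ x : Fin n → ℝ, ENNReal.ofReal (gaussianDensity n β x / Z) *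
        (ENNReal.ofReal ((1 + x j ^ 2)⁻¹) *
          ∫⁻ t : ℝ, ENNReal.ofReal (‖weightedLagrange n x j t‖ ^ β)) := by
        rw [hμ, lintegral_withDensity_eq_lintegral_mul _ hG hW]
        rfl
    _ ≤ ∫⁻ x : Fin n → ℝ, ENNReal.ofReal ((1 + x j ^ 2)⁻¹) *
        ∫⁻ t : ℝ, ENNReal.ofReal (gaussianDensity n β (Function.update x j t) / Z) := by
        refine lintegral_mono fun x => ?_
        rw [mul_left_comm, ← lintegral_const_mul' _ _ ENNReal.ofReal_ne_top]
        refine mul_le_mul_right (lintegral_mono fun t => ?_) _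
        rw [← ENNReal.ofReal_mul (div_nonneg (gaussianDensity_nonneg ..) hZ.le), div_mul_eq_mul_div]
        exact ENNReal.ofReal_le_ofReal (div_le_div_of_nonneg_right
          (gaussianDensity_mul_weightedLagrange_le hβ x j t) hZ.le)
    _ = ENNReal.ofReal Real.pi := by rw [lintegral_cauchy_mul_update j hG, hone, mul_one]

theorem measure_weightedLagrange_le {n : ℕ} (hn : n ≠ 0) {β Z : ℝ} (hβ : 0 < β) (hZ : 0 < Z)
    {μ : Measure (Fin n → ℝ)} [IsProbabilityMeasure μ]
    (hμ : μ = volume.withDensity (fun x => ENNReal.ofReal (gaussianDensity n β x / Z))) :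
    μ {x | ∃ j, ENNReal.ofReal ((n : ℝ) ^ 3 * (1 + x j ^ 2)) <
      ∫⁻ t : ℝ, ENNReal.ofReal (‖weightedLagrange n x j t‖ ^ β)} ≤
      ENNReal.ofReal (Real.pi / (n : ℝ) ^ 2) := by
  have hn0 : (0 : ℝ) < n := by exact_mod_cast Nat.pos_of_ne_zero hn
  have hj (j : Fin n) : μ {x | ENNReal.ofReal ((n : ℝ) ^ 3 * (1 + x j ^ 2)) <
      ∫⁻ t : ℝ, ENNReal.ofReal (‖weightedLagrange n x j t‖ ^ β)} ≤
      ENNReal.ofReal (Real.pi / (n : ℝ) ^ 3) := by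
    rw [ENNReal.ofReal_div_of_pos (by positivity)]
    refine le_trans (measure_mono ?_) ((meas_ge_le_lintegral_div (μ := μ)
      (f := fun x => ENNReal.ofReal ((1 + x j ^ 2)⁻¹) *
        ∫⁻ t : ℝ, ENNReal.ofReal (‖weightedLagrange n x j t‖ ^ β))
      (Measurable.aemeasurable <|
        Measurable.mul (by fun_prop) (measurable_lintegral_weightedLagrange β j))
      (by simpa using hn) ENNReal.ofReal_ne_top).trans
      (ENNReal.div_le_div_right (lintegral_cauchy_mul_weightedLagrange_le hβ hZ hμ j) _))
    intro x hx
    rw [Set.mem_ofPred_eq] at hx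
    have hp : 0 < 1 + x j ^ 2 := by positivity
    rw [Set.mem_ofPred_eq]
    calc ENNReal.ofReal ((n : ℝ) ^ 3)
        = ENNReal.ofReal ((1 + x j ^ 2)⁻¹) * ENNReal.ofReal ((n : ℝ) ^ 3 * (1 + x j ^ 2)) := by
          rw [← ENNReal.ofReal_mul (by positivity)]
          congr 1; field_simp
      _ ≤ _ := mul_le_mul_right hx.le _
  rw [Set.ofPred_exists]
  calc _ ≤ ∑ j : Fin n, _ := measure_iUnion_fintype_le _ _
    _ ≤ ∑ _j : Fin n, ENNReal.ofReal (Real.pi / (n : ℝ) ^ 3) := Finset.sum_le_sum fun j _ => hj j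
    _ = _ := by
      rw [Finset.sum_const, Finset.card_univ, Fintype.card_fin, nsmul_eq_mul,
        ← ENNReal.ofReal_natCast, ← ENNReal.ofReal_mul (by positivity)]
      congr 1; field_simp

theorem measure_not_injective_eq_zero {n : ℕ} {β Z : ℝ} (hβ : 0 < β)
    {μ : Measure (Fin n → ℝ)}
    (hμ : μ = volume.withDensity (fun x => ENNReal.ofReal (gaussianDensity n β x / Z))) :
    μ {x | ¬ Function.Injective x} = 0 := by
  have hG : Measurable fun x : Fin n → ℝ => ENNReal.ofReal (gaussianDensity n β x / Z) :=
    ((measurable_gaussianDensity n β).div_const Z).ennreal_ofReal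
  rw [hμ, withDensity_apply_eq_zero hG]
  convert measure_empty (μ := volume)
  ext x
  simp only [Set.mem_inter_iff, Set.mem_ofPred_eq, Set.mem_empty_iff_false, iff_false, not_and,
    not_not]
  intro h
  by_contra hx
  simp [gaussianDensity_eq_zero hβ hx] at h

theorem measurableSet_not_injective (n : ℕ) :
    MeasurableSet {x : Fin n → ℝ | ¬ Function.Injective x} := by
  unfold Function.Injective
  measurability

theorem ae_eventually_lagrangeBounded
    {β : ℕ → ℝ} (hβpos : ∀ n, 0 < β n) {c₀ : ℝ} (hc₀ : 0 < c₀)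
    (hfreeze : ∀ᶠ n : ℕ in atTop, c₀ * Real.log n ≤ β n)
    {Z : ℕ → ℝ} (hZ : ∀ n, 0 < Z n) {μ : (n : ℕ) → Measure (Fin n → ℝ)}
    (hμ : ∀ n, μ n =
      volume.withDensity (fun x => ENNReal.ofReal (gaussianDensity n (β n) x / Z n)))
    (hμprob : ∀ n, IsProbabilityMeasure (μ n)) {P : Measure ((n : ℕ) → Fin n → ℝ)}
    (hP : ∀ n (A : Set (Fin n → ℝ)), MeasurableSet A → P {ω | ω n ∈ A} = μ n A) :
    ∀ᵐ ω ∂P, ∀ᶠ n in atTop, Function.Injective (ω n) ∧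
      LagrangeBounded n (ω n) (10 * (6 * Real.exp 6 * Real.exp (5 / c₀))) := by
  have hinj : ∀ᵐ ω ∂P, ∀ n, Function.Injective (ω n) := by
    rw [ae_all_iff]
    intro n
    rw [ae_iff]
    exact (hP n _ (measurableSet_not_injective n)).trans
      (measure_not_injective_eq_zero (hβpos n) (hμ n))
  have hbad := ae_eventually_notMem (μ := P) (s := fun n => {ω | ω n ∈ {x : Fin n → ℝ |
    ∃ j, ENNReal.ofReal ((n : ℝ) ^ 3 * (1 + x j ^ 2)) <
      ∫⁻ t : ℝ, ENNReal.ofReal (‖weightedLagrange n x j t‖ ^ β n)}}) (by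
    refine ne_top_of_le_ne_top (b := ∑' n : ℕ, ENNReal.ofReal (Real.pi / (n : ℝ) ^ 2))
      (Summable.tsum_ofReal_ne_top ?_) (ENNReal.tsum_le_tsum fun n => ?_)
    · simp_rw [div_eq_mul_inv]
      exact (Real.summable_nat_pow_inv.2 (by norm_num)).mul_left _
    · rw [hP n]
      · rcases eq_or_ne n 0 with rfl | hn
        · simp
        · exact measure_weightedLagrange_le hn (hβpos n) (hZ n) (hμ n)
      · rw [Set.ofPred_exists]
        exact MeasurableSet.iUnion fun j => measurableSet_lt (by fun_prop)
          (measurable_lintegral_weightedLagrange (β n) j))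
  have hβ1 : ∀ᶠ n in atTop, 1 ≤ β n := by
    have hlog : Tendsto (fun n : ℕ => c₀ * Real.log n) atTop atTop :=
      (Real.tendsto_log_atTop.comp tendsto_natCast_atTop_atTop).const_mul_atTop hc₀
    filter_upwards [hfreeze, hlog.eventually_ge_atTop 1] with n h1 h2 using h2.trans h1
  have hlarge : ∀ᶠ n : ℕ in atTop,
      45 * (6 * Real.exp 6 * Real.exp (5 / c₀)) < (n : ℝ) ^ 2 :=
    ((tendsto_pow_atTop two_ne_zero).comp tendsto_natCast_atTop_atTop).eventually_gt_atTop _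
  filter_upwards [hinj, hbad] with ω h1 h2
  filter_upwards [h2, hfreeze, hβ1, hlarge, eventually_ge_atTop 2] with n h3 h4 h5 h6 h7
  refine ⟨h1 n, lagrangeBounded_of_lintegral_le h7 h5 hc₀ h4 (h1 n) h6 fun j => ?_⟩
  by_contra hj
  exact h3 ⟨j, not_le.1 hj⟩

theorem countIn_Ioo_two (n : ℕ) (x : Fin n → ℝ) (r : ℝ) :
    countIn n x (Set.Ioo (2 - r) (2 + r)) = edgeCount n x r := by
  unfold countIn edgeCount
  rw [← Set.ncard_coe_finset]
  congr 1
  ext k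
  simp only [Set.mem_ofPred_eq, Set.mem_Ioo, Finset.coe_filter, Finset.mem_univ, true_and, abs_lt]
  constructor <;> rintro ⟨h1, h2⟩ <;> constructor <;> linarith

theorem countIn_Ioo_neg_two (n : ℕ) (x : Fin n → ℝ) (r : ℝ) :
    countIn n x (Set.Ioo (-2 - r) (-2 + r)) = edgeCount n (fun k => -x k) r := by
  rw [← countIn_Ioo_two]
  unfold countIn
  congr 1
  ext k
  simp only [Set.mem_ofPred_eq, Set.mem_Ioo]
  constructor <;> rintro ⟨h1, h2⟩ <;> constructor <;> linarith

theorem tendsto_limsup_liminf_of_eventually_close {f : ℝ → ℕ → ℝ} {a : ℝ}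
    (h : ∀ ε > 0, ∃ L₀, ∀ L, L₀ ≤ L → ∀ᶠ n in atTop, |f L n - a| ≤ ε) :
    Tendsto (fun L => limsup (f L) atTop) atTop (𝓝 a) ∧
      Tendsto (fun L => liminf (f L) atTop) atTop (𝓝 a) := by
  simp only [Metric.tendsto_atTop, Real.dist_eq]
  have key : ∀ ε > 0, ∃ L₀, ∀ L, L₀ ≤ L →
      |limsup (f L) atTop - a| < ε ∧ |liminf (f L) atTop - a| < ε := by
    intro ε hε
    obtain ⟨L₀, hL₀⟩ := h (ε / 2) (by positivity)
    refine ⟨L₀, fun L hL => ?_⟩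
    have hle : ∀ᶠ n in atTop, f L n ≤ a + ε / 2 := by
      filter_upwards [hL₀ L hL] with n hn; linarith [(abs_le.1 hn).2]
    have hge : ∀ᶠ n in atTop, a - ε / 2 ≤ f L n := by
      filter_upwards [hL₀ L hL] with n hn; linarith [(abs_le.1 hn).1]
    have hb : IsBoundedUnder (· ≤ ·) atTop (f L) := isBoundedUnder_of_eventually_le hle
    have hb' : IsBoundedUnder (· ≥ ·) atTop (f L) := isBoundedUnder_of_eventually_ge hge
    have h1 : limsup (f L) atTop ≤ a + ε / 2 := limsup_le_of_le hb'.isCoboundedUnder_le hle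
    have h2 : a - ε / 2 ≤ liminf (f L) atTop := le_liminf_of_le hb.isCoboundedUnder_ge hge
    have h3 : liminf (f L) atTop ≤ limsup (f L) atTop := liminf_le_limsup hb hb'
    constructor <;> rw [abs_lt] <;> constructor <;> linarith
  exact ⟨fun ε hε => (key ε hε).imp fun _ h L hL => (h L hL).1,
    fun ε hε => (key ε hε).imp fun _ h L hL => (h L hL).2⟩

theorem edgeCount_div_close {C : ℝ} (hC : 1 ≤ C) {x : (n : ℕ) → Fin n → ℝ}
    (hx : ∀ᶠ n in atTop, Function.Injective (x n) ∧ LagrangeBounded n (x n) C) {ε : ℝ}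
    (hε : 0 < ε) : ∃ L₀, ∀ L, L₀ ≤ L → ∀ᶠ n : ℕ in atTop,
      |(edgeCount n (x n) ((L / n) ^ ((2 : ℝ) / 3)) : ℝ) / L - 2 / (3 * Real.pi)| ≤ ε := by
  obtain ⟨s₀, hs₀, H⟩ := exists_edgeCount_close hC hε
  refine ⟨s₀ ^ 3, fun L hL => ?_⟩
  have hL0 : 0 < L := lt_of_lt_of_le (by positivity) hL
  set s := L ^ ((1 : ℝ) / 3) with hs
  have hs3 : s ^ 3 = L := by
    rw [hs, ← Real.rpow_natCast, ← Real.rpow_mul hL0.le]; norm_num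
  have hs2 : s ^ 2 = L ^ ((2 : ℝ) / 3) := by
    rw [hs, ← Real.rpow_natCast, ← Real.rpow_mul hL0.le]; norm_num
  have hsp : 0 < s := Real.rpow_pos_of_pos hL0 _
  obtain ⟨h₀, hh₀, H⟩ := H s (by
    rw [← hs3] at hL
    exact le_of_pow_le_pow_left₀ (by norm_num) hsp.le hL)
  have hlim : Tendsto (fun n : ℕ => (n : ℝ) ^ (-((2 : ℝ) / 3))) atTop (𝓝 0) :=
    (tendsto_rpow_neg_atTop (by norm_num)).comp tendsto_natCast_atTop_atTop
  filter_upwards [hx, hlim.eventually_le_const hh₀, eventually_gt_atTop 0] with n hn hnh hn0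
  have hn0 : (0 : ℝ) < n := by exact_mod_cast hn0
  have h := H n _ (Real.rpow_pos_of_pos hn0 _) hnh (by
    rw [← Real.rpow_natCast, ← Real.rpow_natCast, ← Real.rpow_mul hn0.le, ← Real.rpow_add hn0]
    norm_num) (x n) hn.1 hn.2
  have hr : s ^ 2 * (n : ℝ) ^ (-((2 : ℝ) / 3)) = (L / n) ^ ((2 : ℝ) / 3) := by
    rw [hs2, Real.div_rpow hL0.le hn0.le, Real.rpow_neg hn0.le, ← div_eq_mul_inv]
  rw [hr, hs3] at h
  have e : (edgeCount n (x n) ((L / n) ^ ((2 : ℝ) / 3)) : ℝ) / L - 2 / (3 * Real.pi) =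
      (Real.pi * edgeCount n (x n) ((L / n) ^ ((2 : ℝ) / 3)) - 2 / 3 * L) / (Real.pi * L) := by
    field_simp
  have hpi : 1 ≤ Real.pi := by linarith [Real.pi_gt_three]
  rw [e, abs_div, abs_of_pos (by positivity : 0 < Real.pi * L), div_le_iff₀ (by positivity)]
  nlinarith [mul_pos hε hL0]

/-- Edge Beurling-Landau densities equal `2/(3π)` in the perfect freezing regime. -/
theorem edge_equidistribution
    (β : ℕ → ℝ) (hβpos : ∀ n, 0 < β n)
    (c₀ : ℝ) (hc₀ : 0 < c₀)
    (hfreeze : ∀ᶠ n : ℕ in atTop, c₀ * Real.log n ≤ β n)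
    (Z : ℕ → ℝ) (hZ : ∀ n, 0 < Z n)
    (μ : (n : ℕ) → Measure (Fin n → ℝ))
    (hμ : ∀ n, μ n =
      volume.withDensity (fun x => ENNReal.ofReal (gaussianDensity n (β n) x / Z n)))
    (hμprob : ∀ n, IsProbabilityMeasure (μ n))
    (P : Measure ((n : ℕ) → Fin n → ℝ)) (hPprob : IsProbabilityMeasure P)
    (hP : ∀ (S : Finset ℕ) (A : (n : ℕ) → Set (Fin n → ℝ)),
      (∀ n ∈ S, MeasurableSet (A n)) →
      P {ω | ∀ n ∈ S, ω n ∈ A n} = ∏ n ∈ S, μ n (A n))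
    :
    ∀ᵐ ω ∂P, ∀ x ∈ ({2, -2} : Set ℝ),
      Tendsto (fun L : ℝ => Filter.limsup
          (fun n : ℕ => (countIn n (ω n)
            (Set.Ioo (x - (L / n) ^ ((2 : ℝ) / 3)) (x + (L / n) ^ ((2 : ℝ) / 3))) : ℝ) / L)
          atTop) atTop (nhds (2 / (3 * Real.pi))) ∧
      Tendsto (fun L : ℝ => Filter.liminf
          (fun n : ℕ => (countIn n (ω n)
            (Set.Ioo (x - (L / n) ^ ((2 : ℝ) / 3)) (x + (L / n) ^ ((2 : ℝ) / 3))) : ℝ) / L)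
          atTop) atTop (nhds (2 / (3 * Real.pi))) := by
  have hmarg (n : ℕ) (A : Set (Fin n → ℝ)) (hA : MeasurableSet A) :
      P {ω | ω n ∈ A} = μ n A := by
    have h := hP {n} (Function.update (fun _ => ∅) n A) (by simpa using hA)
    simpa using h
  have he6 : 1 ≤ Real.exp 6 := Real.one_le_exp (by norm_num)
  have he5 : 1 ≤ Real.exp (5 / c₀) := Real.one_le_exp (by positivity)
  have hC : 1 ≤ 10 * (6 * Real.exp 6 * Real.exp (5 / c₀)) := by
    nlinarith [mul_le_mul he6 he5 zero_le_one (by linarith)]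
  filter_upwards [ae_eventually_lagrangeBounded hβpos hc₀ hfreeze hZ hμ hμprob hmarg] with ω hω
  rintro x (rfl | rfl)
  · simp_rw [countIn_Ioo_two]
    exact tendsto_limsup_liminf_of_eventually_close fun ε hε => edgeCount_div_close hC hω hε
  · simp_rw [countIn_Ioo_neg_two]
    refine tendsto_limsup_liminf_of_eventually_close fun ε hε =>
      edgeCount_div_close (x := fun n k => -ω n k) hC ?_ hε
    filter_upwards [hω] with n hn
    exact ⟨fun a b hab => hn.1 (neg_injective hab), hn.2.neg⟩
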